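/- Let Ω be the open unit disc. Then there exist constants C₀, δ₀ ∈ ℝ and C, B₀ > 0 such that, setting Δ_B = inf_{m∈ℤ} |m − B/2 − ξ₀·√B − δ₀|, one has |λ₁(B) − ( Θ₀·B − C₁·√B + 3·C₁·√Θ₀·(Δ_B² + C₀) )| ≤ C·B^{−1/2} for all B ≥ B₀. -/

import Mathlib

open MeasureTheory Filter Set Topology

noncomputable section

namespace SC

/-- The plane `ℝ²`. -/
abbrev Plane := ℝ × ℝ

/-- Squared Euclidean norm on the plane. -/
def esq (v : Plane) : ℝ := v.1 ^ 2 + v.2 ^ 2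

/-- Euclidean dot product on the plane. -/
def dot2 (v w : Plane) : ℝ := v.1 * w.1 + v.2 * w.2

/-- The reference vector potential `F₀(x) = (-x₂/2, x₁/2)`, with `curl F₀ = 1`. -/
def F0 : Plane → Plane := fun x => (-x.2 / 2, x.1 / 2)

/-- `u` is of class `Cⁿ` on a neighborhood of the closure of `Ω`. -/
def CNearCl {E : Type*} [NormedAddCommGroup E] [NormedSpace ℝ E]
    (n : ℕ) (Ω : Set Plane) (u : Plane → E) : Prop :=
  ∃ U : Set Plane, IsOpen U ∧ closure Ω ⊆ U ∧ ContDiffOn ℝ n u U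

/-- The pointwise squared magnetic gradient `|(-i∇ - B·A)u|²`. -/
def magSq (B : ℝ) (A : Plane → Plane) (u : Plane → ℂ) (x : Plane) : ℝ :=
  ‖(-Complex.I) * fderiv ℝ u x ((1 : ℝ), (0 : ℝ)) - ((B * (A x).1 : ℝ) : ℂ) * u x‖ ^ 2 +
  ‖(-Complex.I) * fderiv ℝ u x ((0 : ℝ), (1 : ℝ)) - ((B * (A x).2 : ℝ) : ℂ) * u x‖ ^ 2

/-- `curl A = ∂₁A₂ - ∂₂A₁`. -/
def curl2 (A : Plane → Plane) (x : Plane) : ℝ :=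
  fderiv ℝ (fun y => (A y).2) x ((1 : ℝ), (0 : ℝ)) -
    fderiv ℝ (fun y => (A y).1) x ((0 : ℝ), (1 : ℝ))

/-- The variational ground state energy `λ₁(B·A)` of the magnetic Neumann Laplacian. -/
def lam1A (Ω : Set Plane) (B : ℝ) (A : Plane → Plane) : ℝ :=
  sInf { r : ℝ | ∃ u : Plane → ℂ, CNearCl 1 Ω u ∧ (∫ x in Ω, ‖u x‖ ^ 2) ≠ 0 ∧
    r = (∫ x in Ω, magSq B A u x) / (∫ x in Ω, ‖u x‖ ^ 2) }

/-- `λ₁(B) = λ₁(B·F₀)`. -/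
def lam1 (Ω : Set Plane) (B : ℝ) : ℝ := lam1A Ω B F0

/-- The Ginzburg–Landau energy functional. -/
def GLenergy (Ω : Set Plane) (κ H : ℝ) (ψ : Plane → ℂ) (A : Plane → Plane) : ℝ :=
  ∫ x in Ω, (magSq (κ * H) A ψ x - κ ^ 2 * ‖ψ x‖ ^ 2 + κ ^ 2 / 2 * ‖ψ x‖ ^ 4
    + κ ^ 2 * H ^ 2 * (curl2 A x - 1) ^ 2)

/-- Admissible Ginzburg–Landau configurations. -/
def GLadm (Ω : Set Plane) (ψ : Plane → ℂ) (A : Plane → Plane) : Prop :=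
  CNearCl 1 Ω ψ ∧ CNearCl 1 Ω A

/-- The normal state is a minimizer at `(κ, H)`. -/
def NormalMin (Ω : Set Plane) (κ H : ℝ) : Prop :=
  ∀ ψ A, GLadm Ω ψ A → 0 ≤ GLenergy Ω κ H ψ A

/-- The normal state is the unique minimizer at `(κ, H)`. -/
def NormalUnique (Ω : Set Plane) (κ H : ℝ) : Prop :=
  NormalMin Ω κ H ∧
  ∀ ψ A, GLadm Ω ψ A → (∫ x in Ω, ‖ψ x‖ ^ 2) ≠ 0 → 0 < GLenergy Ω κ H ψ A

/-- `(ψ, A)` is a minimizer of the Ginzburg–Landau energy at `(κ, H)`. -/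
def IsGLMin (Ω : Set Plane) (κ H : ℝ) (ψ : Plane → ℂ) (A : Plane → Plane) : Prop :=
  GLadm Ω ψ A ∧ ∀ ψ' A', GLadm Ω ψ' A' → GLenergy Ω κ H ψ A ≤ GLenergy Ω κ H ψ' A'

/-- Lower global critical field. -/
def HC3low (Ω : Set Plane) (κ : ℝ) : ℝ := sInf {H : ℝ | 0 < H ∧ NormalMin Ω κ H}

/-- Upper global critical field. -/
def HC3up (Ω : Set Plane) (κ : ℝ) : ℝ :=
  sInf {H : ℝ | 0 < H ∧ ∀ H', H < H' → NormalUnique Ω κ H'}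

/-- Lower local critical field. -/
def HlocLow (Ω : Set Plane) (κ : ℝ) : ℝ :=
  sInf {H : ℝ | 0 < H ∧ κ ^ 2 ≤ lam1 Ω (κ * H)}

/-- Upper local critical field. -/
def HlocUp (Ω : Set Plane) (κ : ℝ) : ℝ :=
  sInf {H : ℝ | 0 < H ∧ ∀ H', H < H' → κ ^ 2 ≤ lam1 Ω (κ * H')}

/-- The inward unit normal `ν(s) = (-γ₂'(s), γ₁'(s))`. -/
def nuVec (γ : ℝ → Plane) (s : ℝ) : Plane := (-(deriv γ s).2, (deriv γ s).1)

/-- The curvature `k(s) = ⟨γ''(s), ν(s)⟩`. -/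
def curvOf (γ : ℝ → Plane) (s : ℝ) : ℝ := dot2 (deriv (deriv γ) s) (nuVec γ s)

/-- The maximal curvature. -/
def kmaxOf (γ : ℝ → Plane) : ℝ := sSup (Set.range (curvOf γ))

/-- A smooth counterclockwise arclength parametrization of the boundary of `Ω`. -/
structure BoundaryParam (Ω : Set Plane) where
  γ : ℝ → Plane
  L : ℝ
  L_pos : 0 < L
  smooth : ContDiff ℝ (⊤ : ℕ∞) γ
  periodic : Function.Periodic γ L
  unit_speed : ∀ s, esq (deriv γ s) = 1
  injOn : Set.InjOn γ (Set.Ico 0 L)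
  range_eq : Set.range γ = frontier Ω
  inward : ∀ s, ∃ ε > 0, ∀ t ∈ Set.Ioo (0 : ℝ) ε, γ s + t • nuVec γ s ∈ Ω

/-- The non-degeneracy assumption: finitely many points of maximal curvature,
all of them non-degenerate maxima. -/
def NonDegen {Ω : Set Plane} (P : BoundaryParam Ω) : Prop :=
  ∃ (N : ℕ) (s : Fin N → ℝ), 0 < N ∧ (∀ j, s j ∈ Set.Ico 0 P.L) ∧
    (∀ j, curvOf P.γ (s j) = kmaxOf P.γ) ∧
    (∀ t ∈ Set.Ico 0 P.L, (∀ j, t ≠ s j) → curvOf P.γ t < kmaxOf P.γ) ∧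
    (∀ j, deriv (deriv (curvOf P.γ)) (s j) < 0)

/-- The ground state energy `μ(ζ)` of the de Gennes half-line model operator. -/
def muGen (ζ : ℝ) : ℝ :=
  sInf { r : ℝ | ∃ φ : ℝ → ℝ, ContDiff ℝ 1 φ ∧ HasCompactSupport φ ∧
    (∃ τ, 0 < τ ∧ φ τ ≠ 0) ∧
    r = (∫ τ in Set.Ioi (0 : ℝ), ((deriv φ τ) ^ 2 + (τ + ζ) ^ 2 * (φ τ) ^ 2)) /
        (∫ τ in Set.Ioi (0 : ℝ), (φ τ) ^ 2) }

/-- The de Gennes constant `Θ₀`. -/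
def Theta0 : ℝ := sInf (Set.range muGen)

/-- Standard facts about the de Gennes constant, taken as hypotheses. -/
structure DeGennes where
  ξ₀ : ℝ
  u₀ : ℝ → ℝ
  theta_lb : 1 / 2 < Theta0
  theta_ub : Theta0 < 1
  ξ₀_mem : ξ₀ ∈ Set.Ioo (-1 : ℝ) 0
  ξ₀_min : muGen ξ₀ = Theta0
  ξ₀_uniq : ∀ ζ, muGen ζ = Theta0 → ζ = ξ₀
  ξ₀_sq : ξ₀ ^ 2 = Theta0
  u₀_pos : ∀ τ, 0 ≤ τ → 0 < u₀ τ
  u₀_smooth : ContDiffOn ℝ 2 u₀ (Set.Ici 0)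
  u₀_sq_int : IntegrableOn (fun τ => (u₀ τ) ^ 2) (Set.Ioi 0)
  u₀_normalized : (∫ τ in Set.Ioi (0 : ℝ), (u₀ τ) ^ 2) = 1
  u₀_neumann : derivWithin u₀ (Set.Ici 0) 0 = 0
  u₀_ode : ∀ τ ∈ Set.Ioi (0 : ℝ),
    -(deriv (deriv u₀) τ) + (τ + ξ₀) ^ 2 * u₀ τ = Theta0 * u₀ τ

/-- The universal constant `C₁ = u₀(0)²/3`. -/
def DeGennes.C1 (D : DeGennes) : ℝ := (D.u₀ 0) ^ 2 / 3

/-- Condition (★) on a vector field `A` at field strength `B` with constant `C₀`. -/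
def StarCond (Ω : Set Plane) (C₀ B : ℝ) (A : Plane → Plane) : Prop :=
  CNearCl 2 Ω A ∧
  (∀ x ∈ closure Ω, ‖A x‖ ≤ C₀) ∧
  (∀ x ∈ closure Ω, ‖fderiv ℝ A x‖ ≤ C₀) ∧
  (∀ x ∈ closure Ω, ‖fderiv ℝ (fderiv ℝ A) x‖ ≤ C₀) ∧
  (∀ x ∈ closure Ω, |curl2 A x - 1| ≤ C₀ * B ^ (-(1 : ℝ) / 4)) ∧
  (∀ x ∈ closure Ω, ‖fderiv ℝ (curl2 A) x‖ ≤ C₀ * B ^ (-(1 : ℝ) / 4)) ∧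
  (∀ x ∈ frontier Ω, curl2 A x = 1)

/-- The open unit disc. -/
def unitDisc : Set Plane := {x : Plane | x.1 ^ 2 + x.2 ^ 2 < 1}

/-- `Δ_B`: distance from `B/2 + ξ₀√B + δ₀` to the nearest integer. -/
def DeltaB (ξ₀ δ₀ B : ℝ) : ℝ :=
  sInf (Set.range (fun m : ℤ => |(m : ℝ) - B / 2 - ξ₀ * Real.sqrt B - δ₀|))

/-- Euclidean distance to the boundary of `Ω`. -/
def distBdry (Ω : Set Plane) (x : Plane) : ℝ :=
  sInf ((fun y => Real.sqrt (esq (x - y))) '' frontier Ω)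

end SC

namespace SC

/-- The even extension `v` of the de Gennes ground state to the line, together with its
logarithmic derivative `q`. -/
structure Profile where
  ξ : ℝ
  v : ℝ → ℝ
  q : ℝ → ℝ
  ξ_neg : ξ < 0
  ξ_gt : -1 < ξ
  v_pos : ∀ t, 0 < v t
  v_deriv : ∀ t, HasDerivAt v (q t * v t) t
  q_deriv : ∀ t, HasDerivAt q ((|t| + ξ) ^ 2 - ξ ^ 2 - q t ^ 2) t
  q_zero : q 0 = 0
  v_int : IntegrableOn (fun t => v t ^ 2) (Ioi 0)
  v_norm : ∫ t in Ioi (0 : ℝ), v t ^ 2 = 1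

namespace DeGennes

variable (D : DeGennes)

theorem hasDerivAt_u₀ {t : ℝ} (ht : 0 < t) :
    HasDerivAt D.u₀ (derivWithin D.u₀ (Ici 0) t) t := by
  have h := (D.u₀_smooth.differentiableOn (by norm_num)) t ht.le
  exact h.hasDerivWithinAt.hasDerivAt (Ici_mem_nhds ht)

theorem continuousOn_derivWithin_u₀ : ContinuousOn (derivWithin D.u₀ (Ici 0)) (Ici 0) :=
  D.u₀_smooth.continuousOn_derivWithin (uniqueDiffOn_Ici 0) (by norm_num)

theorem hasDerivAt_derivWithin_u₀ {t : ℝ} (ht : 0 < t) :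
    HasDerivAt (derivWithin D.u₀ (Ici 0)) (((t + D.ξ₀) ^ 2 - D.ξ₀ ^ 2) * D.u₀ t) t := by
  have hev : derivWithin D.u₀ (Ici 0) =ᶠ[𝓝 t] deriv D.u₀ := by
    filter_upwards [Ioi_mem_nhds ht] with s hs
    exact (D.hasDerivAt_u₀ hs).deriv.symm
  have hc : ContDiffAt ℝ 2 D.u₀ t := (D.u₀_smooth t ht.le).contDiffAt (Ici_mem_nhds ht)
  have hd : DifferentiableAt ℝ (deriv D.u₀) t := by
    have h1 : ContDiffOn ℝ 2 D.u₀ (Ioi 0) := D.u₀_smooth.mono Ioi_subset_Ici_self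
    have h2 : ContDiffOn ℝ 1 (deriv D.u₀) (Ioi 0) :=
      h1.deriv_of_isOpen isOpen_Ioi (by norm_num)
    exact (h2.differentiableOn (by norm_num)).differentiableAt (Ioi_mem_nhds ht)
  have h := hd.hasDerivAt
  have ho := D.u₀_ode t ht
  have he : deriv (deriv D.u₀) t = ((t + D.ξ₀) ^ 2 - D.ξ₀ ^ 2) * D.u₀ t := by
    rw [D.ξ₀_sq]; linarith
  rw [he] at h
  exact h.congr_of_eventuallyEq hev

/-- The even extension of the derivative data of `u₀`. -/
def oddDeriv (t : ℝ) : ℝ := if 0 ≤ t then derivWithin D.u₀ (Ici 0) t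
  else -derivWithin D.u₀ (Ici 0) (-t)

theorem continuousAt_even_u₀ : ContinuousAt (fun t => D.u₀ |t|) 0 := by
  have h : ContinuousWithinAt D.u₀ (Ici 0) |(0 : ℝ)| := by
    rw [abs_zero]; exact D.u₀_smooth.continuousOn 0 self_mem_Ici
  have := h.comp_of_eq (f := fun t : ℝ => |t|) (s := univ) (x := 0)
    continuous_abs.continuousWithinAt (fun t _ => abs_nonneg t) rfl
  exact continuousWithinAt_univ _ _ |>.1 this

theorem continuousAt_oddDeriv : ContinuousAt D.oddDeriv 0 := by
  have h : ContinuousWithinAt (derivWithin D.u₀ (Ici 0)) (Ici 0) |(0 : ℝ)| := by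
    rw [abs_zero]; exact D.continuousOn_derivWithin_u₀ 0 self_mem_Ici
  have h2 := h.comp_of_eq (f := fun t : ℝ => |t|) (s := univ) (x := 0)
    continuous_abs.continuousWithinAt (fun t _ => abs_nonneg t) rfl
  have h3 : Tendsto (fun t : ℝ => derivWithin D.u₀ (Ici 0) |t|) (𝓝 0) (𝓝 0) := by
    have := (continuousWithinAt_univ _ _ |>.1 h2).tendsto
    simpa [Function.comp_def, D.u₀_neumann] using this
  have h4 : D.oddDeriv 0 = 0 := by simp [oddDeriv, D.u₀_neumann]
  unfold ContinuousAt
  rw [h4]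
  rw [tendsto_zero_iff_abs_tendsto_zero] at h3 ⊢
  refine h3.congr fun t => ?_
  unfold oddDeriv
  rcases le_or_gt 0 t with ht | ht
  · simp [ht, abs_of_nonneg ht]
  · simp [not_le.2 ht, abs_of_neg ht]

theorem hasDerivAt_even_u₀ (t : ℝ) : HasDerivAt (fun t => D.u₀ |t|) (D.oddDeriv t) t := by
  have key : ∀ t : ℝ, t ≠ 0 → HasDerivAt (fun t => D.u₀ |t|) (D.oddDeriv t) t := by
    intro t ht
    rcases lt_or_gt_of_ne ht with h | h
    · have h1 := (D.hasDerivAt_u₀ (t := -t) (by linarith)).scomp t (hasDerivAt_neg t)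
      have h2 : (fun t => D.u₀ |t|) =ᶠ[𝓝 t] (D.u₀ ∘ fun t => -t) := by
        filter_upwards [Iio_mem_nhds h] with s hs
        simp [abs_of_neg (show s < 0 from hs)]
      have h3 := h1.congr_of_eventuallyEq h2
      simpa [oddDeriv, not_le.2 h] using h3
    · have h2 : (fun t => D.u₀ |t|) =ᶠ[𝓝 t] D.u₀ := by
        filter_upwards [Ioi_mem_nhds h] with s hs
        simp [abs_of_pos (show 0 < s from hs)]
      have h3 := (D.hasDerivAt_u₀ h).congr_of_eventuallyEq h2
      simpa [oddDeriv, h.le] using h3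
  by_cases ht : t = 0
  · subst ht
    exact hasDerivAt_of_hasDerivAt_of_ne key D.continuousAt_even_u₀ D.continuousAt_oddDeriv
  · exact key t ht

theorem hasDerivAt_oddDeriv (t : ℝ) :
    HasDerivAt D.oddDeriv (((|t| + D.ξ₀) ^ 2 - D.ξ₀ ^ 2) * D.u₀ |t|) t := by
  have key : ∀ t : ℝ, t ≠ 0 →
      HasDerivAt D.oddDeriv (((|t| + D.ξ₀) ^ 2 - D.ξ₀ ^ 2) * D.u₀ |t|) t := by
    intro t ht
    rcases lt_or_gt_of_ne ht with h | h
    · have h1 := ((D.hasDerivAt_derivWithin_u₀ (t := -t) (by linarith)).scomp t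
        (hasDerivAt_neg t)).neg
      have h2 : D.oddDeriv =ᶠ[𝓝 t] (-(derivWithin D.u₀ (Ici 0) ∘ fun t => -t)) := by
        filter_upwards [Iio_mem_nhds h] with s hs
        simp [oddDeriv, not_le.2 (show s < 0 from hs)]
      have h3 := h1.congr_of_eventuallyEq h2
      simpa [abs_of_neg h] using h3
    · have h2 : D.oddDeriv =ᶠ[𝓝 t] derivWithin D.u₀ (Ici 0) := by
        filter_upwards [Ioi_mem_nhds h] with s hs
        simp [oddDeriv, (show 0 < s from hs).le]
      have h3 := (D.hasDerivAt_derivWithin_u₀ h).congr_of_eventuallyEq h2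
      simpa [abs_of_pos h] using h3
  by_cases ht : t = 0
  · subst ht
    refine hasDerivAt_of_hasDerivAt_of_ne key D.continuousAt_oddDeriv ?_
    exact ((continuous_abs.add continuous_const).pow 2 |>.sub
      continuous_const).continuousAt.mul D.continuousAt_even_u₀
  · exact key t ht

/-- The profile associated with the de Gennes data. -/
def profile : Profile where
  ξ := D.ξ₀
  v := fun t => D.u₀ |t|
  q := fun t => D.oddDeriv t / D.u₀ |t|
  ξ_neg := D.ξ₀_mem.2
  ξ_gt := D.ξ₀_mem.1
  v_pos := fun t => D.u₀_pos _ (abs_nonneg t)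
  v_deriv := fun t => by
    rw [div_mul_cancel₀ _ (D.u₀_pos _ (abs_nonneg t)).ne']
    exact D.hasDerivAt_even_u₀ t
  q_deriv := fun t => by
    have hp := (D.u₀_pos _ (abs_nonneg t)).ne'
    have := (D.hasDerivAt_oddDeriv t).div (D.hasDerivAt_even_u₀ t) hp
    exact this.congr_deriv (by field_simp)
  q_zero := by simp [oddDeriv, D.u₀_neumann]
  v_int := by
    refine D.u₀_sq_int.congr_fun (fun t ht => ?_) measurableSet_Ioi
    simp [abs_of_pos (show 0 < t from ht)]
  v_norm := by
    rw [← D.u₀_normalized]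
    refine setIntegral_congr_fun measurableSet_Ioi (fun t ht => ?_)
    simp [abs_of_pos (show 0 < t from ht)]

end DeGennes

end SC

namespace SC

theorem monotoneOn_Ici_of_hasDerivAt {f f' : ℝ → ℝ} {a : ℝ} (hc : ContinuousOn f (Ici a))
    (hf : ∀ x > a, HasDerivAt f (f' x) x) (h : ∀ x > a, 0 ≤ f' x) : MonotoneOn f (Ici a) := by
  refine monotoneOn_of_deriv_nonneg (convex_Ici a) hc ?_ ?_
  · rw [interior_Ici]
    exact fun x hx => (hf x hx).differentiableAt.differentiableWithinAt
  · rw [interior_Ici]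
    intro x hx
    rw [(hf x hx).deriv]
    exact h x hx

theorem bounded_of_tendsto {f : ℝ → ℝ} (hf : Continuous f) {l : ℝ}
    (h : Tendsto f atTop (𝓝 l)) : ∃ C, 0 ≤ C ∧ ∀ t, 0 ≤ t → |f t| ≤ C := by
  have h1 : ∀ᶠ t in atTop, |f t| ≤ |l| + 1 :=
    (h.abs.eventually_lt_const (lt_add_one _)).mono fun _ h => h.le
  obtain ⟨T, hT⟩ := eventually_atTop.1 h1
  obtain ⟨C, hC⟩ := isCompact_Icc.exists_bound_of_continuousOn (s := Icc 0 T) hf.continuousOn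
  refine ⟨max C (|l| + 1), le_max_of_le_right (by positivity), fun t ht => ?_⟩
  rcases le_total t T with h | h
  · exact le_max_of_le_left (hC t ⟨ht, h⟩)
  · exact le_max_of_le_right (hT t h)

/-- Polynomial growth on the half-line. -/
def PolyGrowth (F : ℝ → ℝ) : Prop :=
  ∃ C : ℝ, ∃ N : ℕ, 0 ≤ C ∧ ∀ t, 0 ≤ t → |F t| ≤ C * (1 + t ^ 2) ^ N

theorem one_le_one_add_sq (t : ℝ) : 1 ≤ 1 + t ^ 2 := by nlinarith [sq_nonneg t]

namespace PolyGrowth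

variable {F G : ℝ → ℝ}

theorem const (c : ℝ) : PolyGrowth fun _ => c :=
  ⟨|c|, 0, abs_nonneg c, fun t _ => by simp⟩

theorem id : PolyGrowth fun t => t :=
  ⟨1, 1, zero_le_one, fun t _ => by
    rw [abs_le]; constructor <;> nlinarith [sq_nonneg (t - 1), sq_nonneg (t + 1)]⟩

theorem abs : PolyGrowth fun t => |t| :=
  ⟨1, 1, zero_le_one, fun t _ => by
    rw [abs_abs, abs_le]; constructor <;> nlinarith [sq_nonneg (t - 1), sq_nonneg (t + 1)]⟩

theorem add (hF : PolyGrowth F) (hG : PolyGrowth G) : PolyGrowth fun t => F t + G t := by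
  obtain ⟨C, N, hC, hF⟩ := hF
  obtain ⟨C', N', hC', hG⟩ := hG
  refine ⟨C + C', max N N', by positivity, fun t ht => (abs_add_le _ _).trans ?_⟩
  have h1 := pow_le_pow_right₀ (one_le_one_add_sq t) (le_max_left N N')
  have h2 := pow_le_pow_right₀ (one_le_one_add_sq t) (le_max_right N N')
  have := mul_le_mul_of_nonneg_left h1 hC
  have := mul_le_mul_of_nonneg_left h2 hC'
  linarith [hF t ht, hG t ht]

theorem mul (hF : PolyGrowth F) (hG : PolyGrowth G) : PolyGrowth fun t => F t * G t := by
  obtain ⟨C, N, hC, hF⟩ := hF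
  obtain ⟨C', N', hC', hG⟩ := hG
  refine ⟨C * C', N + N', by positivity, fun t ht => ?_⟩
  rw [abs_mul, pow_add, mul_mul_mul_comm]
  exact mul_le_mul (hF t ht) (hG t ht) (abs_nonneg _) (by positivity)

theorem neg (hF : PolyGrowth F) : PolyGrowth fun t => -F t := by
  obtain ⟨C, N, hC, hF⟩ := hF
  exact ⟨C, N, hC, fun t ht => by rw [abs_neg]; exact hF t ht⟩

theorem sub (hF : PolyGrowth F) (hG : PolyGrowth G) : PolyGrowth fun t => F t - G t := by
  simpa [sub_eq_add_neg] using hF.add hG.neg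

theorem pow (hF : PolyGrowth F) (n : ℕ) : PolyGrowth fun t => F t ^ n := by
  induction n with
  | zero => simpa using const 1
  | succ n ih => simpa [pow_succ] using ih.mul hF

end PolyGrowth

namespace Profile

variable (P : Profile)

theorem continuous_v : Continuous P.v :=
  continuous_iff_continuousAt.2 fun t => (P.v_deriv t).continuousAt

theorem continuous_q : Continuous P.q :=
  continuous_iff_continuousAt.2 fun t => (P.q_deriv t).continuousAt

theorem qv_deriv (t : ℝ) :
    HasDerivAt (fun t => P.q t * P.v t) (((|t| + P.ξ) ^ 2 - P.ξ ^ 2) * P.v t) t :=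
  ((P.q_deriv t).mul (P.v_deriv t)).congr_deriv (by ring)

theorem potential_eq {t : ℝ} (ht : 0 ≤ t) : (|t| + P.ξ) ^ 2 - P.ξ ^ 2 = t * (t + 2 * P.ξ) := by
  rw [abs_of_nonneg ht]; ring

theorem q_nonpos {t : ℝ} (ht : 0 ≤ t) : P.q t ≤ 0 := by
  by_contra! hq
  have hξ := P.ξ_neg
  have hcont : Continuous fun t => P.q t * P.v t := P.continuous_q.mul P.continuous_v
  have ht2 : -2 * P.ξ ≤ t := by
    by_contra! hlt
    have hanti : AntitoneOn (fun t => P.q t * P.v t) (Icc 0 (-2 * P.ξ)) := by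
      refine antitoneOn_of_deriv_nonpos (convex_Icc _ _) hcont.continuousOn
        (fun x _ => (P.qv_deriv x).differentiableAt.differentiableWithinAt) fun x hx => ?_
      rw [interior_Icc] at hx
      rw [(P.qv_deriv x).deriv, P.potential_eq hx.1.le]
      have := P.v_pos x
      have : x * (x + 2 * P.ξ) ≤ 0 := by nlinarith [hx.1, hx.2]
      nlinarith
    have := hanti (show (0 : ℝ) ∈ Icc 0 (-2 * P.ξ) from ⟨le_rfl, by linarith⟩) ⟨ht, hlt.le⟩ ht
    simp only [P.q_zero, zero_mul] at this
    nlinarith [P.v_pos t]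
  have hmono : MonotoneOn (fun t => P.q t * P.v t) (Ici t) := by
    refine monotoneOn_Ici_of_hasDerivAt hcont.continuousOn (fun x _ => P.qv_deriv x) fun x hx => ?_
    have hx' : t < x := hx
    rw [P.potential_eq (by linarith)]
    have : 0 ≤ x * (x + 2 * P.ξ) := mul_nonneg (by linarith) (by linarith)
    exact mul_nonneg this (P.v_pos x).le
  have hvm : MonotoneOn P.v (Ici t) := by
    refine monotoneOn_Ici_of_hasDerivAt P.continuous_v.continuousOn (fun x _ => P.v_deriv x)
      fun x hx => ?_
    exact (mul_pos hq (P.v_pos t)).le.trans (hmono self_mem_Ici (le_of_lt hx) (le_of_lt hx))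
  have hint : IntegrableOn (fun _ : ℝ => P.v t ^ 2) (Ioi t) := by
    refine Integrable.mono' (P.v_int.mono_set (Ioi_subset_Ioi ht)) aestronglyMeasurable_const ?_
    filter_upwards [ae_restrict_mem measurableSet_Ioi] with x hx
    rw [Real.norm_of_nonneg (sq_nonneg _)]
    exact pow_le_pow_left₀ (P.v_pos t).le (hvm self_mem_Ici (show x ∈ Ici t from le_of_lt (show t < x from hx)) (le_of_lt (show t < x from hx))) 2
  rw [integrableOn_const_iff] at hint
  simp [(P.v_pos t).ne'] at hint

theorem v_antitone : AntitoneOn P.v (Ici 0) := by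
  have : MonotoneOn (fun t => -P.v t) (Ici 0) :=
    monotoneOn_Ici_of_hasDerivAt P.continuous_v.neg.continuousOn (fun x _ => (P.v_deriv x).neg)
      fun x hx => by nlinarith [P.v_pos x, P.q_nonpos (le_of_lt hx)]
  exact fun x hx y hy hxy => neg_le_neg_iff.1 (this hx hy hxy)

theorem q_le_neg_one {t : ℝ} (ht : 3 ≤ t) : P.q t ≤ -1 := by
  by_contra! hq
  have hξ := P.ξ_gt
  have hz : 0 < (P.q t + 1) * P.v t := mul_pos (by linarith) (P.v_pos t)
  have hd : ∀ x, HasDerivAt (fun x => (P.q x * P.v x + P.v x) * Real.exp (-x))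
      ((((|x| + P.ξ) ^ 2 - P.ξ ^ 2) * P.v x - P.v x) * Real.exp (-x)) x := fun x =>
    (((P.qv_deriv x).add (P.v_deriv x)).mul (hasDerivAt_neg x).exp).congr_deriv (by
      simp only [Pi.add_apply]; ring)
  have hmono : MonotoneOn (fun x => (P.q x * P.v x + P.v x) * Real.exp (-x)) (Ici t) := by
    refine monotoneOn_Ici_of_hasDerivAt
      (fun x _ => (hd x).continuousAt.continuousWithinAt) (fun x _ => hd x) fun x hx => ?_
    have hx' : t < x := hx
    rw [P.potential_eq (by linarith)]
    have h1 : 1 ≤ x * (x + 2 * P.ξ) := by nlinarith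
    have := mul_nonneg (sub_nonneg.2 h1) (P.v_pos x).le
    exact mul_nonneg (by linarith) (Real.exp_pos _).le
  set z := P.q t * P.v t + P.v t with hzdef
  have hz' : 0 < z := by rw [hzdef]; linarith
  set s := t + P.v t / z with hs
  have hvz : 0 < P.v t / z := div_pos (P.v_pos t) hz'
  have hts : t ≤ s := by linarith
  have h1 := hmono self_mem_Ici hts hts
  simp only at h1
  have h2 : z * Real.exp (s - t) ≤ P.q s * P.v s + P.v s := by
    have h3 := mul_le_mul_of_nonneg_right h1 (Real.exp_pos s).le
    rw [mul_assoc, mul_assoc, ← Real.exp_add, ← Real.exp_add] at h3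
    simpa [neg_add_eq_sub] using h3
  have h4 : P.v t / z + 1 ≤ Real.exp (s - t) := by
    have := Real.add_one_le_exp (s - t); rw [hs] at this ⊢; simpa using this
  have h5 : P.v s ≤ P.v t := P.v_antitone (show (0:ℝ) ≤ t by linarith)
    (show (0:ℝ) ≤ s by linarith) hts
  have h6 : P.q s * P.v s ≤ 0 :=
    mul_nonpos_of_nonpos_of_nonneg (P.q_nonpos (by linarith)) (P.v_pos s).le
  have h7 : z * (P.v t / z + 1) = P.v t + z := by field_simp
  nlinarith [mul_le_mul_of_nonneg_left h4 hz'.le]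

theorem q_ge {t : ℝ} (ht : 0 ≤ t) : -(t + 2) ≤ P.q t := by
  by_contra! hq
  have hξ := P.ξ_neg
  have hξ' := P.ξ_gt
  have hd : ∀ x, HasDerivAt
      (fun x => (-(P.q x * P.v x) - (x + 2) * P.v x) * Real.exp (-(x ^ 2 / 2 + 2 * x)))
      (((x + 2) ^ 2 - 1 - ((|x| + P.ξ) ^ 2 - P.ξ ^ 2)) * P.v x *
        Real.exp (-(x ^ 2 / 2 + 2 * x))) x := fun x => by
    have h1 : HasDerivAt (fun x : ℝ => -(x ^ 2 / 2 + 2 * x)) (-(x + 2)) x :=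
      ((((hasDerivAt_id x).pow 2).div_const 2).add ((hasDerivAt_id x).const_mul 2)).neg.congr_deriv
        (by simp)
    exact (((P.qv_deriv x).neg.sub (((hasDerivAt_id x).add_const 2).mul (P.v_deriv x))).mul
      h1.exp).congr_deriv (by simp; ring)
  have hmono : MonotoneOn
      (fun x => (-(P.q x * P.v x) - (x + 2) * P.v x) * Real.exp (-(x ^ 2 / 2 + 2 * x)))
      (Ici t) := by
    refine monotoneOn_Ici_of_hasDerivAt
      (fun x _ => (hd x).continuousAt.continuousWithinAt) (fun x _ => hd x) fun x hx => ?_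
    have hx' : t < x := hx
    rw [P.potential_eq (by linarith)]
    exact mul_nonneg (mul_nonneg (by nlinarith) (P.v_pos x).le) (Real.exp_pos _).le
  set z := -(P.q t * P.v t) - (t + 2) * P.v t with hzdef
  have hz : 0 < z := by rw [hzdef]; nlinarith [P.v_pos t]
  have hlow : ∀ x ≥ t, z ≤ -(P.q x * P.v x) := by
    intro x hx
    have h1 := hmono self_mem_Ici hx hx
    simp only at h1
    have h2 : Real.exp (-(x ^ 2 / 2 + 2 * x)) ≤ Real.exp (-(t ^ 2 / 2 + 2 * t)) :=
      Real.exp_le_exp.2 (by nlinarith [show t ≤ x from hx])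
    have h3 : z * Real.exp (-(x ^ 2 / 2 + 2 * x)) ≤
        (-(P.q x * P.v x) - (x + 2) * P.v x) * Real.exp (-(x ^ 2 / 2 + 2 * x)) :=
      (mul_le_mul_of_nonneg_left h2 hz.le).trans h1
    have h4 := le_of_mul_le_mul_right h3 (Real.exp_pos _)
    nlinarith [P.v_pos x, show t ≤ x from hx]
  have hm : MonotoneOn (fun x => -P.v x - z * x) (Ici t) := by
    have hd2 : ∀ x, HasDerivAt (fun x => -P.v x - z * x) (-(P.q x * P.v x) - z) x := fun x =>
      ((P.v_deriv x).neg.sub ((hasDerivAt_id x).const_mul z)).congr_deriv (by simp)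
    exact monotoneOn_Ici_of_hasDerivAt (fun x _ => (hd2 x).continuousAt.continuousWithinAt)
      (fun x _ => hd2 x) fun x hx => sub_nonneg.2 (hlow x (le_of_lt hx))
  have hvz : 0 < P.v t / z := div_pos (P.v_pos t) hz
  have h := hm self_mem_Ici (show t ≤ t + P.v t / z by linarith)
    (show t ≤ t + P.v t / z by linarith)
  simp only at h
  have : z * (t + P.v t / z) = z * t + P.v t := by field_simp
  linarith [P.v_pos (t + P.v t / z)]

theorem polyGrowth_q : PolyGrowth P.q :=
  ⟨3, 1, by norm_num, fun t ht => by
    rw [abs_le]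
    constructor <;> nlinarith [P.q_ge ht, P.q_nonpos ht, sq_nonneg (t - 1)]⟩

theorem v_le_exp {t : ℝ} (ht : 3 ≤ t) : P.v t ≤ P.v 3 * Real.exp 3 * Real.exp (-t) := by
  have hd : ∀ x, HasDerivAt (fun x => -(P.v x * Real.exp x))
      (-(P.q x + 1) * P.v x * Real.exp x) x := fun x =>
    ((P.v_deriv x).mul (Real.hasDerivAt_exp x)).neg.congr_deriv (by ring)
  have hm : MonotoneOn (fun x => -(P.v x * Real.exp x)) (Ici 3) :=
    monotoneOn_Ici_of_hasDerivAt (fun x _ => (hd x).continuousAt.continuousWithinAt)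
      (fun x _ => hd x) fun x hx => by
        have := P.q_le_neg_one (le_of_lt hx)
        exact mul_nonneg (mul_nonneg (by linarith) (P.v_pos x).le) (Real.exp_pos x).le
  have h := hm self_mem_Ici ht ht
  simp only [neg_le_neg_iff] at h
  rw [Real.exp_neg, ← div_eq_mul_inv, le_div_iff₀ (Real.exp_pos t)]
  exact h

theorem tendsto_v_mul_pow (N : ℕ) :
    Tendsto (fun t => P.v t * (1 + t ^ 2) ^ N) atTop (𝓝 0) := by
  have h1 := Polynomial.tendsto_div_exp_atTop (((1 : Polynomial ℝ) + Polynomial.X ^ 2) ^ N)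
  have h2 := h1.const_mul (P.v 3 * Real.exp 3)
  rw [mul_zero] at h2
  refine squeeze_zero' (Eventually.of_forall fun t => ?_) ?_ h2
  · have := P.v_pos t; positivity
  · filter_upwards [eventually_ge_atTop 3] with t ht
    have := mul_le_mul_of_nonneg_right (P.v_le_exp ht)
      (show 0 ≤ (1 + t ^ 2) ^ N by positivity)
    simp only [Polynomial.eval_pow, Polynomial.eval_add, Polynomial.eval_one, Polynomial.eval_X]
    rw [Real.exp_neg] at this
    refine this.trans_eq ?_
    ring

theorem v_mul_pow_bounded (N : ℕ) : ∃ C, 0 ≤ C ∧ ∀ t, 0 ≤ t → P.v t * (1 + t ^ 2) ^ N ≤ C := by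
  obtain ⟨C, hC, h⟩ := bounded_of_tendsto (P.continuous_v.mul (by fun_prop))
    (P.tendsto_v_mul_pow N)
  exact ⟨C, hC, fun t ht => (le_abs_self _).trans (h t ht)⟩

theorem tendsto_v_mul {F : ℝ → ℝ} (hF : PolyGrowth F) :
    Tendsto (fun t => P.v t * F t) atTop (𝓝 0) := by
  obtain ⟨C, N, hC, h⟩ := hF
  have h2 := (P.tendsto_v_mul_pow N).const_mul C
  rw [mul_zero] at h2
  refine squeeze_zero_norm' ?_ h2
  filter_upwards [eventually_ge_atTop 0] with t ht
  rw [Real.norm_eq_abs, abs_mul, abs_of_pos (P.v_pos t)]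
  have := mul_le_mul_of_nonneg_left (h t ht) (P.v_pos t).le
  linarith

theorem polyGrowth_v : PolyGrowth P.v := by
  obtain ⟨C, hC, h⟩ := P.v_mul_pow_bounded 0
  exact ⟨C, 0, hC, fun t ht => by simpa [abs_of_pos (P.v_pos t)] using h t ht⟩

theorem tendsto_v_sq_mul {F : ℝ → ℝ} (hF : PolyGrowth F) :
    Tendsto (fun t => P.v t ^ 2 * F t) atTop (𝓝 0) :=
  (P.tendsto_v_mul (P.polyGrowth_v.mul hF)).congr fun t => by ring

theorem integrableOn_v_sq_mul {F : ℝ → ℝ} (hc : Continuous F) (hF : PolyGrowth F) :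
    IntegrableOn (fun t => P.v t ^ 2 * F t) (Ioi 0) := by
  have hcont : Continuous fun t => P.v t ^ 2 * F t := (P.continuous_v.pow 2).mul hc
  have hpg : PolyGrowth fun t => F t * (1 + t ^ 2) :=
    hF.mul ((PolyGrowth.const 1).add (PolyGrowth.id.pow 2))
  obtain ⟨C, hC, h⟩ := bounded_of_tendsto
    ((P.continuous_v.pow 2).mul (hc.mul (by fun_prop))) (P.tendsto_v_sq_mul hpg)
  refine Integrable.mono' ((integrable_inv_one_add_sq.const_mul C).integrableOn)
    hcont.aestronglyMeasurable ?_
  filter_upwards [ae_restrict_mem measurableSet_Ioi] with t ht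
  have h' : |P.v t ^ 2 * (F t * (1 + t ^ 2))| ≤ C := h t (le_of_lt ht)
  have hp : (0 : ℝ) < 1 + t ^ 2 := by positivity
  rw [← div_eq_mul_inv, le_div_iff₀ hp, Real.norm_eq_abs, ← abs_of_pos hp, ← abs_mul]
  rwa [mul_assoc]

/-- The mean of `F` against the density `v²` on the half-line. -/
def avg (F : ℝ → ℝ) : ℝ := ∫ t in Ioi (0 : ℝ), P.v t ^ 2 * F t

theorem avg_eq_of_hasDerivAt {F Φ : ℝ → ℝ} (hc : Continuous F) (hF : PolyGrowth F)
    (hΦ : Continuous Φ) (hΦg : PolyGrowth Φ)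
    (hd : ∀ t > 0, HasDerivAt (fun t => P.v t ^ 2 * Φ t) (P.v t ^ 2 * F t) t) :
    P.avg F = -(P.v 0 ^ 2 * Φ 0) := by
  unfold avg
  rw [integral_Ioi_of_hasDerivAt_of_tendsto
    ((P.continuous_v.pow 2).mul hΦ).continuousAt.continuousWithinAt (fun t ht => hd t ht)
    (P.integrableOn_v_sq_mul hc hF) (P.tendsto_v_sq_mul hΦg)]
  simp

theorem avg_const (c : ℝ) : P.avg (fun _ => c) = c := by
  unfold avg
  rw [integral_mul_const, P.v_norm, one_mul]

theorem avg_sub_const {F : ℝ → ℝ} (hc : Continuous F) (hF : PolyGrowth F) (c : ℝ) :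
    P.avg (fun t => F t - c) = P.avg F - c := by
  have h := P.avg_const c
  unfold avg at *
  rw [← h, ← integral_sub (P.integrableOn_v_sq_mul hc hF)
    (P.integrableOn_v_sq_mul continuous_const (PolyGrowth.const c)), h]
  simp only [mul_sub]

/-- The solution of `k' + 2 q k = F - avg F`, `k 0 = 0`. -/
def solve (F : ℝ → ℝ) (t : ℝ) : ℝ :=
  (P.v t ^ 2)⁻¹ * ∫ s in (0 : ℝ)..t, P.v s ^ 2 * (F s - P.avg F)

theorem solve_zero (F : ℝ → ℝ) : P.solve F 0 = 0 := by simp [solve]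

variable {F : ℝ → ℝ}

theorem solve_deriv (hc : Continuous F) (t : ℝ) :
    HasDerivAt (P.solve F) (F t - P.avg F - 2 * P.q t * P.solve F t) t := by
  have hcont : Continuous fun s => P.v s ^ 2 * (F s - P.avg F) :=
    (P.continuous_v.pow 2).mul (hc.sub continuous_const)
  have h1 : HasDerivAt (fun t => ∫ s in (0 : ℝ)..t, P.v s ^ 2 * (F s - P.avg F))
      (P.v t ^ 2 * (F t - P.avg F)) t :=
    intervalIntegral.integral_hasDerivAt_right (hcont.intervalIntegrable _ _)
      (hcont.stronglyMeasurableAtFilter _ _) hcont.continuousAt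
  have hv := (P.v_pos t).ne'
  have h2 := (((P.v_deriv t).pow 2).inv (pow_ne_zero 2 hv)).mul h1
  refine h2.congr_deriv ?_
  simp only [solve, Pi.inv_apply, Pi.pow_apply]
  field_simp
  ring

theorem continuous_solve (hc : Continuous F) : Continuous (P.solve F) :=
  continuous_iff_continuousAt.2 fun t => (P.solve_deriv hc t).continuousAt

theorem v_sq_mul_solve (F : ℝ → ℝ) (t : ℝ) :
    P.v t ^ 2 * P.solve F t = ∫ s in (0 : ℝ)..t, P.v s ^ 2 * (F s - P.avg F) := by
  unfold solve
  rw [mul_inv_cancel_left₀ (pow_ne_zero 2 (P.v_pos t).ne')]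

theorem tendsto_v_sq_mul_solve (hc : Continuous F) (hF : PolyGrowth F) :
    Tendsto (fun t => P.v t ^ 2 * P.solve F t) atTop (𝓝 0) := by
  have h := intervalIntegral_tendsto_integral_Ioi (0 : ℝ)
    (P.integrableOn_v_sq_mul (F := fun t => F t - P.avg F) (hc.sub continuous_const) (hF.sub (PolyGrowth.const (P.avg F))))
    tendsto_id
  have h0 : ∫ t in Ioi (0 : ℝ), P.v t ^ 2 * (F t - P.avg F) = 0 := by
    have := P.avg_sub_const hc hF (P.avg F)
    rw [sub_self] at this
    exact this
  rw [h0] at h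
  exact h.congr fun t => (P.v_sq_mul_solve F t).symm

theorem pow_deriv_le {N : ℕ} {t : ℝ} (ht : 2 * N ≤ t) :
    N * (1 + t ^ 2) ^ (N - 1) * (2 * t) ≤ (1 + t ^ 2) ^ N := by
  rcases N with _ | n
  · simp
  · have h1 : ((n + 1 : ℕ) : ℝ) * (2 * t) ≤ 1 + t ^ 2 := by
      have : 0 ≤ t := le_trans (by positivity) ht
      nlinarith
    have h2 : 0 ≤ (1 + t ^ 2) ^ n := by positivity
    have := mul_le_mul_of_nonneg_left h1 h2
    rw [Nat.add_sub_cancel, pow_succ (1 + t ^ 2) n]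
    linarith

theorem barrier {K : ℝ} (hK : 0 ≤ K) {N : ℕ} {E g : ℝ → ℝ}
    (hE : ∀ t, HasDerivAt E (P.v t ^ 2 * g t) t) (hg : ∀ t, 0 ≤ t → -(K * (1 + t ^ 2) ^ N) ≤ g t)
    (hlim : Tendsto E atTop (𝓝 0)) {t : ℝ} (ht : max 3 (2 * N : ℝ) ≤ t) :
    E t ≤ P.v t ^ 2 * (K * (1 + t ^ 2) ^ N) := by
  have hd : ∀ x, HasDerivAt (fun x => E x - P.v x ^ 2 * (K * (1 + x ^ 2) ^ N))
      (P.v x ^ 2 * g x - P.v x ^ 2 * (K * (N * (1 + x ^ 2) ^ (N - 1) * (2 * x) +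
        2 * P.q x * (1 + x ^ 2) ^ N))) x := fun x => by
    have h1 : HasDerivAt (fun x : ℝ => (1 + x ^ 2) ^ N) (N * (1 + x ^ 2) ^ (N - 1) * (2 * x)) x :=
      ((((hasDerivAt_id x).pow 2).const_add 1).pow N).congr_deriv (by simp)
    exact ((hE x).sub (((P.v_deriv x).pow 2).mul (h1.const_mul K))).congr_deriv
      (by simp; ring)
  have hm : MonotoneOn (fun x => E x - P.v x ^ 2 * (K * (1 + x ^ 2) ^ N))
      (Ici (max 3 (2 * N : ℝ))) := by
    refine monotoneOn_Ici_of_hasDerivAt (fun x _ => (hd x).continuousAt.continuousWithinAt)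
      (fun x _ => hd x) fun x hx => ?_
    have hx3 : 3 ≤ x := (le_max_left _ _).trans (le_of_lt hx)
    have hxN : 2 * (N : ℝ) ≤ x := (le_max_right _ _).trans (le_of_lt hx)
    have h1 := pow_deriv_le hxN
    have h2 := P.q_le_neg_one hx3
    have h3 : 0 ≤ (1 + x ^ 2) ^ N := by positivity
    have h4 := hg x (by linarith)
    rw [← mul_sub]
    refine mul_nonneg (sq_nonneg _) ?_
    have h5 : N * (1 + x ^ 2) ^ (N - 1) * (2 * x) + 2 * P.q x * (1 + x ^ 2) ^ N ≤
        -(1 + x ^ 2) ^ N := by nlinarith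
    nlinarith [mul_le_mul_of_nonneg_left h5 hK]
  have hl : Tendsto (fun x => E x - P.v x ^ 2 * (K * (1 + x ^ 2) ^ N)) atTop (𝓝 0) := by
    have := hlim.sub (P.tendsto_v_sq_mul (F := fun x => K * (1 + x ^ 2) ^ N)
      ((PolyGrowth.const K).mul (((PolyGrowth.const 1).add (PolyGrowth.id.pow 2)).pow N)))
    simpa using this
  have := ge_of_tendsto hl (b := E t - P.v t ^ 2 * (K * (1 + t ^ 2) ^ N)) (by
    filter_upwards [eventually_ge_atTop t] with x hx
    exact hm ht (le_trans ht hx) hx)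
  linarith

theorem polyGrowth_solve (hc : Continuous F) (hF : PolyGrowth F) : PolyGrowth (P.solve F) := by
  obtain ⟨K, N, hK, h⟩ := hF.sub (PolyGrowth.const (P.avg F))
  set T := max 3 (2 * N : ℝ)
  have hE : ∀ t, HasDerivAt (fun t => P.v t ^ 2 * P.solve F t) (P.v t ^ 2 * (F t - P.avg F)) t :=
    fun t => (((P.v_deriv t).pow 2).mul (P.solve_deriv hc t)).congr_deriv (by simp; ring)
  have hlim := P.tendsto_v_sq_mul_solve hc hF
  obtain ⟨C, hC⟩ := isCompact_Icc.exists_bound_of_continuousOn (s := Icc 0 T)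
    (P.continuous_solve hc).continuousOn
  have hC0 : 0 ≤ C := (norm_nonneg _).trans (hC 0 ⟨le_rfl, le_max_of_le_left (by norm_num)⟩)
  refine ⟨C + K, N, by positivity, fun t ht => ?_⟩
  have hJ : 1 ≤ (1 + t ^ 2) ^ N := one_le_pow₀ (one_le_one_add_sq t)
  rcases le_total t T with htT | htT
  · have := hC t ⟨ht, htT⟩
    rw [Real.norm_eq_abs] at this
    nlinarith [mul_nonneg hC0 (sub_nonneg.2 hJ)]
  · have h1 := P.barrier hK (N := N) hE (fun t ht => (abs_le.1 (h t ht)).1) hlim htT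
    have h2 := P.barrier hK (N := N) (E := fun t => -(P.v t ^ 2 * P.solve F t))
      (g := fun t => -(F t - P.avg F)) (fun t => (hE t).fun_neg.congr_deriv (by ring))
      (fun t ht => by linarith [(abs_le.1 (h t ht)).2]) (by simpa using hlim.neg) htT
    have hv : 0 < P.v t ^ 2 := pow_pos (P.v_pos t) 2
    have h3 := le_of_mul_le_mul_left h1 hv
    have h4 : -P.solve F t ≤ K * (1 + t ^ 2) ^ N :=
      le_of_mul_le_mul_left (by linarith) hv
    rw [abs_le]
    constructor <;> nlinarith

end Profile

end SC

namespace SC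

namespace Profile

variable (P : Profile)

/-- The shifted variable `|t| + ξ`. -/
def X (t : ℝ) : ℝ := |t| + P.ξ

/-- First-order corrector in the momentum parameter. -/
def α : ℝ → ℝ := P.solve fun t => 2 * P.X t

/-- Source of the first-order curvature corrector. -/
def srcβ (t : ℝ) : ℝ := P.X t * (P.X t ^ 2 - P.ξ ^ 2) + P.q t

/-- First-order corrector in the curvature parameter. -/
def β : ℝ → ℝ := P.solve P.srcβ

/-- Source of the second-order corrector in `ε`. -/
def src₁ (t : ℝ) : ℝ := 1 - P.α t ^ 2

/-- Source of the mixed second-order corrector. -/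
def src₂ (t : ℝ) : ℝ := 4 * t * P.X t - t ^ 2 + P.α t - 2 * P.α t * P.β t

/-- Source of the second-order corrector in `h`. -/
def src₃ (t : ℝ) : ℝ := t ^ 4 / 4 - 2 * t ^ 3 * P.X t + 3 * t ^ 2 * P.X t ^ 2 + t * P.q t + P.β t
  - P.β t ^ 2

/-- Second-order corrector in `ε`. -/
def γ₁ : ℝ → ℝ := P.solve P.src₁

/-- Mixed second-order corrector. -/
def γ₂ : ℝ → ℝ := P.solve P.src₂

/-- Second-order corrector in `h`. -/
def γ₃ : ℝ → ℝ := P.solve P.src₃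

theorem continuous_X : Continuous P.X := continuous_abs.add continuous_const

theorem polyGrowth_X : PolyGrowth P.X := PolyGrowth.abs.add (PolyGrowth.const P.ξ)

theorem X_of_nonneg {t : ℝ} (ht : 0 ≤ t) : P.X t = t + P.ξ := by rw [X, abs_of_nonneg ht]

theorem hasDerivAt_X {t : ℝ} (ht : 0 < t) : HasDerivAt P.X 1 t :=
  ((hasDerivAt_abs_pos ht).add_const P.ξ)

theorem q_deriv' (t : ℝ) : HasDerivAt P.q (P.X t ^ 2 - P.ξ ^ 2 - P.q t ^ 2) t := P.q_deriv t

theorem continuous_α : Continuous P.α := P.continuous_solve (P.continuous_X.const_mul 2)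

theorem polyGrowth_two_X : PolyGrowth fun t => 2 * P.X t := (PolyGrowth.const 2).mul P.polyGrowth_X

theorem polyGrowth_α : PolyGrowth P.α :=
  P.polyGrowth_solve (P.continuous_X.const_mul 2) P.polyGrowth_two_X

theorem continuous_srcβ : Continuous P.srcβ :=
  (P.continuous_X.mul ((P.continuous_X.pow 2).sub continuous_const)).add P.continuous_q

theorem polyGrowth_srcβ : PolyGrowth P.srcβ :=
  (P.polyGrowth_X.mul ((P.polyGrowth_X.pow 2).sub (.const _))).add P.polyGrowth_q

theorem continuous_β : Continuous P.β := P.continuous_solve P.continuous_srcβ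

theorem polyGrowth_β : PolyGrowth P.β := P.polyGrowth_solve P.continuous_srcβ P.polyGrowth_srcβ

theorem continuous_src₁ : Continuous P.src₁ := continuous_const.sub (P.continuous_α.pow 2)

theorem polyGrowth_src₁ : PolyGrowth P.src₁ := (PolyGrowth.const 1).sub (P.polyGrowth_α.pow 2)

theorem continuous_src₂ : Continuous P.src₂ := by
  have := P.continuous_X
  have := P.continuous_α
  have := P.continuous_β
  unfold src₂
  fun_prop

theorem polyGrowth_src₂ : PolyGrowth P.src₂ :=
  (((((PolyGrowth.const 4).mul .id).mul P.polyGrowth_X).sub (PolyGrowth.id.pow 2)).add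
    P.polyGrowth_α).sub (((PolyGrowth.const 2).mul P.polyGrowth_α).mul P.polyGrowth_β)

theorem continuous_src₃ : Continuous P.src₃ := by
  have := P.continuous_X
  have := P.continuous_q
  have := P.continuous_β
  unfold src₃
  fun_prop

theorem polyGrowth_src₃ : PolyGrowth P.src₃ := by
  have h : PolyGrowth fun t => t ^ 4 * (1 / 4) - 2 * t ^ 3 * P.X t + 3 * t ^ 2 * P.X t ^ 2 +
      t * P.q t + P.β t - P.β t ^ 2 :=
    (((((((PolyGrowth.id.pow 4).mul (.const (1 / 4))).sub
      (((PolyGrowth.const 2).mul (PolyGrowth.id.pow 3)).mul P.polyGrowth_X))).add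
      (((PolyGrowth.const 3).mul (PolyGrowth.id.pow 2)).mul (P.polyGrowth_X.pow 2))).add
      (PolyGrowth.id.mul P.polyGrowth_q)).add P.polyGrowth_β).sub (P.polyGrowth_β.pow 2)
  have e : P.src₃ = fun t => t ^ 4 * (1 / 4) - 2 * t ^ 3 * P.X t + 3 * t ^ 2 * P.X t ^ 2 +
      t * P.q t + P.β t - P.β t ^ 2 := by
    funext t; unfold src₃; ring
  rw [e]; exact h

theorem avg_two_X : P.avg (fun t => 2 * P.X t) = 0 := by
  have hX := P.continuous_X
  have hq := P.continuous_q
  rw [P.avg_eq_of_hasDerivAt (Φ := fun t => P.X t ^ 2 - P.ξ ^ 2 - P.q t ^ 2) (hX.const_mul 2)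
    P.polyGrowth_two_X (by fun_prop)
    (((P.polyGrowth_X.pow 2).sub (.const _)).sub (P.polyGrowth_q.pow 2)) fun t ht => ?_]
  · simp [X, P.q_zero]
  · exact (((P.v_deriv t).pow 2).mul ((((P.hasDerivAt_X ht).pow 2).sub_const _).sub
      ((P.q_deriv' t).pow 2))).congr_deriv (by simp; ring)

theorem α_eq {t : ℝ} (ht : 0 ≤ t) : P.α t = P.X t ^ 2 - P.ξ ^ 2 - P.q t ^ 2 := by
  have hX := P.continuous_X
  have hq := P.continuous_q
  have hv := P.continuous_v
  have h1 : P.v t ^ 2 * P.α t = ∫ s in (0 : ℝ)..t, P.v s ^ 2 * (2 * P.X s - 0) := by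
    have := P.v_sq_mul_solve (fun t => 2 * P.X t) t
    rwa [P.avg_two_X] at this
  have h2 := intervalIntegral.integral_eq_sub_of_hasDerivAt_of_le ht
    (f := fun t => P.v t ^ 2 * (P.X t ^ 2 - P.ξ ^ 2 - P.q t ^ 2))
    (f' := fun s => P.v s ^ 2 * (2 * P.X s - 0)) (by fun_prop)
    (fun s hs => (((P.v_deriv s).pow 2).mul ((((P.hasDerivAt_X hs.1).pow 2).sub_const _).sub
      ((P.q_deriv' s).pow 2))).congr_deriv (by simp; ring))
    (Continuous.intervalIntegrable (by fun_prop) _ _)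
  rw [h2] at h1
  have h0 : P.v 0 ^ 2 * (P.X 0 ^ 2 - P.ξ ^ 2 - P.q 0 ^ 2) = 0 := by simp [X, P.q_zero]
  rw [h0, sub_zero] at h1
  exact mul_left_cancel₀ (pow_ne_zero 2 (P.v_pos t).ne') h1

theorem avg_srcβ : P.avg P.srcβ = -(P.v 0 ^ 2 / 3) := by
  have hX := P.continuous_X
  have hq := P.continuous_q
  have gX := P.polyGrowth_X
  have gq := P.polyGrowth_q
  rw [P.avg_eq_of_hasDerivAt (Φ := fun t => (-1 / 6) * (1 - P.X t ^ 2 * (P.X t ^ 2 - P.ξ ^ 2) -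
      2 * P.X t * P.q t + P.X t ^ 2 * P.q t ^ 2) +
      (P.ξ ^ 2 * (1 / 6)) * (P.q t ^ 2 - (P.X t ^ 2 - P.ξ ^ 2)) + 1 / 2)
    P.continuous_srcβ P.polyGrowth_srcβ (by fun_prop)
    ((((PolyGrowth.const _).mul ((((PolyGrowth.const 1).sub
      ((gX.pow 2).mul ((gX.pow 2).sub (.const _)))).sub (((PolyGrowth.const 2).mul gX).mul gq)).add
      ((gX.pow 2).mul (gq.pow 2)))).add ((PolyGrowth.const _).mul
      ((gq.pow 2).sub ((gX.pow 2).sub (.const _))))).add (.const _)) fun t ht => ?_]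
  · simp [X, P.q_zero]; ring
  · have dX := P.hasDerivAt_X ht
    have dq := P.q_deriv' t
    refine (((P.v_deriv t).pow 2).mul ((((((((dX.pow 2).mul ((dX.pow 2).sub_const _)).const_sub
      1).sub ((dX.const_mul 2).mul dq)).add ((dX.pow 2).mul (dq.pow 2))).const_mul (-1 / 6)).add
      (((dq.pow 2).sub ((dX.pow 2).sub_const (P.ξ ^ 2))).const_mul
      (P.ξ ^ 2 * (1 / 6)))).add_const (1 / 2))).congr_deriv ?_
    simp [srcβ]; ring

theorem avg_src₁ : P.avg P.src₁ = -(P.v 0 ^ 2 * P.ξ) := by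
  have hX := P.continuous_X
  have hq := P.continuous_q
  have ha := P.continuous_α
  rw [P.avg_eq_of_hasDerivAt (Φ := fun t => P.X t - P.q t * P.α t) P.continuous_src₁
    P.polyGrowth_src₁ (by fun_prop) (P.polyGrowth_X.sub (P.polyGrowth_q.mul P.polyGrowth_α))
    fun t ht => ?_]
  · simp [X, P.q_zero]
  · refine (((P.v_deriv t).pow 2).mul ((P.hasDerivAt_X ht).sub ((P.q_deriv' t).mul
      (P.solve_deriv (P.continuous_X.const_mul 2) t)))).congr_deriv ?_
    have e := P.α_eq ht.le
    have e' : P.q t ^ 2 = P.X t ^ 2 - P.ξ ^ 2 - P.α t := by linarith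
    simp only [src₁, P.avg_two_X, Pi.pow_apply]
    change _ * (P.X t - P.q t * P.α t) + P.v t ^ 2 * (1 - (_ * P.α t + P.q t * (_ - _ *
      P.α t))) = _
    rw [← e]
    simp; ring

/-- The corrector `k₁ + k₂` of the logarithmic derivative. -/
def k (h ε t : ℝ) : ℝ := ε * P.α t + h * P.β t + (ε ^ 2 * P.γ₁ t + ε * h * P.γ₂ t + h ^ 2 * P.γ₃ t)

/-- The approximate eigenvalue. -/
def lev (h ε : ℝ) : ℝ := P.ξ ^ 2 + h * P.avg P.srcβ + (ε ^ 2 * P.avg P.src₁ +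
  ε * h * P.avg P.src₂ + h ^ 2 * P.avg P.src₃)

/-- The derivative of `k`. -/
def k' (h ε t : ℝ) : ℝ := ε * (2 * P.X t) + h * P.srcβ t + (ε ^ 2 * P.src₁ t +
  ε * h * P.src₂ t + h ^ 2 * P.src₃ t) - (P.lev h ε - P.ξ ^ 2) - 2 * P.q t * P.k h ε t

theorem hasDerivAt_k (h ε t : ℝ) : HasDerivAt (P.k h ε) (P.k' h ε t) t := by
  have ha := P.solve_deriv (P.continuous_X.const_mul 2) t
  have hb := P.solve_deriv P.continuous_srcβ t
  have h1 := P.solve_deriv P.continuous_src₁ t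
  have h2 := P.solve_deriv P.continuous_src₂ t
  have h3 := P.solve_deriv P.continuous_src₃ t
  refine (((ha.const_mul ε).add (hb.const_mul h)).add (((h1.const_mul (ε ^ 2)).add
    (h2.const_mul (ε * h))).add (h3.const_mul (h ^ 2)))).congr_deriv ?_
  rw [P.avg_two_X]
  simp only [k', k, lev, α, β, γ₁, γ₂, γ₃]
  ring

theorem continuous_k (h ε : ℝ) : Continuous (P.k h ε) :=
  continuous_iff_continuousAt.2 fun t => (P.hasDerivAt_k h ε t).continuousAt

theorem polyGrowth_γ₁ : PolyGrowth P.γ₁ := P.polyGrowth_solve P.continuous_src₁ P.polyGrowth_src₁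

theorem polyGrowth_γ₂ : PolyGrowth P.γ₂ := P.polyGrowth_solve P.continuous_src₂ P.polyGrowth_src₂

theorem polyGrowth_γ₃ : PolyGrowth P.γ₃ := P.polyGrowth_solve P.continuous_src₃ P.polyGrowth_src₃

end Profile

end SC

namespace SC

/-- Functions of `(h, ε, t)` that are of order `j` in the small parameters `h, ε`, with polynomial
growth in `t`, as long as `h t ≤ b`. -/
def Bd (b : ℝ) (j : ℕ) (F : ℝ → ℝ → ℝ → ℝ) : Prop :=
  ∃ C : ℝ, ∃ N : ℕ, 0 ≤ C ∧ ∀ h ε t : ℝ, 0 < h → h + |ε| ≤ 1 → 0 ≤ t → h * t ≤ b →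
    |F h ε t| ≤ C * (h + |ε|) ^ j * (1 + t ^ 2) ^ N

theorem PolyGrowth.bd {b : ℝ} {F : ℝ → ℝ} (hF : PolyGrowth F) : Bd b 0 fun _ _ t => F t := by
  obtain ⟨C, N, hC, h⟩ := hF
  exact ⟨C, N, hC, fun h' ε t _ _ ht _ => by simpa using h t ht⟩

namespace Bd

variable {F G : ℝ → ℝ → ℝ → ℝ} {i j : ℕ} {b : ℝ}

theorem const (c : ℝ) : Bd b 0 fun _ _ _ => c := (PolyGrowth.const c).bd

theorem h : Bd b 1 fun h _ _ => h :=
  ⟨1, 0, zero_le_one, fun h ε t hh _ _ _ => by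
    have := abs_nonneg ε
    rw [abs_of_pos hh]; simp⟩

theorem ε : Bd b 1 fun _ ε _ => ε :=
  ⟨1, 0, zero_le_one, fun h ε t hh _ _ _ => by simp; exact hh.le⟩

theorem t : Bd b 0 fun _ _ t => t := PolyGrowth.id.bd

theorem add (hF : Bd b j F) (hG : Bd b j G) : Bd b j fun h ε t => F h ε t + G h ε t := by
  obtain ⟨C, N, hC, hF⟩ := hF
  obtain ⟨C', N', hC', hG⟩ := hG
  refine ⟨C + C', max N N', by positivity, fun h ε t h0 h1 h2 h3 => (abs_add_le _ _).trans ?_⟩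
  have hs : 0 ≤ (h + |ε|) ^ j := by positivity
  have e1 := pow_le_pow_right₀ (one_le_one_add_sq t) (le_max_left N N')
  have e2 := pow_le_pow_right₀ (one_le_one_add_sq t) (le_max_right N N')
  have := mul_le_mul_of_nonneg_left e1 (mul_nonneg hC hs)
  have := mul_le_mul_of_nonneg_left e2 (mul_nonneg hC' hs)
  linarith [hF h ε t h0 h1 h2 h3, hG h ε t h0 h1 h2 h3]

theorem mul (hF : Bd b i F) (hG : Bd b j G) : Bd b (i + j) fun h ε t => F h ε t * G h ε t := by
  obtain ⟨C, N, hC, hF⟩ := hF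
  obtain ⟨C', N', hC', hG⟩ := hG
  refine ⟨C * C', N + N', by positivity, fun h ε t h0 h1 h2 h3 => ?_⟩
  rw [abs_mul]
  refine (mul_le_mul (hF h ε t h0 h1 h2 h3) (hG h ε t h0 h1 h2 h3) (abs_nonneg _)
    (by positivity)).trans_eq ?_
  ring

theorem neg (hF : Bd b j F) : Bd b j fun h ε t => -F h ε t := by
  obtain ⟨C, N, hC, hF⟩ := hF
  exact ⟨C, N, hC, fun h ε t h0 h1 h2 h3 => by rw [abs_neg]; exact hF h ε t h0 h1 h2 h3⟩

theorem sub (hF : Bd b j F) (hG : Bd b j G) : Bd b j fun h ε t => F h ε t - G h ε t := by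
  simpa [sub_eq_add_neg] using hF.add hG.neg

theorem mono (hF : Bd b j F) (hij : i ≤ j) : Bd b i F := by
  obtain ⟨C, N, hC, hF⟩ := hF
  refine ⟨C, N, hC, fun h ε t h0 h1 h2 h3 => (hF h ε t h0 h1 h2 h3).trans ?_⟩
  have hs : 0 ≤ h + |ε| := by positivity
  gcongr ?_ * ?_ * ?_
  exact pow_le_pow_of_le_one hs h1 hij

theorem inv_width : Bd (3 / 4) 0 fun h _ t => (1 - h * t)⁻¹ :=
  ⟨4, 0, by norm_num, fun h ε t h0 h1 h2 h3 => by
    have : (1 : ℝ) / 4 ≤ 1 - h * t := by linarith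
    rw [abs_of_pos (inv_pos.2 (by linarith))]
    simpa using inv_anti₀ (by norm_num) this⟩

end Bd

/-- A cutoff of the correctors at the scale where they cease to be small. -/
def chi (M : ℕ) (h ε t : ℝ) : ℝ := (1 + (h + |ε|) ^ 2 * (1 + t ^ 2) ^ M)⁻¹

/-- The `t`-derivative of `chi`. -/
def chi' (M : ℕ) (h ε t : ℝ) : ℝ :=
  -((h + |ε|) ^ 2 * (M * (1 + t ^ 2) ^ (M - 1) * (2 * t))) * chi M h ε t ^ 2

section chi

variable (M : ℕ) (h ε t : ℝ) {b : ℝ}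

theorem one_le_chi_den : 1 ≤ 1 + (h + |ε|) ^ 2 * (1 + t ^ 2) ^ M := by
  have : 0 ≤ (h + |ε|) ^ 2 * (1 + t ^ 2) ^ M := by positivity
  linarith

theorem chi_pos : 0 < chi M h ε t := inv_pos.2 (by linarith [one_le_chi_den M h ε t])

theorem chi_le_one : chi M h ε t ≤ 1 := inv_le_one_of_one_le₀ (one_le_chi_den M h ε t)

theorem one_sub_chi : 1 - chi M h ε t = (h + |ε|) ^ 2 * (1 + t ^ 2) ^ M * chi M h ε t := by
  unfold chi
  have := one_le_chi_den M h ε t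
  field_simp
  ring

theorem hasDerivAt_chi : HasDerivAt (chi M h ε) (chi' M h ε t) t := by
  have h1 : HasDerivAt (fun x : ℝ => (1 + x ^ 2) ^ M) (M * (1 + t ^ 2) ^ (M - 1) * (2 * t)) t :=
    ((((hasDerivAt_id t).pow 2).const_add 1).pow M).congr_deriv (by simp)
  have h2 := ((h1.const_mul ((h + |ε|) ^ 2)).const_add 1).inv
    (by linarith [one_le_chi_den M h ε t])
  refine h2.congr_deriv ?_
  unfold chi' chi
  have := one_le_chi_den M h ε t
  field_simp

theorem bd_chi : Bd b 0 (chi M) :=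
  ⟨1, 0, zero_le_one, fun h ε t _ _ _ _ => by
    rw [abs_of_pos (chi_pos M h ε t)]; simpa using chi_le_one M h ε t⟩

theorem bd_scale_sq : Bd b 2 fun h ε _ => (h + |ε|) ^ 2 :=
  ⟨1, 0, zero_le_one, fun h ε t h0 _ _ _ => by rw [abs_of_nonneg (by positivity)]; simp⟩

theorem bd_weight (M : ℕ) : Bd b 0 fun _ _ t => (1 + t ^ 2) ^ M :=
  (((PolyGrowth.const 1).add (PolyGrowth.id.pow 2)).pow M).bd

theorem bd_one_sub_chi : Bd b 2 fun h ε t => 1 - chi M h ε t := by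
  simp_rw [one_sub_chi]
  exact (bd_scale_sq.mul (bd_weight M)).mul (bd_chi M)

theorem bd_chi' : Bd b 2 (chi' M) := by
  have : Bd b 2 _ := ((bd_scale_sq.mul (((Bd.const (M : ℝ)).mul (bd_weight (M - 1))).mul
    ((Bd.const 2).mul Bd.t))).neg).mul ((bd_chi M).mul (bd_chi M))
  have e : chi' M = fun h ε t => -((h + |ε|) ^ 2 * (M * (1 + t ^ 2) ^ (M - 1) * (2 * t))) *
    (chi M h ε t * chi M h ε t) := by
    funext h ε t; rw [chi', pow_two (chi M h ε t)]
  rw [e]; exact this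

end chi

namespace Profile

variable (P : Profile) {b : ℝ}

/-- The rescaled angular-momentum potential at distance `t` from the boundary. -/
def pot (h ε t : ℝ) : ℝ := ((t + P.ξ + ε - h * t ^ 2 / 2) / (1 - h * t)) ^ 2

/-- Logarithmic derivative of the quasimode. -/
def p (M : ℕ) (h ε t : ℝ) : ℝ := P.q t + chi M h ε t * P.k h ε t

/-- Derivative of `p`. -/
def p' (M : ℕ) (h ε t : ℝ) : ℝ :=
  (P.X t ^ 2 - P.ξ ^ 2 - P.q t ^ 2) + (chi' M h ε t * P.k h ε t + chi M h ε t * P.k' h ε t)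

theorem hasDerivAt_p (M : ℕ) (h ε t : ℝ) : HasDerivAt (P.p M h ε) (P.p' M h ε t) t :=
  (P.q_deriv' t).add ((hasDerivAt_chi M h ε t).mul (P.hasDerivAt_k h ε t))

/-- `(H f)/f` for a function `f` with logarithmic derivative `p`. -/
def res (M : ℕ) (h ε t : ℝ) : ℝ :=
  P.pot h ε t - P.p' M h ε t - P.p M h ε t ^ 2 + h / (1 - h * t) * P.p M h ε t

/-- First-order part of the corrector. -/
def k₁ (h ε t : ℝ) : ℝ := ε * P.α t + h * P.β t

/-- Second-order part of the corrector. -/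
def k₂ (h ε t : ℝ) : ℝ := ε * ε * P.γ₁ t + ε * h * P.γ₂ t + h * h * P.γ₃ t

/-- First-order part of the potential. -/
def V₁ (h ε t : ℝ) : ℝ := ε * (2 * P.X t) + h * (P.X t * (P.X t ^ 2 - P.ξ ^ 2))

/-- Shift of the potential due to `ε` and the curvature. -/
def shift (h ε t : ℝ) : ℝ := ε - h * (t ^ 2 * (1 / 2))

/-- Second-order part of the potential. -/
def V₂ (h ε t : ℝ) : ℝ := shift h ε t * shift h ε t +
  4 * t * P.X t * (h * shift h ε t) + 3 * t ^ 2 * P.X t ^ 2 * (h * h)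

/-- Third-order remainder of the potential. -/
def potRem (h ε t : ℝ) : ℝ := 2 * t * (h * (shift h ε t * shift h ε t)) +
  6 * t ^ 2 * P.X t * (h * (h * shift h ε t)) +
  3 * t ^ 2 * (h * (h * (shift h ε t * shift h ε t))) +
  h * (h * h) * t ^ 3 * ((P.X t + shift h ε t) * (P.X t + shift h ε t) * (4 - 3 * t * h)) *
    ((1 - h * t)⁻¹ * (1 - h * t)⁻¹)

theorem pot_eq {h ε t : ℝ} (ht : 0 ≤ t) (hw : 1 - h * t ≠ 0) :
    P.pot h ε t = P.X t ^ 2 + P.V₁ h ε t + P.V₂ h ε t + P.potRem h ε t := by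
  have hj : (1 - h * t)⁻¹ * (1 - h * t) = 1 := inv_mul_cancel₀ hw
  simp only [pot, V₁, V₂, potRem, shift, P.X_of_nonneg ht, div_eq_mul_inv]
  generalize (1 - h * t)⁻¹ = j at *
  linear_combination ((t + P.ξ + ε - h * t ^ 2 / 2) ^ 2 * (1 + 2 * (h * t) + 3 * (h * t) ^ 2)) *
    (j * (1 - h * t) + 1) * hj

theorem bd_k₁ : Bd b 1 P.k₁ := (Bd.ε.mul P.polyGrowth_α.bd).add (Bd.h.mul P.polyGrowth_β.bd)

theorem bd_k₂ : Bd b 2 P.k₂ :=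
  (((Bd.ε.mul Bd.ε).mul P.polyGrowth_γ₁.bd).add ((Bd.ε.mul Bd.h).mul P.polyGrowth_γ₂.bd)).add
    ((Bd.h.mul Bd.h).mul P.polyGrowth_γ₃.bd)

theorem k_eq : P.k = fun h ε t => P.k₁ h ε t + P.k₂ h ε t := by
  funext h ε t; simp only [k, k₁, k₂]; ring

theorem bd_k : Bd b 1 P.k := by
  rw [k_eq]; exact P.bd_k₁.add (P.bd_k₂.mono one_le_two)

theorem bd_shift : Bd b 1 shift :=
  Bd.ε.sub (Bd.h.mul ((PolyGrowth.id.pow 2).mul (.const (1 / 2))).bd)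

theorem bd_V₁ : Bd b 1 P.V₁ :=
  (Bd.ε.mul P.polyGrowth_two_X.bd).add
    (Bd.h.mul (P.polyGrowth_X.mul ((P.polyGrowth_X.pow 2).sub (.const _))).bd)

theorem bd_V₂ : Bd b 2 P.V₂ :=
  ((bd_shift.mul bd_shift).add ((((PolyGrowth.const 4).mul .id).mul P.polyGrowth_X).bd.mul
    (Bd.h.mul bd_shift)) : Bd b 2 _).add
    ((((PolyGrowth.const 3).mul (PolyGrowth.id.pow 2)).mul (P.polyGrowth_X.pow 2)).bd.mul
      (Bd.h.mul Bd.h))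

theorem bd_potRem : Bd (3 / 4) 3 P.potRem := by
  have h1 : Bd (3 / 4) 3 _ := ((PolyGrowth.const 2).mul .id).bd.mul (Bd.h.mul (bd_shift.mul bd_shift))
  have h2 : Bd (3 / 4) 3 _ := ((((PolyGrowth.const 6).mul (PolyGrowth.id.pow 2)).mul P.polyGrowth_X).bd).mul
    (Bd.h.mul (Bd.h.mul bd_shift))
  have h3 : Bd (3 / 4) 4 _ := (((PolyGrowth.const 3).mul (PolyGrowth.id.pow 2)).bd).mul
    (Bd.h.mul (Bd.h.mul (bd_shift.mul bd_shift)))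
  have hs : Bd (3 / 4) 0 _ := P.polyGrowth_X.bd.add (bd_shift.mono zero_le_one)
  have h4 : Bd (3 / 4) 0 _ := (Bd.const 4).sub
    ((((Bd.const 3).mul Bd.t).mul Bd.h).mono zero_le_one)
  have h5 : Bd (3 / 4) 3 _ := (((Bd.h.mul (Bd.h.mul Bd.h)).mul (PolyGrowth.id.pow 3).bd).mul
    ((hs.mul hs).mul h4)).mul (Bd.inv_width.mul Bd.inv_width)
  exact ((h1.add h2).add (h3.mono (by norm_num))).add h5

/-- The part of the residual other than `potRem`. -/
def resRem (M : ℕ) (h ε t : ℝ) : ℝ :=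
  (1 - chi M h ε t) * (P.V₁ h ε t + P.V₂ h ε t - (h * P.avg P.srcβ + (ε * ε * P.avg P.src₁ +
    ε * h * P.avg P.src₂ + h * h * P.avg P.src₃)) + h * P.q t + h * h * (t * P.q t)) +
  h * (h * h) * (t ^ 2 * P.q t) * (1 - h * t)⁻¹ + chi M h ε t * (h * P.k₂ h ε t) +
  chi M h ε t * (P.k h ε t * (h * h)) * (t * (1 - h * t)⁻¹) +
  chi M h ε t * ((1 - chi M h ε t) * (P.k₁ h ε t * P.k₁ h ε t)) -
  chi M h ε t * chi M h ε t * (2 * (P.k₁ h ε t * P.k₂ h ε t) + P.k₂ h ε t * P.k₂ h ε t) -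
  chi' M h ε t * P.k h ε t

theorem bd_resRem (M : ℕ) : Bd (3 / 4) 3 (P.resRem M) := by
  have hV : Bd (3 / 4) 1 _ := P.bd_V₁.add (P.bd_V₂.mono one_le_two)
  have hl2 : Bd (3 / 4) 2 _ := (((Bd.ε.mul Bd.ε).mul (Bd.const (P.avg P.src₁))).add
    ((Bd.ε.mul Bd.h).mul (Bd.const (P.avg P.src₂)))).add
    ((Bd.h.mul Bd.h).mul (Bd.const (P.avg P.src₃)))
  have hl : Bd (3 / 4) 1 _ := (Bd.h.mul (Bd.const (P.avg P.srcβ))).add (hl2.mono one_le_two)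
  have hq2 : Bd (3 / 4) 2 _ := (Bd.h.mul Bd.h).mul (PolyGrowth.id.mul P.polyGrowth_q).bd
  have h1 : Bd (3 / 4) 3 _ := (bd_one_sub_chi M).mul
    (((hV.sub hl).add (Bd.h.mul P.polyGrowth_q.bd)).add (hq2.mono one_le_two))
  have h2 : Bd (3 / 4) 3 _ := ((Bd.h.mul (Bd.h.mul Bd.h)).mul
    ((PolyGrowth.id.pow 2).mul P.polyGrowth_q).bd).mul Bd.inv_width
  have h3 : Bd (3 / 4) 3 _ := (bd_chi M).mul (Bd.h.mul P.bd_k₂)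
  have h4 : Bd (3 / 4) 3 _ := ((bd_chi M).mul (P.bd_k.mul (Bd.h.mul Bd.h))).mul (Bd.t.mul Bd.inv_width)
  have h5 : Bd (3 / 4) 4 _ := (bd_chi M).mul ((bd_one_sub_chi M).mul (P.bd_k₁.mul P.bd_k₁))
  have h6 : Bd (3 / 4) 3 _ := ((bd_chi M).mul (bd_chi M)).mul
    ((((Bd.const 2).mul (P.bd_k₁.mul P.bd_k₂) : Bd (3 / 4) 3 _)).add
      ((P.bd_k₂.mul P.bd_k₂ : Bd (3 / 4) 4 _).mono (by norm_num)))
  have h7 : Bd (3 / 4) 3 _ := (bd_chi' M).mul P.bd_k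
  exact (((((h1.add h2).add h3).add h4).add (h5.mono (by norm_num))).sub h6).sub h7

theorem res_eq (M : ℕ) {h ε t : ℝ} (ht : 0 ≤ t) (hw : 1 - h * t ≠ 0) :
    P.res M h ε t = P.lev h ε + P.potRem h ε t + P.resRem M h ε t := by
  have hj : (1 - h * t)⁻¹ * (1 - h * t) = 1 := inv_mul_cancel₀ hw
  have hk : P.k h ε t = P.k₁ h ε t + P.k₂ h ε t := by rw [k_eq]
  rw [res, P.pot_eq ht hw]
  simp only [p', p, k', lev, resRem, hk, div_eq_mul_inv]
  generalize (1 - h * t)⁻¹ = j at *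
  generalize chi M h ε t = c at *
  generalize chi' M h ε t = c' at *
  generalize P.potRem h ε t = r at *
  simp only [V₁, V₂, shift, k₁, srcβ, src₁, src₂, src₃]
  generalize P.k₂ h ε t = z at *
  linear_combination ((h + h * h * t) * P.q t + h * c * (ε * P.α t + h * P.β t + z)) * hj

theorem res_sub_lev (M : ℕ) : ∃ C : ℝ, ∃ N : ℕ, 0 ≤ C ∧ ∀ h ε t : ℝ, 0 < h → h + |ε| ≤ 1 → 0 ≤ t →
    h * t ≤ 3 / 4 → |P.res M h ε t - P.lev h ε| ≤ C * (h + |ε|) ^ 3 * (1 + t ^ 2) ^ N := by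
  obtain ⟨C, N, hC, H⟩ := P.bd_potRem.add (P.bd_resRem M)
  refine ⟨C, N, hC, fun h ε t h0 h1 h2 h3 => ?_⟩
  rw [P.res_eq M h2 (by linarith), add_assoc, add_sub_cancel_left]
  exact H h ε t h0 h1 h2 h3

end Profile

end SC

namespace SC

theorem mul_chi_le (N : ℕ) (h ε t : ℝ) :
    (h + |ε|) * (1 + t ^ 2) ^ (N + 1) * chi (2 * N + 2) h ε t ≤ 1 := by
  have h1 := one_le_chi_den (2 * N + 2) h ε t
  unfold chi
  rw [← div_eq_mul_inv, div_le_one (by linarith)]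
  have e : (1 + t ^ 2) ^ (2 * N + 2) = ((1 + t ^ 2) ^ (N + 1)) ^ 2 := by rw [← pow_mul]; ring_nf
  rw [e]
  nlinarith [sq_nonneg ((h + |ε|) * (1 + t ^ 2) ^ (N + 1) - 1)]

namespace Profile

variable (P : Profile)

theorem exists_k_le : ∃ C : ℝ, ∃ N : ℕ, 0 ≤ C ∧ ∀ h ε t : ℝ, 0 < h → h + |ε| ≤ 1 → 0 ≤ t →
    |P.k h ε t| ≤ C * (h + |ε|) * (1 + t ^ 2) ^ N := by
  have habs : ∀ {F : ℝ → ℝ}, PolyGrowth F → PolyGrowth fun t => |F t| := fun ⟨C, N, hC, H⟩ =>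
    ⟨C, N, hC, fun t ht => by rw [abs_abs]; exact H t ht⟩
  obtain ⟨C, N, hC, H⟩ := ((((habs P.polyGrowth_α).add (habs P.polyGrowth_β)).add
    (habs P.polyGrowth_γ₁)).add (habs P.polyGrowth_γ₂)).add (habs P.polyGrowth_γ₃)
  refine ⟨C, N, hC, fun h ε t h0 h1 h2 => ?_⟩
  have H := (le_abs_self _).trans (H t h2)
  have e0 := abs_nonneg ε
  have hs : 0 ≤ h + |ε| := by positivity
  refine le_trans ?_ ((mul_le_mul_of_nonneg_left H hs).trans_eq (by ring))
  have t1 : |ε * P.α t| ≤ (h + |ε|) * |P.α t| := by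
    rw [abs_mul]; exact mul_le_mul_of_nonneg_right (by linarith) (abs_nonneg _)
  have t2 : |h * P.β t| ≤ (h + |ε|) * |P.β t| := by
    rw [abs_mul, abs_of_pos h0]; exact mul_le_mul_of_nonneg_right (by linarith) (abs_nonneg _)
  have t3 : |ε ^ 2 * P.γ₁ t| ≤ (h + |ε|) * |P.γ₁ t| := by
    rw [abs_mul, abs_pow]; exact mul_le_mul_of_nonneg_right (by nlinarith) (abs_nonneg _)
  have t4 : |ε * h * P.γ₂ t| ≤ (h + |ε|) * |P.γ₂ t| := by
    rw [abs_mul, abs_mul, abs_of_pos h0]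
    exact mul_le_mul_of_nonneg_right (by nlinarith) (abs_nonneg _)
  have t5 : |h ^ 2 * P.γ₃ t| ≤ (h + |ε|) * |P.γ₃ t| := by
    rw [abs_mul, abs_pow, abs_of_pos h0]
    exact mul_le_mul_of_nonneg_right (by nlinarith) (abs_nonneg _)
  unfold k
  have a1 := abs_add_le (ε * P.α t + h * P.β t)
    (ε ^ 2 * P.γ₁ t + ε * h * P.γ₂ t + h ^ 2 * P.γ₃ t)
  have a2 := abs_add_le (ε * P.α t) (h * P.β t)
  have a3 := abs_add_le (ε ^ 2 * P.γ₁ t + ε * h * P.γ₂ t) (h ^ 2 * P.γ₃ t)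
  have a4 := abs_add_le (ε ^ 2 * P.γ₁ t) (ε * h * P.γ₂ t)
  linarith

theorem exists_cutoff : ∃ M : ℕ, ∃ C : ℝ, 0 ≤ C ∧ ∀ h ε t : ℝ, 0 < h → h + |ε| ≤ 1 → 0 ≤ t →
    |chi M h ε t * P.k h ε t| ≤ C * (1 + t ^ 2)⁻¹ := by
  obtain ⟨C, N, hC, H⟩ := P.exists_k_le
  refine ⟨2 * N + 2, C, hC, fun h ε t h0 h1 h2 => ?_⟩
  have hJ : 0 < 1 + t ^ 2 := by positivity
  have hc := chi_pos (2 * N + 2) h ε t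
  rw [← div_eq_mul_inv, le_div_iff₀ hJ, abs_mul, abs_of_pos hc]
  calc chi (2 * N + 2) h ε t * |P.k h ε t| * (1 + t ^ 2)
      ≤ chi (2 * N + 2) h ε t * (C * (h + |ε|) * (1 + t ^ 2) ^ N) * (1 + t ^ 2) := by
        gcongr; exact H h ε t h0 h1 h2
    _ = C * ((h + |ε|) * (1 + t ^ 2) ^ (N + 1) * chi (2 * N + 2) h ε t) := by ring
    _ ≤ C * 1 := by gcongr; exact mul_chi_le N h ε t
    _ = C := mul_one C

theorem continuous_chi (M : ℕ) (h ε : ℝ) : Continuous (chi M h ε) :=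
  continuous_iff_continuousAt.2 fun t => (hasDerivAt_chi M h ε t).continuousAt

/-- The quasimode. -/
def mode (M : ℕ) (h ε t : ℝ) : ℝ :=
  P.v t * Real.exp (∫ s in (0 : ℝ)..t, chi M h ε s * P.k h ε s)

theorem mode_pos (M : ℕ) (h ε t : ℝ) : 0 < P.mode M h ε t := mul_pos (P.v_pos t) (Real.exp_pos _)

theorem hasDerivAt_mode (M : ℕ) (h ε t : ℝ) :
    HasDerivAt (P.mode M h ε) (P.p M h ε t * P.mode M h ε t) t := by
  have hc : Continuous fun s => chi M h ε s * P.k h ε s :=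
    (continuous_chi M h ε).mul (P.continuous_k h ε)
  have h1 : HasDerivAt (fun t => ∫ s in (0 : ℝ)..t, chi M h ε s * P.k h ε s)
      (chi M h ε t * P.k h ε t) t :=
    intervalIntegral.integral_hasDerivAt_right (hc.intervalIntegrable _ _)
      (hc.stronglyMeasurableAtFilter _ _) hc.continuousAt
  refine ((P.v_deriv t).mul h1.exp).congr_deriv ?_
  simp only [mode, p]; ring

theorem p_zero (M : ℕ) (h ε : ℝ) : P.p M h ε 0 = 0 := by
  simp [p, k, α, β, γ₁, γ₂, γ₃, P.q_zero, solve_zero]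

theorem mode_bounds {M : ℕ} {C : ℝ} (hC : 0 ≤ C) {h ε : ℝ}
    (H : ∀ t : ℝ, 0 ≤ t → |chi M h ε t * P.k h ε t| ≤ C * (1 + t ^ 2)⁻¹) {t : ℝ} (ht : 0 ≤ t) :
    P.v t * Real.exp (-(2 * C)) ≤ P.mode M h ε t ∧ P.mode M h ε t ≤ P.v t * Real.exp (2 * C) := by
  have hc : Continuous fun s => chi M h ε s * P.k h ε s :=
    (continuous_chi M h ε).mul (P.continuous_k h ε)
  have hci : Continuous fun s : ℝ => C * (1 + s ^ 2)⁻¹ :=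
    continuous_const.mul (Continuous.inv₀ (by fun_prop) fun s => by positivity)
  have h1 : |∫ s in (0 : ℝ)..t, chi M h ε s * P.k h ε s| ≤ 2 * C := by
    calc |∫ s in (0 : ℝ)..t, chi M h ε s * P.k h ε s|
        ≤ ∫ s in (0 : ℝ)..t, |chi M h ε s * P.k h ε s| :=
          intervalIntegral.abs_integral_le_integral_abs ht
      _ ≤ ∫ s in (0 : ℝ)..t, C * (1 + s ^ 2)⁻¹ :=
          intervalIntegral.integral_mono_on ht (hc.abs.intervalIntegrable _ _)
            (hci.intervalIntegrable _ _) fun s hs => H s hs.1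
      _ = C * Real.arctan t := by
          rw [intervalIntegral.integral_const_mul, integral_inv_one_add_sq, Real.arctan_zero,
            sub_zero]
      _ ≤ C * 2 := by
          gcongr
          linarith [Real.arctan_lt_pi_div_two t, Real.pi_lt_four]
      _ = 2 * C := by ring
  rw [abs_le] at h1
  unfold mode
  have hv := P.v_pos t
  constructor
  · gcongr; exact h1.1
  · gcongr; exact h1.2

theorem p_sq_add (M : ℕ) (h ε t : ℝ) : -P.p' M h ε t - P.p M h ε t ^ 2 =
    -(P.X t ^ 2 - P.ξ ^ 2) - chi M h ε t * (P.k' h ε t + 2 * P.q t * P.k h ε t) -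
      chi' M h ε t * P.k h ε t - (chi M h ε t * P.k h ε t) ^ 2 := by
  simp only [p, p']; ring

end Profile

end SC

namespace SC

namespace Profile

variable (P : Profile)

theorem xi_sq_lt_one : P.ξ ^ 2 < 1 := by nlinarith [P.ξ_neg, P.ξ_gt]

theorem exists_lev_sub : ∃ C : ℝ, 0 ≤ C ∧ ∀ h ε : ℝ, 0 < h → h + |ε| ≤ 1 →
    |P.lev h ε - P.ξ ^ 2| ≤ C * (h + |ε|) := by
  have h2 : Bd 1 2 _ := (((Bd.ε.mul Bd.ε).mul (Bd.const (P.avg P.src₁))).add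
    ((Bd.ε.mul Bd.h).mul (Bd.const (P.avg P.src₂)))).add
    ((Bd.h.mul Bd.h).mul (Bd.const (P.avg P.src₃)))
  have hl : Bd 1 1 _ := (Bd.h.mul (Bd.const (P.avg P.srcβ))).add (h2.mono one_le_two)
  obtain ⟨C, N, hC, H⟩ := hl
  refine ⟨C, hC, fun h ε h0 h1 => ?_⟩
  have := H h ε 0 h0 h1 le_rfl (by norm_num)
  simp only [pow_one, ne_eq, OfNat.ofNat_ne_zero, not_false_eq_true, zero_pow, add_zero, one_pow,
    mul_one] at this
  refine le_of_eq_of_le ?_ this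
  congr 1
  unfold lev; ring

theorem pot_lower {h ε t : ℝ} (h0 : 0 < h) (h1 : h + |ε| ≤ 1) (ht : 8 ≤ t) (htw : h * t < 1) :
    (t / 4) ^ 2 / (1 - h * t) ^ 2 ≤ P.pot h ε t := by
  unfold pot
  rw [div_pow (t + P.ξ + ε - h * t ^ 2 / 2) (1 - h * t)]
  have := abs_le.1 (show |ε| ≤ 1 by linarith)
  have := P.ξ_gt
  refine div_le_div_of_nonneg_right (pow_le_pow_left₀ (show 0 ≤ t / 4 by linarith) ?_ 2)
    (sq_nonneg _)
  nlinarith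

theorem pot_ge_four {h ε t : ℝ} (h0 : 0 < h) (h1 : h + |ε| ≤ 1) (ht : 8 ≤ t) (htw : h * t < 1) :
    4 ≤ P.pot h ε t := by
  refine le_trans ?_ (P.pot_lower h0 h1 ht htw)
  have : 0 < h * t := mul_pos h0 (by linarith)
  have hw : 0 < 1 - h * t := by linarith
  rw [le_div_iff₀ (by positivity)]
  nlinarith

theorem exists_far (M : ℕ) {Cp : ℝ} (hCp : 0 ≤ Cp) (hk : ∀ h ε t : ℝ, 0 < h → h + |ε| ≤ 1 → 0 ≤ t →
    |chi M h ε t * P.k h ε t| ≤ Cp * (1 + t ^ 2)⁻¹) :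
    ∃ h₀ : ℝ, ∃ C : ℝ, ∃ N : ℕ, 0 < h₀ ∧ 0 ≤ C ∧ ∀ h ε t : ℝ, 0 < h → h ≤ h₀ → h + |ε| ≤ 1 → 0 ≤ t →
    3 / 4 ≤ h * t → h * t < 1 → P.lev h ε - C * (h + |ε|) ^ 3 * (1 + t ^ 2) ^ N ≤ P.res M h ε t := by
  have hsrc2 : Bd 1 2 _ := (((Bd.ε.mul Bd.ε).mul P.polyGrowth_src₁.bd).add
    ((Bd.ε.mul Bd.h).mul P.polyGrowth_src₂.bd)).add ((Bd.h.mul Bd.h).mul P.polyGrowth_src₃.bd)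
  have hlev2 : Bd 1 2 _ := (((Bd.ε.mul Bd.ε).mul (Bd.const (P.avg P.src₁))).add
    ((Bd.ε.mul Bd.h).mul (Bd.const (P.avg P.src₂)))).add
    ((Bd.h.mul Bd.h).mul (Bd.const (P.avg P.src₃)))
  have hlev : Bd 1 1 _ := (Bd.h.mul (Bd.const (P.avg P.srcβ))).add (hlev2.mono one_le_two)
  have hsrc : Bd 1 1 _ := (((Bd.ε.mul P.polyGrowth_two_X.bd).add
    (Bd.h.mul P.polyGrowth_srcβ.bd)).add (hsrc2.mono one_le_two)).sub hlev
  have hG : Bd 1 0 _ := (((((P.polyGrowth_X.pow 2).sub (.const (P.ξ ^ 2))).neg).bd).sub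
    (((bd_chi M).mul (hsrc.mono zero_le_one)))).sub ((bd_chi' M |>.mono zero_le_two).mul
    (P.bd_k.mono zero_le_one))
  obtain ⟨CG, N, hCG, HG⟩ := hG.sub (((bd_chi M).mul (P.bd_k.mono zero_le_one)).mul
    ((bd_chi M).mul (P.bd_k.mono zero_le_one)))
  obtain ⟨Cl, hCl, Hl⟩ := P.exists_lev_sub
  set T : ℝ := 8 + 16 * (3 + Cp) with hT
  have hT0 : 0 < T := by positivity
  refine ⟨3 / (4 * T), (CG + (1 + Cl)) * 3, N + 2, by positivity, by positivity,
    fun h ε t h0 hh h1 ht hta htb => ?_⟩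
  have hG := HG h ε t h0 h1 ht (by linarith)
  have hl := Hl h ε h0 h1
  have hkt := hk h ε t h0 h1 ht
  simp only [pow_zero, mul_one] at hG
  have htT : T ≤ t := by
    rw [le_div_iff₀ (by positivity)] at hh
    by_contra! hlt
    nlinarith
  have ht8 : 8 ≤ t := by linarith
  have hw : 0 < 1 - h * t := by linarith
  have hpot := P.pot_lower h0 h1 ht8 htb
  have hkc : |chi M h ε t * P.k h ε t| ≤ Cp := hkt.trans
    (mul_le_of_le_one_right hCp (inv_le_one_of_one_le₀ (one_le_one_add_sq t)))
  have hp : -(t * (3 + Cp)) ≤ P.p M h ε t := by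
    have := P.q_ge ht
    have := (abs_le.1 hkc).1
    unfold p
    nlinarith
  have hhp : -((t / 4) ^ 2 / (1 - h * t) ^ 2) ≤ h / (1 - h * t) * P.p M h ε t := by
    have e1 : h / (1 - h * t) * -(t * (3 + Cp)) ≤ h / (1 - h * t) * P.p M h ε t :=
      mul_le_mul_of_nonneg_left hp (by positivity)
    refine le_trans ?_ e1
    rw [div_mul_eq_mul_div, mul_neg, neg_div, neg_le_neg_iff, div_le_div_iff₀ hw (by positivity)]
    have e2 : h * (t * (3 + Cp)) * (1 - h * t) ≤ (t / 4) ^ 2 := by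
      have a1 : h * t * (1 - h * t) ≤ 1 := by nlinarith
      have a2 : h * t * (1 - h * t) * (3 + Cp) ≤ 1 * (3 + Cp) :=
        mul_le_mul_of_nonneg_right a1 (by positivity)
      have a3 : 16 * (3 + Cp) ≤ t := by linarith
      nlinarith
    calc h * (t * (3 + Cp)) * (1 - h * t) ^ 2
        = h * (t * (3 + Cp)) * (1 - h * t) * (1 - h * t) := by ring
      _ ≤ (t / 4) ^ 2 * (1 - h * t) := mul_le_mul_of_nonneg_right e2 hw.le
  have hlow : -(CG * (1 + t ^ 2) ^ N) ≤ -P.p' M h ε t - P.p M h ε t ^ 2 := by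
    rw [P.p_sq_add]
    refine (abs_le.1 hG).1.trans (le_of_eq ?_)
    simp only [k', lev]; ring
  have hlev1 : P.lev h ε ≤ 1 + Cl := by
    have := (abs_le.1 hl).2
    have := P.xi_sq_lt_one
    nlinarith
  have hJ : 1 ≤ (1 + t ^ 2) ^ N := one_le_pow₀ (one_le_one_add_sq t)
  have hs3 : 1 ≤ 3 * ((h + |ε|) ^ 3 * (1 + t ^ 2) ^ 2) := by
    have b1 : (3 / 4 : ℝ) ^ 3 ≤ (h * t) ^ 3 := pow_le_pow_left₀ (by norm_num) hta 3
    have b2 : h ^ 3 ≤ (h + |ε|) ^ 3 := pow_le_pow_left₀ h0.le (by linarith [abs_nonneg ε]) 3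
    have b3 : t ^ 3 ≤ (1 + t ^ 2) ^ 2 := by nlinarith [sq_nonneg (t ^ 2), pow_pos (show 0 < t by linarith) 3]
    have b4 : h ^ 3 * t ^ 3 ≤ (h + |ε|) ^ 3 * (1 + t ^ 2) ^ 2 := by gcongr
    rw [mul_pow] at b1
    norm_num at b1
    linarith
  have hfin : (CG + (1 + Cl)) * (1 + t ^ 2) ^ N ≤
      (CG + (1 + Cl)) * 3 * (h + |ε|) ^ 3 * (1 + t ^ 2) ^ (N + 2) := by
    have := mul_le_mul_of_nonneg_left hs3
      (show 0 ≤ (CG + (1 + Cl)) * (1 + t ^ 2) ^ N by positivity)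
    rw [pow_add]
    linarith
  have : (1 + Cl) ≤ (1 + Cl) * (1 + t ^ 2) ^ N := le_mul_of_one_le_right (by positivity) hJ
  unfold res
  linarith

/-- Existence of a supersolution of the Riccati equation at the approximate eigenvalue, up to a
third-order error. -/
theorem exists_super : ∃ s₀ C : ℝ, 0 < s₀ ∧ s₀ ≤ 1 ∧ 0 ≤ C ∧ ∀ h ε : ℝ, 0 < h → h + |ε| ≤ s₀ →
    ∃ g g' : ℝ → ℝ, g 0 = 0 ∧ (∀ t, HasDerivAt g (g' t) t) ∧ ∀ t, 0 ≤ t → h * t < 1 →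
      P.lev h ε - C * (h + |ε|) ^ 3 ≤ P.pot h ε t - g' t - g t ^ 2 + h / (1 - h * t) * g t := by
  obtain ⟨M, Cp, hCp, hk⟩ := P.exists_cutoff
  obtain ⟨h₀, C₁, N₁, hh₀, hC₁, Hfar⟩ := P.exists_far M hCp hk
  obtain ⟨C₂, N₂, hC₂, Hnear⟩ := P.res_sub_lev M
  obtain ⟨Cl, hCl, Hl⟩ := P.exists_lev_sub
  set N := max N₁ N₂
  set C := max C₁ C₂
  have hC : 0 ≤ C := hC₁.trans (le_max_left _ _)
  obtain ⟨Cv, hCv, Hv⟩ := P.v_mul_pow_bounded N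
  set K := Real.exp (2 * Cp) * Cv * C + 1 with hK
  have hK0 : 0 < K := by positivity
  set m := P.v 8 * Real.exp (-(2 * Cp)) with hm
  have hm0 : 0 < m := mul_pos (P.v_pos _) (Real.exp_pos _)
  set s₀ := min (min 1 h₀) (1 / (1 + Cl)) with hs₀
  refine ⟨s₀, C * 65 ^ N + 2 * K / m, by positivity,
    (min_le_left _ _).trans (min_le_left _ _), by positivity, fun h ε h0 hs => ?_⟩
  have hε := abs_nonneg ε
  have hs1 : h + |ε| ≤ 1 := hs.trans ((min_le_left _ _).trans (min_le_left _ _))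
  have hsh : h ≤ h₀ := by
    have := hs.trans ((min_le_left _ _).trans (min_le_right _ _))
    linarith
  have hsl : P.lev h ε ≤ 2 := by
    have e1 := hs.trans (min_le_right _ _)
    rw [le_div_iff₀ (by positivity)] at e1
    have := (abs_le.1 (Hl h ε h0 hs1)).2
    have := P.xi_sq_lt_one
    nlinarith
  set f := P.mode M h ε
  have hf : ∀ t, 0 < f t := P.mode_pos M h ε
  have hfb : ∀ {t : ℝ}, 0 ≤ t → _ := fun {t} ht => P.mode_bounds hCp (fun t => hk h ε t h0 hs1) ht
  set δ := K * (h + |ε|) ^ 3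
  have hδ : 0 < δ := by positivity
  have hres : ∀ t, 0 ≤ t → h * t < 1 →
      -(C * (h + |ε|) ^ 3 * (1 + t ^ 2) ^ N) ≤ P.res M h ε t - P.lev h ε := by
    intro t ht htw
    have e1 : (1 + t ^ 2) ^ N₁ ≤ (1 + t ^ 2) ^ N :=
      pow_le_pow_right₀ (one_le_one_add_sq t) (le_max_left _ _)
    have e2 : (1 + t ^ 2) ^ N₂ ≤ (1 + t ^ 2) ^ N :=
      pow_le_pow_right₀ (one_le_one_add_sq t) (le_max_right _ _)
    rcases le_or_gt (h * t) (3 / 4) with h3 | h3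
    · have := (abs_le.1 (Hnear h ε t h0 hs1 ht h3)).1
      refine le_trans (neg_le_neg ?_) this
      gcongr
      exact le_max_right _ _
    · have := Hfar h ε t h0 hsh hs1 ht h3.le htw
      have e3 : C₁ * (h + |ε|) ^ 3 * (1 + t ^ 2) ^ N₁ ≤ C * (h + |ε|) ^ 3 * (1 + t ^ 2) ^ N := by
        gcongr
        exact le_max_left _ _
      linarith
  refine ⟨fun t => f t / (f t + δ) * P.p M h ε t,
    fun t => (δ / (f t + δ) * (f t / (f t + δ)) * P.p M h ε t) * P.p M h ε t +
      f t / (f t + δ) * P.p' M h ε t, by simp [p_zero], fun t => ?_, fun t ht htw => ?_⟩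
  · have hfd := P.hasDerivAt_mode M h ε t
    have hne : f t + δ ≠ 0 := by have := hf t; positivity
    refine ((hfd.div (hfd.add_const δ) hne).mul (P.hasDerivAt_p M h ε t)).congr_deriv ?_
    change (P.p M h ε t * f t * (f t + δ) - f t * (P.p M h ε t * f t)) / (f t + δ) ^ 2 *
      P.p M h ε t + f t / (f t + δ) * P.p' M h ε t = _
    congr 2
    field_simp
    ring
  · have hft := hf t
    have hw : 0 < 1 - h * t := by linarith
    have hden : 0 < f t + δ := by positivity
    have key : P.pot h ε t - ((δ / (f t + δ) * (f t / (f t + δ)) * P.p M h ε t) * P.p M h ε t +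
        f t / (f t + δ) * P.p' M h ε t) - (f t / (f t + δ) * P.p M h ε t) ^ 2 +
        h / (1 - h * t) * (f t / (f t + δ) * P.p M h ε t) =
        P.lev h ε + (δ * (P.pot h ε t - P.lev h ε) + f t * (P.res M h ε t - P.lev h ε)) /
          (f t + δ) := by
      unfold res
      field_simp
      ring
    rw [key, sub_eq_add_neg]
    refine add_le_add le_rfl ?_
    rw [le_div_iff₀ hden]
    have hr := mul_le_mul_of_nonneg_left (hres t ht htw) hft.le
    rcases le_or_gt t 8 with h8 | h8
    · have hpot0 : 0 ≤ P.pot h ε t := sq_nonneg _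
      have hJ : (1 + t ^ 2) ^ N ≤ 65 ^ N := by gcongr; nlinarith
      have hmf : m ≤ f t := by
        refine le_trans ?_ (hfb ht).1
        have := P.v_antitone ht (show (8 : ℝ) ∈ Ici 0 by simp) h8
        exact mul_le_mul_of_nonneg_right this (Real.exp_pos _).le
      have a1 : C * (h + |ε|) ^ 3 * (1 + t ^ 2) ^ N ≤ C * (h + |ε|) ^ 3 * 65 ^ N := by gcongr
      have a2 := mul_le_mul_of_nonneg_left a1 hft.le
      have a3 : 2 * δ ≤ 2 * K / m * (h + |ε|) ^ 3 * (f t) := by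
        rw [div_mul_eq_mul_div, div_mul_eq_mul_div, le_div_iff₀ hm0]
        have := mul_le_mul_of_nonneg_left hmf (show 0 ≤ 2 * δ by positivity)
        linarith
      have a4 : 0 ≤ (C * 65 ^ N + 2 * K / m) * (h + |ε|) ^ 3 * δ := by positivity
      have a5 : δ * (-2) ≤ δ * (P.pot h ε t - P.lev h ε) := by
        gcongr; linarith
      linarith
    · have hpot := P.pot_ge_four h0 hs1 h8.le htw
      have b1 : f t * (1 + t ^ 2) ^ N ≤ Real.exp (2 * Cp) * Cv := by
        have := mul_le_mul_of_nonneg_right (hfb ht).2 (show 0 ≤ (1 + t ^ 2) ^ N by positivity)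
        have := mul_le_mul_of_nonneg_left (Hv t ht) (Real.exp_pos (2 * Cp)).le
        linarith
      have b2 : f t * (C * (h + |ε|) ^ 3 * (1 + t ^ 2) ^ N) ≤ δ := by
        have := mul_le_mul_of_nonneg_right b1 (show 0 ≤ C * (h + |ε|) ^ 3 by positivity)
        have : 0 ≤ (h + |ε|) ^ 3 := by positivity
        change _ ≤ (Real.exp (2 * Cp) * Cv * C + 1) * (h + |ε|) ^ 3
        linarith
      have b3 : δ * 1 ≤ δ * (P.pot h ε t - P.lev h ε) := by
        gcongr; linarith
      have b4 : 0 ≤ (C * 65 ^ N + 2 * K / m) * (h + |ε|) ^ 3 * (f t + δ) := by positivity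
      linarith

end Profile

end SC

namespace SC

/-- The effective radial potential of angular momentum `m` in the variable `ϱ = √B r`. -/
def radial (m ϱ : ℝ) : ℝ := m / ϱ - ϱ / 2

theorem hasDerivAt_radial (m : ℝ) {ϱ : ℝ} (h : 0 < ϱ) :
    HasDerivAt (radial m) (-(m / ϱ ^ 2) - 1 / 2) ϱ := by
  have h1 := ((hasDerivAt_inv h.ne').const_mul m).sub ((hasDerivAt_id ϱ).div_const 2)
  refine (h1.congr_deriv ?_).congr_of_eventuallyEq (.of_forall fun x => ?_)
  · ring
  · simp [radial, div_eq_mul_inv]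

theorem continuousOn_radial (m : ℝ) {a b : ℝ} (ha : 0 < a) : ContinuousOn (radial m) (Icc a b) :=
  fun _ hx => (hasDerivAt_radial m (ha.trans_le hx.1)).continuousAt.continuousWithinAt

theorem radial_eq_div (m : ℝ) {ϱ : ℝ} (h : 0 < ϱ) : radial m ϱ = (m - ϱ ^ 2 / 2) / ϱ := by
  unfold radial
  field_simp

theorem radial_antitone {m : ℝ} (hm : 0 ≤ m) {a b : ℝ} (ha : 0 < a) (hab : a ≤ b) :
    radial m b ≤ radial m a := by
  unfold radial
  have := div_le_div_of_nonneg_left hm ha hab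
  linarith

/-- A coercivity estimate with boundary terms for a weighted one-dimensional form, from a
Riccati subsolution `P`. -/
theorem riccati_bound {m lam a b : ℝ} {P P' f f' : ℝ → ℝ} (ha : 0 < a) (hab : a ≤ b)
    (hP : ∀ x ∈ Icc a b, HasDerivAt P (P' x) x)
    (hle : ∀ x ∈ Icc a b, P' x + P x / x + P x ^ 2 ≤ radial m x ^ 2 - lam)
    (hf : ∀ x, HasDerivAt f (f' x) x) (hf' : Continuous f') :
    lam * (∫ x in a..b, f x ^ 2 * x) + b * P b * f b ^ 2 ≤
      (∫ x in a..b, (f' x ^ 2 + radial m x ^ 2 * f x ^ 2) * x) + a * P a * f a ^ 2 := by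
  have hfc : Continuous f := continuous_iff_continuousAt.2 fun x => (hf x).continuousAt
  have hW := continuousOn_radial m (b := b) ha
  have hc1 : ContinuousOn (fun x => f x ^ 2 * x) (Icc a b) := by fun_prop
  have hc2 : ContinuousOn (fun x => (f' x ^ 2 + radial m x ^ 2 * f x ^ 2) * x) (Icc a b) := by
    fun_prop
  have hd : ∀ x ∈ Icc a b, HasDerivAt (fun x => x * P x * f x ^ 2)
      ((P x + x * P' x) * f x ^ 2 + x * P x * (2 * f x * f' x)) x := fun x hx => by
    refine ((((hasDerivAt_id x).mul (hP x hx)).mul ((hf x).pow 2)).congr_deriv ?_)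
    simp
  have key := intervalIntegral.sub_le_integral_of_hasDeriv_right_of_le hab
    (fun x hx => (hd x hx).continuousAt.continuousWithinAt)
    (fun x hx => (hd x (Ioo_subset_Icc_self hx)).hasDerivWithinAt)
    (φ := fun x => (f' x ^ 2 + radial m x ^ 2 * f x ^ 2) * x - lam * (f x ^ 2 * x))
    (hc2.sub (hc1.const_smul lam)).integrableOn_Icc (fun x hx => by
      have hx' := Ioo_subset_Icc_self hx
      have hx0 : 0 < x := ha.trans hx.1
      have h1 := mul_le_mul_of_nonneg_left (hle x hx')
        (mul_nonneg hx0.le (sq_nonneg (f x)))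
      have h2 := mul_nonneg hx0.le (sq_nonneg (f' x - P x * f x))
      have h3 : x * f x ^ 2 * (P' x + P x / x + P x ^ 2) =
          (P x + x * P' x) * f x ^ 2 + x * P x ^ 2 * f x ^ 2 := by
        field_simp
        ring
      rw [h3] at h1
      nlinarith)
  have hu := uIcc_of_le hab
  rw [intervalIntegral.integral_sub (hu ▸ hc2).intervalIntegrable
    ((hu ▸ hc1).intervalIntegrable.const_mul lam), intervalIntegral.integral_const_mul] at key
  linarith

/-- The radial form of angular momentum `m` on `(0, R)` is bounded below by `lam`, up to a
boundary term at the inner end which is absent for `m = 0`. -/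
def RadialBound (m R lam : ℝ) : Prop :=
  ∃ C η₀ : ℝ, 0 ≤ C ∧ 0 < η₀ ∧ η₀ ≤ R ∧ (m = 0 → C = 0) ∧ ∀ f f' : ℝ → ℝ,
    (∀ r, HasDerivAt f (f' r) r) → Continuous f' → ∀ η, 0 < η → η < η₀ →
    lam * (∫ ϱ in η..R, f ϱ ^ 2 * ϱ) ≤
      (∫ ϱ in η..R, (f' ϱ ^ 2 + radial m ϱ ^ 2 * f ϱ ^ 2) * ϱ) + C * f η ^ 2

theorem RadialBound.of_sub {m R lam C : ℝ} {P P' : ℝ → ℝ} (hR : 0 < R) (hC : 0 ≤ C)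
    (hC0 : m = 0 → C = 0) (hP : ∀ x ∈ Ioc 0 R, HasDerivAt P (P' x) x)
    (hle : ∀ x ∈ Ioc 0 R, P' x + P x / x + P x ^ 2 ≤ radial m x ^ 2 - lam)
    (hend : 0 ≤ P R) (hbd : ∀ x ∈ Ioc 0 R, x * P x ≤ C) : RadialBound m R lam := by
  refine ⟨C, R, hC, hR, le_rfl, hC0, fun f f' hf hf' η h0 hη => ?_⟩
  have hs : ∀ x ∈ Icc η R, x ∈ Ioc 0 R := fun x hx => ⟨h0.trans_le hx.1, hx.2⟩
  have := riccati_bound h0 hη.le (fun x hx => hP x (hs x hx)) (fun x hx => hle x (hs x hx)) hf hf'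
  have h1 : 0 ≤ R * P R * f R ^ 2 := by positivity
  have h2 := mul_le_mul_of_nonneg_right (hbd η ⟨h0, hη.le⟩) (sq_nonneg (f η))
  linarith

theorem RadialBound.mono {m R lam lam' : ℝ} (H : RadialBound m R lam) (h : lam' ≤ lam) :
    RadialBound m R lam' := by
  obtain ⟨C, η₀, hC, h0, hR, hC0, H⟩ := H
  refine ⟨C, η₀, hC, h0, hR, hC0, fun f f' hf hf' η h1 h2 =>
    le_trans (mul_le_mul_of_nonneg_right h ?_) (H f f' hf hf' η h1 h2)⟩
  exact intervalIntegral.integral_nonneg (h2.le.trans hR)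
    fun x hx => mul_nonneg (sq_nonneg _) (h1.le.trans hx.1)

theorem RadialBound.extend {m R R' lam : ℝ} (H : RadialBound m R' lam) (hR : R' ≤ R)
    (hW : ∀ x ∈ Icc R' R, lam ≤ radial m x ^ 2) : RadialBound m R lam := by
  obtain ⟨C, η₀, hC, h0, hη, hC0, H⟩ := H
  refine ⟨C, η₀, hC, h0, hη.trans hR, hC0, fun f f' hf hf' η h1 h2 => ?_⟩
  have h3 := H f f' hf hf' η h1 h2
  have hR' : 0 < R' := h0.trans_le hη
  have hle : η ≤ R' := h2.le.trans hη
  have hfc : Continuous f := continuous_iff_continuousAt.2 fun x => (hf x).continuousAt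
  have hc1 : Continuous (fun x => f x ^ 2 * x) := by fun_prop
  have hc2 : ContinuousOn (fun x => (f' x ^ 2 + radial m x ^ 2 * f x ^ 2) * x) (Icc η R) := by
    have := continuousOn_radial m (b := R) h1
    fun_prop
  have hi1 : IntervalIntegrable (fun x => (f' x ^ 2 + radial m x ^ 2 * f x ^ 2) * x) volume η R' :=
    (hc2.mono (uIcc_of_le hle ▸ Icc_subset_Icc_right hR)).intervalIntegrable
  have hi2 : IntervalIntegrable (fun x => (f' x ^ 2 + radial m x ^ 2 * f x ^ 2) * x) volume R' R :=
    (hc2.mono (uIcc_of_le hR ▸ Icc_subset_Icc_left hle)).intervalIntegrable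
  rw [← intervalIntegral.integral_add_adjacent_intervals hi1 hi2,
    ← intervalIntegral.integral_add_adjacent_intervals (hc1.intervalIntegrable η R')
      (hc1.intervalIntegrable R' R), mul_add]
  have h4 : lam * (∫ x in R'..R, f x ^ 2 * x) ≤
      ∫ x in R'..R, (f' x ^ 2 + radial m x ^ 2 * f x ^ 2) * x := by
    rw [← intervalIntegral.integral_const_mul]
    refine intervalIntegral.integral_mono_on hR ((hc1.intervalIntegrable _ _).const_mul _) hi2
      fun x hx => ?_
    have hx0 : 0 ≤ x := hR'.le.trans hx.1
    have h5 := mul_le_mul_of_nonneg_right (hW x hx) (mul_nonneg (sq_nonneg (f x)) hx0)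
    have h6 := mul_nonneg (sq_nonneg (f' x)) hx0
    nlinarith
  linarith

set_option maxHeartbeats 800000 in
/-- A low or negative angular momentum sees the bulk: the level is close to `1`. -/
theorem radialBound_of_le {M₀ lam : ℝ} (hM : 0 ≤ M₀) (hl : 0 ≤ lam) (hl1 : lam < 1) :
    ∃ R₀ : ℝ, 0 < R₀ ∧ ∀ R m : ℝ, R₀ ≤ R → m ≤ M₀ → RadialBound m R lam := by
  obtain ⟨θ, hθ, hθ1⟩ := exists_between hl1
  have hκ : 0 < 1 - θ ^ 2 := by nlinarith
  have hd : 0 < θ - lam := by linarith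
  refine ⟨1 + 32 * (M₀ + 1) / (θ - lam) + 16 / (1 - θ ^ 2), by positivity, fun R m hR hm => ?_⟩
  have hA : 0 ≤ 32 * (M₀ + 1) / (θ - lam) := by positivity
  have hB : 0 ≤ 16 / (1 - θ ^ 2) := by positivity
  have hR1 : 1 ≤ R := by linarith
  have hRR : R ≤ R ^ 2 := by nlinarith
  have hR2 : 32 * (M₀ + 1) ≤ (θ - lam) * R ^ 2 := by
    have : 32 * (M₀ + 1) / (θ - lam) ≤ R ^ 2 := by linarith
    rw [div_le_iff₀ hd] at this
    linarith
  have hR3 : 16 ≤ (1 - θ ^ 2) * R ^ 2 := by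
    have : 16 / (1 - θ ^ 2) ≤ R ^ 2 := by linarith
    rw [div_le_iff₀ hκ] at this
    linarith
  have hR0 : 0 < R := by linarith
  refine RadialBound.of_sub (C := |m|) (P := fun x => θ * (1 - (x / R) ^ 2) * radial m x)
    (P' := fun x => θ * (-(2 * x / R ^ 2)) * radial m x +
      θ * (1 - (x / R) ^ 2) * (-(m / x ^ 2) - 1 / 2)) hR0 (abs_nonneg _) (by simp)
    (fun x hx => ?_) (fun x hx => ?_) (by simp [hR0.ne']) (fun x hx => ?_)
  · refine ((((((hasDerivAt_id x).div_const R).pow 2).const_sub 1).const_mul θ).mul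
      (hasDerivAt_radial m hx.1)).congr_deriv ?_
    simp only [id, Pi.pow_apply]
    have := hx.1.ne'
    generalize radial m x = w
    field_simp
    linear_combination (-4 * θ * x ^ 3 * w) * mul_inv_cancel₀ hR0.ne'
  · have hx0 := hx.1
    obtain ⟨y, hy⟩ : ∃ y, y = x ^ 2 := ⟨_, rfl⟩
    obtain ⟨k, hk⟩ : ∃ k, k = 1 / R ^ 2 := ⟨_, rfl⟩
    have hk0 : 0 < k := by rw [hk]; positivity
    have hkR : k * R ^ 2 = 1 := by rw [hk]; field_simp
    have hy0 : 0 < y := by rw [hy]; positivity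
    have hxR : x ^ 2 ≤ R ^ 2 := pow_le_pow_left₀ hx0.le hx.2 2
    have hyk : k * y ≤ 1 := by rw [hy, ← hkR]; exact mul_le_mul_of_nonneg_left hxR hk0.le
    have hk2 : k * (32 * (M₀ + 1)) ≤ θ - lam := by
      have := mul_le_mul_of_nonneg_left hR2 hk0.le
      linear_combination this + (θ - lam) * hkR
    have hk3 : 16 * k ≤ 1 - θ ^ 2 := by
      have := mul_le_mul_of_nonneg_left hR3 hk0.le
      linear_combination this + (1 - θ ^ 2) * hkR
    have hW : radial m x ^ 2 = m ^ 2 / y - m + y / 4 := by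
      unfold radial; rw [hy]; field_simp; ring
    have hc : (θ * (1 - k * y)) ^ 2 ≤ θ ^ 2 := by
      have : (1 - k * y) ^ 2 ≤ 1 := by
        have := mul_pos hk0 hy0
        nlinarith
      rw [mul_pow]
      nlinarith [sq_nonneg θ]
    have hWn := sq_nonneg (radial m x)
    have hlhs : θ * (-(2 * x / R ^ 2)) * radial m x +
        θ * (1 - (x / R) ^ 2) * (-(m / x ^ 2) - 1 / 2) +
        θ * (1 - (x / R) ^ 2) * radial m x / x + (θ * (1 - (x / R) ^ 2) * radial m x) ^ 2 =
        -θ + 2 * θ * (k * y) - 2 * θ * (k * m) + (θ * (1 - k * y)) ^ 2 * radial m x ^ 2 := by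
      rw [hy, hk]; unfold radial; field_simp; ring
    rw [hlhs]
    have h1 := mul_le_mul_of_nonneg_right hc hWn
    have hm2 : 0 ≤ m ^ 2 / y := by positivity
    have h2 : (1 - θ ^ 2) * (y / 4 - m) ≤ (1 - θ ^ 2) * radial m x ^ 2 :=
      mul_le_mul_of_nonneg_left (by linarith) hκ.le
    have hθ0 : 0 < θ := by linarith
    suffices hs : lam ≤ θ - 2 * θ * (k * y) + 2 * θ * (k * m) + (1 - θ ^ 2) * radial m x ^ 2 by
      linarith
    rcases le_total m 0 with hm0 | hm0
    · have h3 : 16 * k * (y / 4 - m) ≤ (1 - θ ^ 2) * (y / 4 - m) :=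
        mul_le_mul_of_nonneg_right hk3 (by linarith)
      have h4 : 0 ≤ k * y := by positivity
      have h5 : 0 ≤ k * (-m) := mul_nonneg hk0.le (by linarith)
      have h6 : θ * (k * y) ≤ k * y := mul_le_of_le_one_left h4 hθ1.le
      have h7 : θ * (k * (-m)) ≤ k * (-m) := mul_le_of_le_one_left h5 hθ1.le
      linarith
    · have h5 : 0 ≤ θ * (k * m) := by positivity
      rcases le_total y (16 * M₀) with hy1 | hy1
      · have h6 : k * y ≤ k * (16 * M₀) := mul_le_mul_of_nonneg_left hy1 hk0.le
        have h7 : θ * (k * y) ≤ k * y := mul_le_of_le_one_left (by positivity) hθ1.le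
        have h8 := mul_nonneg hκ.le hWn
        nlinarith
      · have h3 : 16 * k * (y / 4 - m) ≤ (1 - θ ^ 2) * (y / 4 - m) :=
          mul_le_mul_of_nonneg_right hk3 (by linarith)
        have h7 : θ * (k * y) ≤ k * y := mul_le_of_le_one_left (by positivity) hθ1.le
        have h8 : k * (16 * m) ≤ k * y := mul_le_mul_of_nonneg_left (by linarith) hk0.le
        have h9 : 0 ≤ k * y := by positivity
        linarith
  · have hx0 := hx.1
    have hc1 : (x / R) ^ 2 ≤ 1 := by
      rw [div_pow]; exact div_le_one_of_le₀ (pow_le_pow_left₀ hx0.le hx.2 2) (by positivity)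
    have hθ0 : 0 < θ := by linarith
    have hxr : x * radial m x ≤ |m| := by
      unfold radial
      have : x * (m / x - x / 2) = m - x ^ 2 / 2 := by field_simp
      rw [this]
      have := le_abs_self m
      nlinarith
    have hc : θ * (1 - (x / R) ^ 2) ≤ 1 :=
      mul_le_one₀ hθ1.le (by linarith) (by linarith [sq_nonneg (x / R)])
    have hc0 : 0 ≤ θ * (1 - (x / R) ^ 2) := mul_nonneg hθ0.le (by linarith)
    calc x * (θ * (1 - (x / R) ^ 2) * radial m x)
        = θ * (1 - (x / R) ^ 2) * (x * radial m x) := by ring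
      _ ≤ θ * (1 - (x / R) ^ 2) * |m| := mul_le_mul_of_nonneg_left hxr hc0
      _ ≤ |m| := mul_le_of_le_one_left (abs_nonneg _) hc

end SC

namespace SC

/-- `lam` admits a global Riccati subsolution for angular momentum `m` which vanishes at `R`. -/
def HasSub (m R lam : ℝ) : Prop :=
  ∃ P P' : ℝ → ℝ, P R = 0 ∧ (∀ x, HasDerivAt P (P' x) x) ∧
    ∀ x ∈ Ioc 0 R, P' x + P x / x + P x ^ 2 ≤ radial m x ^ 2 - lam

theorem HasSub.mono {m R lam lam' : ℝ} (H : HasSub m R lam) (h : lam' ≤ lam) :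
    HasSub m R lam' := by
  obtain ⟨P, P', h0, h1, h2⟩ := H
  exact ⟨P, P', h0, h1, fun x hx => (h2 x hx).trans (by linarith)⟩

theorem HasSub.radialBound_of_nonneg {m R R' lam : ℝ} (hm : m ≠ 0) (hR : 0 < R) {P P' : ℝ → ℝ}
    (hP : ∀ x, HasDerivAt P (P' x) x) (h0 : 0 ≤ P R) (hRR : R ≤ R')
    (hle : ∀ x ∈ Ioc 0 R', P' x + P x / x + P x ^ 2 ≤ radial m x ^ 2 - lam) :
    RadialBound m R lam := by
  have hc : Continuous fun x => x * P x :=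
    continuous_id.mul (continuous_iff_continuousAt.2 fun x => (hP x).continuousAt)
  obtain ⟨C, hC⟩ := isCompact_Icc.exists_bound_of_continuousOn (s := Icc 0 R) hc.continuousOn
  have hC0 : 0 ≤ C := (norm_nonneg _).trans (hC 0 ⟨le_rfl, hR.le⟩)
  exact RadialBound.of_sub hR hC0 (fun h => absurd h hm) (fun x _ => hP x)
    (fun x hx => hle x ⟨hx.1, hx.2.trans hRR⟩) h0
    fun x hx => (le_abs_self _).trans (hC x ⟨hx.1.le, hx.2⟩)

theorem HasSub.radialBound {m R lam : ℝ} (H : HasSub m R lam) (hm : m ≠ 0) (hR : 0 < R) :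
    RadialBound m R lam := by
  obtain ⟨P, P', h0, h1, h2⟩ := H
  exact HasSub.radialBound_of_nonneg hm hR h1 h0.ge le_rfl h2

theorem HasSub.radialBound_of_le {m R R' lam : ℝ} (H : HasSub m R' lam) (hm : m ≠ 0) (hR : 0 < R)
    (hRR : R < R') {a b : ℝ} (ha : m = R ^ 2 / 2 + a) (hb : m = R' ^ 2 / 2 - b)
    (hab : a ^ 2 - a * b + b ^ 2 ≤ 3 * lam * R ^ 2) : RadialBound m R lam := by
  obtain ⟨P, P', h0, h1, h2⟩ := H
  refine HasSub.radialBound_of_nonneg hm hR h1 ?_ hRR.le h2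
  have hd : ∀ x, HasDerivAt (fun x => x * P x + lam * x ^ 2 / 2 + (m - x ^ 2 / 2) ^ 3 / (3 * R ^ 2))
      (P x + x * P' x + lam * x - (m - x ^ 2 / 2) ^ 2 * x / R ^ 2) x := fun x => by
    refine ((((hasDerivAt_id x).mul (h1 x)).add
      ((((hasDerivAt_id x).pow 2).const_mul lam).div_const 2)).add
      ((((((hasDerivAt_id x).pow 2).div_const 2).const_sub m).pow 3).div_const _)).congr_deriv ?_
    simp only [id, Pi.pow_apply]
    have := hR.ne'
    field_simp
    ring
  have hanti : AntitoneOn (fun x => x * P x + lam * x ^ 2 / 2 + (m - x ^ 2 / 2) ^ 3 / (3 * R ^ 2))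
      (Icc R R') := by
    refine antitoneOn_of_deriv_nonpos (convex_Icc R R')
      (fun x _ => (hd x).continuousAt.continuousWithinAt)
      (fun x _ => (hd x).differentiableAt.differentiableWithinAt) fun x hx => ?_
    rw [interior_Icc] at hx
    rw [(hd x).deriv]
    have hx0 : 0 < x := hR.trans hx.1
    have h3 := mul_le_mul_of_nonneg_left (h2 x ⟨hx0, hx.2.le⟩) hx0.le
    have h4 : x * (P' x + P x / x + P x ^ 2) = P x + x * P' x + x * P x ^ 2 := by
      field_simp; ring
    have h5 : x * radial m x ^ 2 ≤ (m - x ^ 2 / 2) ^ 2 * x / R ^ 2 := by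
      rw [radial_eq_div m hx0, le_div_iff₀ (by positivity), div_pow]
      have : R ^ 2 ≤ x ^ 2 := pow_le_pow_left₀ hR.le hx.1.le 2
      calc x * ((m - x ^ 2 / 2) ^ 2 / x ^ 2) * R ^ 2
          ≤ x * ((m - x ^ 2 / 2) ^ 2 / x ^ 2) * x ^ 2 :=
            mul_le_mul_of_nonneg_left this (by positivity)
        _ = _ := by field_simp
    have h6 := mul_nonneg hx0.le (sq_nonneg (P x))
    rw [h4] at h3
    linarith
  have h3 := hanti ⟨le_rfl, hRR.le⟩ ⟨hRR.le, le_rfl⟩ hRR.le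
  simp only [h0, mul_zero, zero_add] at h3
  have e1 : m - R ^ 2 / 2 = a := by linarith
  have e2 : m - R' ^ 2 / 2 = -b := by linarith
  have e3 : R' ^ 2 = R ^ 2 + 2 * (a + b) := by linarith
  rw [e1, e2, e3] at h3
  have hs : 0 ≤ a + b := by nlinarith
  have h4 : (a ^ 3 + b ^ 3) / (3 * R ^ 2) ≤ lam * (a + b) := by
    rw [div_le_iff₀ (by positivity)]
    nlinarith [mul_le_mul_of_nonneg_left hab hs]
  have h5 : 0 ≤ R * P R := by
    rw [add_div] at h4
    have : (-b) ^ 3 / (3 * R ^ 2) = -(b ^ 3 / (3 * R ^ 2)) := by ring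
    rw [this] at h3
    linarith
  exact (mul_nonneg_iff_of_pos_left hR).1 h5

namespace Profile

variable (P : Profile)

theorem exists_hasSub : ∃ s₀ C : ℝ, 0 < s₀ ∧ s₀ ≤ 1 / 4 ∧ 0 ≤ C ∧ ∀ R ε m : ℝ, 0 < R →
    R⁻¹ + |ε| ≤ s₀ → m = R ^ 2 / 2 + (P.ξ + ε) * R → 0 < m ∧
    HasSub m R (P.lev R⁻¹ ε - C * (R⁻¹ + |ε|) ^ 3) := by
  obtain ⟨s₀, C, hs, hs1, hC, H⟩ := P.exists_super
  refine ⟨min s₀ (1 / 4), C, lt_min hs (by norm_num), min_le_right _ _, hC,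
    fun R ε m hR hε hm => ?_⟩
  have hh : 0 < R⁻¹ := inv_pos.2 hR
  obtain ⟨g, g', h0, hg, hle⟩ := H R⁻¹ ε hh (hε.trans (min_le_left _ _))
  have h4 := hε.trans (min_le_right _ _)
  have hR4 : 4 ≤ R := by
    have : R⁻¹ ≤ 4⁻¹ := by linarith [abs_nonneg ε]
    exact (inv_le_inv₀ hR (by norm_num)).1 this
  have hε4 := abs_le.1 (show |ε| ≤ 1 / 4 by linarith)
  have := P.ξ_gt
  refine ⟨by rw [hm]; nlinarith, fun x => -g (R - x), fun x => g' (R - x), by simp [h0],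
    fun x => ?_, fun x hx => ?_⟩
  · refine (((hg (R - x)).comp x ((hasDerivAt_id x).const_sub R)).neg).congr_deriv ?_
    ring
  · have hx0 := hx.1
    have e1 : 1 - R⁻¹ * (R - x) = x / R := by field_simp; ring
    have h5 := hle (R - x) (by linarith [hx.2]) (by
      have : 0 < x / R := by positivity
      linarith)
    have e2 : R⁻¹ / (1 - R⁻¹ * (R - x)) = 1 / x := by rw [e1]; field_simp
    have e3 : P.pot R⁻¹ ε (R - x) = radial m x ^ 2 := by
      unfold pot
      rw [e1, radial_eq_div m hx0, hm]
      congr 1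
      field_simp
      ring
    rw [e2, e3] at h5
    have e4 : -g (R - x) / x = -(1 / x * g (R - x)) := by ring
    have e5 : (-g (R - x)) ^ 2 = g (R - x) ^ 2 := by ring
    change g' (R - x) + -g (R - x) / x + (-g (R - x)) ^ 2 ≤ _
    rw [e4, e5]
    linarith

end Profile

end SC

namespace SC

theorem exists_outer_radius {R ζ ζ₀ m : ℝ} (hR : 3 ≤ R) (h1 : -1 < ζ₀) (h2 : ζ₀ < 0) (h3 : ζ₀ < ζ)
    (h4 : ζ < 1) (hm : m = R ^ 2 / 2 + ζ * R) :
    ∃ R', R < R' ∧ R' ≤ R + 3 ∧ m = R' ^ 2 / 2 + ζ₀ * R' := by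
  have hm0 : 0 < m := by rw [hm]; nlinarith
  have hS2 : √(ζ₀ ^ 2 + 2 * m) ^ 2 = ζ₀ ^ 2 + 2 * m := Real.sq_sqrt (by positivity)
  have hS0 := Real.sqrt_nonneg (ζ₀ ^ 2 + 2 * m)
  generalize √(ζ₀ ^ 2 + 2 * m) = S at hS2 hS0
  have hp : 0 < (ζ - ζ₀) * R := mul_pos (by linarith) (by linarith)
  refine ⟨S - ζ₀, ?_, ?_, by linarith⟩
  · by_contra! hh
    have : S ^ 2 ≤ (R + ζ₀) ^ 2 := pow_le_pow_left₀ hS0 (by linarith) 2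
    linarith
  · by_contra! hh
    have : (R + 3 + ζ₀) ^ 2 < S ^ 2 := pow_lt_pow_left₀ (by linarith) (by linarith) two_ne_zero
    nlinarith

theorem exists_inner_radius {R ζ z m K : ℝ} (hz : 0 < z) (hR : 0 < R) (hK : 0 < K)
    (hm : m = R ^ 2 / 2 + ζ * R) (hζ : ζ < -z) (hKm : K ^ 2 / 2 < m) :
    ∃ R', K ≤ R' ∧ R' ≤ R ∧ m = R' ^ 2 / 2 - z * R' := by
  have hm0 : 0 < m := lt_of_le_of_lt (by positivity) hKm
  have hS2 : √(z ^ 2 + 2 * m) ^ 2 = z ^ 2 + 2 * m := Real.sq_sqrt (by positivity)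
  have hS0 := Real.sqrt_nonneg (z ^ 2 + 2 * m)
  generalize √(z ^ 2 + 2 * m) = S at hS2 hS0
  have hp : 0 < (-z - ζ) * R := mul_pos (by linarith) hR
  refine ⟨S + z, ?_, ?_, by linarith⟩
  · by_contra! hh
    have : S ^ 2 ≤ K ^ 2 := pow_le_pow_left₀ hS0 (by linarith) 2
    have := sq_nonneg z
    linarith
  · by_contra! hh
    have hzR : z < R := by
      have : 0 < (R / 2 + ζ) * R := by linarith
      have := (mul_pos_iff_of_pos_right hR).1 this
      linarith
    have : (R - z) ^ 2 < S ^ 2 := pow_lt_pow_left₀ (by linarith) (by linarith) two_ne_zero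
    linarith

theorem sq_le_of_outer {R R' ζ₀ ξ c : ℝ} (hR : 3 ≤ R) (h1 : R ≤ R') (h2 : R' ≤ R + 3)
    (hz : ζ₀ < 0) (hξz : ξ ≤ ζ₀) (hξ1 : -1 < ξ) (hc : 100 ≤ c * R) :
    (-(ζ₀ * R')) ^ 2 ≤ (ξ ^ 2 + c) * R ^ 2 := by
  have hR3 : 0 < R' := by linarith
  have e1 : R' ^ 2 ≤ (R + 3) ^ 2 := pow_le_pow_left₀ (by linarith) h2 2
  have hR0 : 0 < R := by linarith
  have e0 : ζ₀ ^ 2 ≤ ξ ^ 2 := by nlinarith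
  have e2 : ζ₀ ^ 2 * R' ^ 2 ≤ ξ ^ 2 * (R + 3) ^ 2 := mul_le_mul e0 e1 (sq_nonneg _) (sq_nonneg _)
  have e4 : 100 * R ≤ c * R * R := mul_le_mul_of_nonneg_right hc hR0.le
  have e5 : ξ ^ 2 * (6 * R + 9) ≤ 1 * (6 * R + 9) :=
    mul_le_mul_of_nonneg_right (by nlinarith) (by linarith)
  linarith

namespace Profile

variable (P : Profile)

theorem avg_src₁_pos : 0 < P.avg P.src₁ := by
  rw [avg_src₁]
  have := mul_pos (pow_pos (P.v_pos 0) 2) (neg_pos.2 P.ξ_neg)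
  linarith

/-- Away from the optimal angular momentum, the corrected level exceeds `Θ₀` by a fixed amount. -/
theorem exists_gap {C ε₁ : ℝ} (hC : 0 ≤ C) (hε₁ : 0 < ε₁) : ∃ ε₀ c h₁ : ℝ, 0 < ε₀ ∧ ε₀ ≤ ε₁ ∧
    ε₀ < -P.ξ ∧ 0 < c ∧ P.ξ ^ 2 + c < 1 ∧ c ≤ ε₀ ^ 2 ∧ 0 < h₁ ∧ ∀ h ε : ℝ, 0 < h → h ≤ h₁ →
    |ε| = ε₀ → P.ξ ^ 2 + c ≤ P.lev h ε - C * (h + |ε|) ^ 3 := by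
  have hA := P.avg_src₁_pos
  set A := P.avg P.src₁ with hAdef
  have hξ := P.ξ_neg
  have hξ1 := P.xi_sq_lt_one
  obtain ⟨ε₀, h0, h1⟩ := exists_between (show (0 : ℝ) < min (min ε₁ (-P.ξ))
    (min (1 - P.ξ ^ 2) (A / (2 * (C + 1)))) from
    lt_min (lt_min hε₁ (by linarith)) (lt_min (by linarith) (by positivity)))
  simp only [lt_min_iff] at h1
  obtain ⟨⟨h1, h2⟩, h3, h4⟩ := h1
  rw [lt_div_iff₀ (by positivity)] at h4
  have hsq : 0 < ε₀ ^ 2 := by positivity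
  have h5 : ε₀ ^ 2 ≤ ε₀ := by nlinarith [sq_nonneg P.ξ]
  have hmin : 0 < min A 1 / 4 := by positivity
  have hmin1 : min A 1 / 4 ≤ 1 := by linarith [min_le_right A 1]
  have hminA : min A 1 / 4 ≤ A / 4 := by linarith [min_le_left A 1]
  have hlim : ∀ σ : ℝ, |σ| = ε₀ → ∀ᶠ h in 𝓝 (0 : ℝ),
      P.ξ ^ 2 + min A 1 / 4 * ε₀ ^ 2 < P.lev h σ - C * (h + ε₀) ^ 3 := fun σ hσ => by
    have hc : Continuous fun h => P.lev h σ - C * (h + ε₀) ^ 3 := by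
      unfold lev; fun_prop
    refine hc.continuousAt.eventually (lt_mem_nhds ?_)
    have e : σ ^ 2 = ε₀ ^ 2 := by rw [← hσ, sq_abs]
    have : P.lev 0 σ = P.ξ ^ 2 + ε₀ ^ 2 * A := by unfold lev; rw [e]; ring
    change _ < P.lev 0 σ - C * (0 + ε₀) ^ 3
    rw [this]
    have h6 := mul_le_mul_of_nonneg_right hminA hsq.le
    have h7 : C * (0 + ε₀) ^ 3 ≤ A / 2 * ε₀ ^ 2 := by
      have : C * ε₀ ≤ A / 2 := by nlinarith
      calc C * (0 + ε₀) ^ 3 = C * ε₀ * ε₀ ^ 2 := by ring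
        _ ≤ _ := mul_le_mul_of_nonneg_right this hsq.le
    have := mul_pos hA hsq
    linarith
  obtain ⟨h₁, hh, H⟩ := Metric.eventually_nhds_iff.1
    ((hlim ε₀ (abs_of_pos h0)).and (hlim (-ε₀) (by rw [abs_neg, abs_of_pos h0])))
  refine ⟨ε₀, min A 1 / 4 * ε₀ ^ 2, h₁ / 2, h0, h1.le, h2, by positivity, ?_, ?_, by positivity,
    fun h ε hp hle hε => ?_⟩
  · have := mul_le_mul_of_nonneg_right hmin1 hsq.le
    linarith
  · have := mul_le_mul_of_nonneg_right hmin1 hsq.le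
    linarith
  · have h6 := H (show dist h 0 < h₁ by rw [Real.dist_eq, sub_zero, abs_of_pos hp]; linarith)
    rw [hε]
    rcases (abs_eq h0.le).1 hε with h7 | h7
    · rw [h7]; exact h6.1.le
    · rw [h7]; exact h6.2.le

set_option maxHeartbeats 800000 in
theorem exists_radialBound : ∃ C : ℝ, 0 ≤ C ∧ ∀ ε₁ : ℝ, 0 < ε₁ → ∃ ε₀ c R₀ : ℝ, 0 < ε₀ ∧ ε₀ ≤ ε₁ ∧
    0 < c ∧ 1 ≤ R₀ ∧ ∀ R ε m : ℝ, R₀ ≤ R → m = R ^ 2 / 2 + (P.ξ + ε) * R →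
    (|ε| ≤ ε₀ → RadialBound m R (P.lev R⁻¹ ε - C * (R⁻¹ + |ε|) ^ 3)) ∧
    (ε₀ < |ε| → RadialBound m R (P.ξ ^ 2 + c)) := by
  obtain ⟨s₀, C, hs, hs1, hC, H⟩ := P.exists_hasSub
  refine ⟨C, hC, fun ε₁ hε₁ => ?_⟩
  obtain ⟨ε₀, c, h₁, h0, hle, hξε, hc, hc1, hcε, hh₁, hgap⟩ :=
    P.exists_gap hC (show 0 < min ε₁ (s₀ / 2) from lt_min hε₁ (by linarith))
  have hξ := P.ξ_neg
  have hξ1 := P.ξ_gt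
  have hlam0 : 0 < P.ξ ^ 2 + c := by positivity
  obtain ⟨R₁, hR₁, Hlow⟩ := radialBound_of_le (M₀ := (h₁⁻¹ + 2 / s₀) ^ 2 / 2) (by positivity)
    hlam0.le hc1
  have hε₀s : ε₀ ≤ s₀ / 2 := hle.trans (min_le_right _ _)
  -- the subsolution attached to the endpoints `ε = ±ε₀`
  have Hend : ∀ R m σ : ℝ, |σ| = ε₀ → h₁⁻¹ + 2 / s₀ ≤ R → m = R ^ 2 / 2 + (P.ξ + σ) * R →
      0 < m ∧ HasSub m R (P.ξ ^ 2 + c) := fun R m σ hσ hR hm => by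
    have hA : 0 < h₁⁻¹ := inv_pos.2 hh₁
    have hB : 0 < 2 / s₀ := by positivity
    have hR0 : 0 < R := by linarith
    have e1 : R⁻¹ ≤ h₁ := by
      rw [inv_le_comm₀ hR0 hh₁]; linarith
    have e2 : R⁻¹ ≤ s₀ / 2 := by
      rw [inv_le_comm₀ hR0 (by positivity), inv_div]; linarith
    have h2 := H R σ m hR0 (by rw [hσ]; linarith) hm
    exact ⟨h2.1, h2.2.mono (hgap R⁻¹ σ (inv_pos.2 hR0) e1 hσ)⟩
  have hA : 0 < h₁⁻¹ := inv_pos.2 hh₁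
  have hB : 0 < 2 / s₀ := by positivity
  refine ⟨ε₀, c, 3 + R₁ + (h₁⁻¹ + 2 / s₀) + 100 / c, h0, hle.trans (min_le_left _ _), hc, ?_,
    fun R ε m hR hm => ⟨fun hε => ?_, fun hε => ?_⟩⟩
  · have : 0 ≤ 100 / c := by positivity
    linarith
  · have hcc : 0 ≤ 100 / c := by positivity
    have hR0 : 0 < R := by linarith
    have e2 : R⁻¹ ≤ s₀ / 2 := by
      rw [inv_le_comm₀ hR0 (by positivity), inv_div]; linarith
    have := H R ε m hR0 (by linarith) hm
    exact this.2.radialBound this.1.ne' hR0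
  · have hcc : 0 ≤ 100 / c := by positivity
    have hR0 : 0 < R := by linarith
    have hR3 : 3 ≤ R := by linarith
    have hcR : 100 ≤ c * R := by
      have : 100 / c ≤ R := by linarith
      rw [div_le_iff₀ hc] at this; linarith
    rcases lt_abs.1 hε with hpos | hneg
    · obtain ⟨ζ, hζ⟩ : ∃ ζ, ζ = P.ξ + ε := ⟨_, rfl⟩
      rw [← hζ] at hm
      by_cases hcase : 0 ≤ ζ ∧ P.ξ ^ 2 + c ≤ ζ ^ 2
      · have hm0 : 0 ≤ m := by rw [hm]; have := mul_nonneg hcase.1 hR0.le; positivity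
        have hrad : ∀ x ∈ Ioc 0 R, P.ξ ^ 2 + c ≤ radial m x ^ 2 := fun x hx => by
          have h1 := radial_antitone hm0 hx.1 hx.2
          have h2 : radial m R = ζ := by unfold radial; rw [hm]; field_simp; ring
          rw [h2] at h1
          exact hcase.2.trans (pow_le_pow_left₀ hcase.1 h1 2)
        exact RadialBound.of_sub (C := 0) (P := fun _ => 0) (P' := fun _ => 0) hR0 le_rfl
          (fun _ => rfl) (fun x _ => hasDerivAt_const x 0)
          (fun x hx => by have := hrad x hx; norm_num; linarith) le_rfl (fun x _ => by simp)
      · have hζ1 : ζ < 1 ∧ (0 ≤ ζ → ζ ^ 2 < P.ξ ^ 2 + c) := by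
          refine ⟨?_, fun h => not_le.1 fun h2 => hcase ⟨h, h2⟩⟩
          by_contra! h
          exact hcase ⟨by linarith, by linarith [one_le_pow₀ (n := 2) h]⟩
        have hζlow : P.ξ + ε₀ < ζ := by linarith
        obtain ⟨ζ₀, hζ₀⟩ : ∃ ζ₀, ζ₀ = P.ξ + ε₀ := ⟨_, rfl⟩
        rw [← hζ₀] at hζlow
        have hz1 : -1 < ζ₀ := by linarith
        have hz2 : ζ₀ < 0 := by linarith
        have hm0 : 0 < m := by
          rw [hm]; have := mul_pos (show 0 < R / 2 + ζ by linarith) hR0; linarith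
        obtain ⟨R', hRR, hdiff, hmR'⟩ := exists_outer_radius hR3 hz1 hz2 hζlow hζ1.1 hm
        have hsub := Hend R' m ε₀ (abs_of_pos h0) (by linarith) (by rw [hmR', hζ₀])
        refine hsub.2.radialBound_of_le hm0.ne' hR0 hRR (a := ζ * R) (b := -(ζ₀ * R'))
          (by linarith) (by linarith) ?_
        have hb0 : 0 ≤ -(ζ₀ * R') := by linarith [mul_nonneg (neg_nonneg.2 hz2.le) (hR0.le.trans hRR.le)]
        have e1 := sq_le_of_outer hR3 hRR.le hdiff hz2 (by linarith) hξ1 hcR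
        rcases le_total 0 ζ with hz | hz
        · have e1' := mul_le_mul_of_nonneg_right (hζ1.2 hz).le (sq_nonneg R)
          have e2 : 0 ≤ ζ * R * (-(ζ₀ * R')) := mul_nonneg (mul_nonneg hz hR0.le) hb0
          have e3 : 0 ≤ (P.ξ ^ 2 + c) * R ^ 2 := by positivity
          linarith
        · have e2 : 0 ≤ -(ζ * R) := by linarith [mul_nonneg (neg_nonneg.2 hz) hR0.le]
          have e3 : -(ζ * R) ≤ -(ζ₀ * R') := by
            have h1 := mul_le_mul_of_nonneg_left hRR.le (neg_nonneg.2 hz2.le)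
            have h2 := mul_le_mul_of_nonneg_right hζlow.le hR0.le
            linarith
          have h4 := mul_le_mul e3 e3 e2 hb0
          have h5 := mul_le_mul_of_nonneg_right e3 hb0
          linarith
    · by_cases hm0 : m ≤ (h₁⁻¹ + 2 / s₀) ^ 2 / 2
      · exact Hlow R m (by linarith) hm0
      push Not at hm0
      obtain ⟨z, hz⟩ : ∃ z, z = -(P.ξ + -ε₀) := ⟨_, rfl⟩
      have hz0 : 0 < z := by linarith
      have hm00 : 0 < m := lt_of_le_of_lt (by positivity) hm0
      obtain ⟨R', hge, hRR, hmz⟩ := exists_inner_radius hz0 hR0 (show 0 < h₁⁻¹ + 2 / s₀ by linarith)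
        hm (show P.ξ + ε < -z by linarith) hm0
      have hR'0 : 0 < R' := by linarith
      have hmR' : m = R' ^ 2 / 2 + (P.ξ + -ε₀) * R' := by rw [hmz, hz]; ring
      have hsub := Hend R' m (-ε₀) (by rw [abs_neg, abs_of_pos h0]) hge hmR'
      refine (hsub.2.radialBound hsub.1.ne' hR'0).extend hRR fun x hx => ?_
      have h1 := radial_antitone hm00.le hR'0 hx.1
      have h2 : radial m R' = -z := by unfold radial; rw [hmR', hz]; field_simp; ring
      rw [h2] at h1
      have h3 : z ^ 2 ≤ radial m x ^ 2 := by
        rw [← neg_sq (radial m x)]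
        exact pow_le_pow_left₀ hz0.le (by linarith) 2
      have h4 : P.ξ ^ 2 + c ≤ z ^ 2 := by
        have := mul_pos h0 (neg_pos.2 hξ)
        rw [hz]; linarith
      exact h4.trans h3

end Profile

end SC

namespace SC

open Complex (I)
open scoped Real

theorem hasDerivAt_intervalIntegral_param {F F' : ℝ → ℝ → ℂ} {a b : ℝ}
    (hd : ∀ x t, HasDerivAt (fun x => F x t) (F' x t) x)
    (hc : ∀ x, Continuous (F x)) (hc' : Continuous fun z : ℝ × ℝ => F' z.1 z.2) (x₀ : ℝ) :
    HasDerivAt (fun x => ∫ t in a..b, F x t) (∫ t in a..b, F' x₀ t) x₀ := by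
  obtain ⟨C, hC⟩ := (isCompact_Icc.prod isCompact_uIcc).exists_bound_of_continuousOn
    (s := Icc (x₀ - 1) (x₀ + 1) ×ˢ uIcc a b) hc'.continuousOn
  refine (intervalIntegral.hasDerivAt_integral_of_dominated_loc_of_deriv_le
    (s := Icc (x₀ - 1) (x₀ + 1)) (bound := fun _ => C)
    (Icc_mem_nhds (by linarith) (by linarith))
    (.of_forall fun x => (hc x).aestronglyMeasurable) ((hc x₀).intervalIntegrable _ _)
    (Continuous.aestronglyMeasurable ?_) (.of_forall fun t ht x hx => ?_)
    intervalIntegrable_const (.of_forall fun t _ x _ => hd x t)).2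
  · exact hc'.comp (by fun_prop : Continuous fun t : ℝ => (x₀, t))
  · exact hC (x, t) ⟨hx, uIoc_subset_uIcc ht⟩

/-- The character `θ ↦ e^{-imθ}`. -/
def ch (m : ℤ) (θ : ℝ) : ℂ := Complex.exp (-((m : ℂ) * θ * I))

theorem continuous_ch (m : ℤ) : Continuous (ch m) := by unfold ch; fun_prop

theorem hasDerivAt_ch (m : ℤ) (θ : ℝ) : HasDerivAt (ch m) (-(m * I) * ch m θ) θ := by
  have h1 : HasDerivAt (fun θ : ℝ => -((m : ℂ) * θ * I)) (-(m * I)) θ := by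
    have h0 : HasDerivAt (fun θ : ℝ => (θ : ℂ)) 1 θ := (hasDerivAt_id θ).ofReal_comp
    have := ((h0.const_mul (m : ℂ)).mul_const I).fun_neg
    simpa using this
  refine h1.cexp.congr_deriv ?_
  unfold ch; ring

theorem ch_pi (m : ℤ) : ch m π = ch m (-π) := by
  unfold ch
  rw [Complex.exp_eq_exp_iff_exists_int]
  refine ⟨-m, ?_⟩
  push_cast; ring

/-- The `m`-th Fourier coefficient on `(-π, π)`. -/
def fc (m : ℤ) (g : ℝ → ℂ) : ℂ := (2 * π : ℝ)⁻¹ • ∫ θ in -π..π, ch m θ * g θ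

theorem fc_eq_fourierCoeffOn (m : ℤ) (g : ℝ → ℂ) :
    fc m g = fourierCoeffOn (show -π < π by linarith [Real.pi_pos]) g m := by
  rw [fourierCoeffOn_eq_integral, fc, show π - -π = 2 * π by ring, one_div]
  congr 1
  refine intervalIntegral.integral_congr fun θ _ => ?_
  simp only [smul_eq_mul]
  rw [fourier_coe_apply, ch]
  congr 2
  have : (π : ℂ) ≠ 0 := by exact_mod_cast Real.pi_ne_zero
  push_cast
  field_simp

theorem hasSum_fc {g : ℝ → ℂ} (hg : Continuous g) :
    HasSum (fun m : ℤ => ‖fc m g‖ ^ 2) ((2 * π)⁻¹ * ∫ θ in -π..π, ‖g θ‖ ^ 2) := by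
  have hab : -π < π := by linarith [Real.pi_pos]
  have hL : MemLp g 2 (volume.restrict (Ioc (-π) π)) := by
    obtain ⟨C, hC⟩ := isCompact_Icc.exists_bound_of_continuousOn (s := Icc (-π) π) hg.continuousOn
    refine MemLp.of_bound hg.aestronglyMeasurable C ?_
    filter_upwards [ae_restrict_mem measurableSet_Ioc] with x hx using hC x (Ioc_subset_Icc_self hx)
  have := hasSum_sq_fourierCoeffOn hab hL
  simp only [← fc_eq_fourierCoeffOn, smul_eq_mul, show π - -π = 2 * π by ring] at this
  exact this

theorem fc_deriv (m : ℤ) {g g' : ℝ → ℂ} (hg : ∀ θ, HasDerivAt g (g' θ) θ) (hg' : Continuous g')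
    (hper : g π = g (-π)) : fc m g' = m * I * fc m g := by
  have hgc : Continuous g := continuous_iff_continuousAt.2 fun x => (hg x).continuousAt
  have hc := continuous_ch m
  have h1 : ∫ θ in -π..π, (-(m * I) * ch m θ * g θ + ch m θ * g' θ) = 0 := by
    rw [intervalIntegral.integral_eq_sub_of_hasDerivAt (f := fun θ => ch m θ * g θ)
      (fun θ _ => (hasDerivAt_ch m θ).mul (hg θ)) (by
        apply Continuous.intervalIntegrable; fun_prop), ch_pi, hper, sub_self]
  rw [intervalIntegral.integral_add (by apply Continuous.intervalIntegrable; fun_prop)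
    (by apply Continuous.intervalIntegrable; fun_prop)] at h1
  have h2 : ∫ θ in -π..π, -(m * I) * ch m θ * g θ = -(m * I) * ∫ θ in -π..π, ch m θ * g θ := by
    rw [← intervalIntegral.integral_const_mul]
    congr 1; ext θ; ring
  rw [h2] at h1
  unfold fc
  rw [show ∫ θ in -π..π, ch m θ * g' θ = m * I * ∫ θ in -π..π, ch m θ * g θ by
    linear_combination h1]
  rw [mul_smul_comm]

theorem fc_lin (m : ℤ) {g k : ℝ → ℂ} (hg : Continuous g) (hk : Continuous k) (a b : ℂ) :
    fc m (fun θ => a * g θ + b * k θ) = a * fc m g + b * fc m k := by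
  have hc := continuous_ch m
  unfold fc
  have : ∀ θ, ch m θ * (a * g θ + b * k θ) = a * (ch m θ * g θ) + b * (ch m θ * k θ) :=
    fun θ => by ring
  simp only [this]
  rw [intervalIntegral.integral_add (by apply Continuous.intervalIntegrable; fun_prop)
    (by apply Continuous.intervalIntegrable; fun_prop), intervalIntegral.integral_const_mul,
    intervalIntegral.integral_const_mul, smul_add, mul_smul_comm, mul_smul_comm]

theorem hasDerivAt_fc (m : ℤ) {F F' : ℝ → ℝ → ℂ} (hd : ∀ x t, HasDerivAt (fun x => F x t) (F' x t) x)
    (hc : ∀ x, Continuous (F x)) (hc' : Continuous fun z : ℝ × ℝ => F' z.1 z.2) (x : ℝ) :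
    HasDerivAt (fun x => fc m (F x)) (fc m (F' x)) x := by
  have hch := continuous_ch m
  have := hasDerivAt_intervalIntegral_param (F := fun x t => ch m t * F x t)
    (F' := fun x t => ch m t * F' x t) (a := -π) (b := π) (fun x t => (hd x t).const_mul _)
    (fun x => hch.mul (hc x)) (by fun_prop) x
  exact this.const_smul (2 * π : ℝ)⁻¹

theorem continuous_fc (m : ℤ) {F : ℝ → ℝ → ℂ} (hc : Continuous fun z : ℝ × ℝ => F z.1 z.2) :
    Continuous fun x => fc m (F x) := by
  have hch := continuous_ch m
  have h : Continuous fun z : ℝ × ℝ => ch m z.2 * F z.1 z.2 := by fun_prop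
  have := intervalIntegral.continuous_parametric_intervalIntegral_of_continuous'
    (f := fun x t => ch m t * F x t) (μ := volume) h (-π) π
  exact this.const_smul (2 * π : ℝ)⁻¹

theorem fc_const_eq_zero {m : ℤ} (hm : m ≠ 0) (c : ℂ) : fc m (fun _ => c) = 0 := by
  have h := fc_deriv m (g := fun _ => c) (g' := fun _ => 0) (fun θ => hasDerivAt_const θ c)
    continuous_const rfl
  have h0 : fc m (fun _ => 0) = 0 := by simp [fc]
  rw [h0] at h
  have hm' : (m : ℂ) * I ≠ 0 := mul_ne_zero (by exact_mod_cast hm) Complex.I_ne_zero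
  exact (mul_eq_zero.1 h.symm).resolve_left hm'

/-- Integration over the unit disc in polar coordinates. -/
theorem integral_unitDisc {F : Plane → ℝ} (hF : Continuous F) :
    ∫ x in unitDisc, F x =
      ∫ r in (0 : ℝ)..1, r * ∫ θ in -π..π, F (r * Real.cos θ, r * Real.sin θ) := by
  have hm : MeasurableSet unitDisc :=
    (isOpen_lt (f := fun x : Plane => x.1 ^ 2 + x.2 ^ 2) (by fun_prop) continuous_const).measurableSet
  have hcont : Continuous fun p : ℝ × ℝ => p.1 * F (p.1 * Real.cos p.2, p.1 * Real.sin p.2) := by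
    fun_prop
  rw [← integral_indicator hm, ← integral_comp_polarCoord_symm]
  have h1 : ∀ p ∈ polarCoord.target, p.1 • unitDisc.indicator F (polarCoord.symm p) =
      (Ioo (0 : ℝ) 1 ×ˢ Ioo (-π) π).indicator
        (fun p => p.1 * F (p.1 * Real.cos p.2, p.1 * Real.sin p.2)) p := fun p hp => by
    have hp1 : 0 < p.1 := hp.1
    have hmem : polarCoord.symm p ∈ unitDisc ↔ p ∈ Ioo (0 : ℝ) 1 ×ˢ Ioo (-π) π := by
      have e : (p.1 * Real.cos p.2) ^ 2 + (p.1 * Real.sin p.2) ^ 2 = p.1 ^ 2 := by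
        linear_combination p.1 ^ 2 * Real.sin_sq_add_cos_sq p.2
      change (p.1 * Real.cos p.2) ^ 2 + (p.1 * Real.sin p.2) ^ 2 < 1 ↔ _
      rw [e]
      refine ⟨fun h => ⟨⟨hp1, ?_⟩, hp.2⟩, fun h => ?_⟩
      · nlinarith
      · have := h.1.2; nlinarith
    by_cases h : polarCoord.symm p ∈ unitDisc
    · rw [indicator_of_mem h, indicator_of_mem (hmem.1 h)]
      rfl
    · rw [indicator_of_notMem h, indicator_of_notMem (fun h' => h (hmem.2 h')), smul_zero]
  rw [setIntegral_congr_fun polarCoord.open_target.measurableSet h1]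
  have hms : MeasurableSet (Ioo (0 : ℝ) 1 ×ˢ Ioo (-π) π) := measurableSet_Ioo.prod measurableSet_Ioo
  rw [setIntegral_indicator hms]
  have hsub : polarCoord.target ∩ Ioo (0 : ℝ) 1 ×ˢ Ioo (-π) π = Ioo (0 : ℝ) 1 ×ˢ Ioo (-π) π :=
    inter_eq_right.2 fun p hp => ⟨hp.1.1, hp.2⟩
  rw [hsub, Measure.volume_eq_prod, setIntegral_prod _ ?_]
  · rw [intervalIntegral.integral_of_le zero_le_one, integral_Ioc_eq_integral_Ioo]
    refine setIntegral_congr_fun measurableSet_Ioo fun r _ => ?_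
    simp only
    rw [integral_const_mul, intervalIntegral.integral_of_le (by linarith [Real.pi_pos]),
      integral_Ioc_eq_integral_Ioo]
  · exact (hcont.continuousOn.integrableOn_compact (isCompact_Icc.prod isCompact_Icc)).mono_set
      (prod_mono Ioo_subset_Icc_self Ioo_subset_Icc_self)

end SC

namespace SC

open Complex (I)
open scoped Real Manifold

theorem exists_global {u : Plane → ℂ} (h : CNearCl 1 unitDisc u) : ∃ w : Plane → ℂ,
    ContDiff ℝ 1 w ∧ ∀ x ∈ unitDisc, w x = u x ∧ fderiv ℝ w x = fderiv ℝ u x := by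
  obtain ⟨U, hU, hsub, hu⟩ := h
  have hbdd : Bornology.IsBounded unitDisc := by
    refine (Metric.isBounded_ball (x := (0 : Plane)) (r := 2)).subset fun x hx => ?_
    have hx' : x.1 ^ 2 + x.2 ^ 2 < 1 := hx
    rw [mem_ball_zero_iff, Prod.norm_def, max_lt_iff, Real.norm_eq_abs, Real.norm_eq_abs]
    exact ⟨abs_lt_of_sq_lt_sq (by nlinarith [sq_nonneg x.2]) (by norm_num),
      abs_lt_of_sq_lt_sq (by nlinarith [sq_nonneg x.1]) (by norm_num)⟩
  have hopen : IsOpen unitDisc :=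
    isOpen_lt (f := fun x : Plane => x.1 ^ 2 + x.2 ^ 2) (by fun_prop) continuous_const
  have hK : IsCompact (closure unitDisc) := hbdd.isCompact_closure
  obtain ⟨K', hK', h1, h2⟩ := exists_compact_between hK hU hsub
  obtain ⟨φ, hφ0, hφ1, -⟩ := exists_contMDiffMap_zero_one_of_isClosed (n := 1) 𝓘(ℝ, Plane)
    (s := (interior K')ᶜ) (t := closure unitDisc) isOpen_interior.isClosed_compl isClosed_closure
    (disjoint_compl_left_iff_subset.2 h1)
  have hφ : ContDiff ℝ 1 φ := φ.contMDiff.contDiff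
  refine ⟨fun x => φ x • u x, contDiff_iff_contDiffAt.2 fun x => ?_, fun x hx => ?_⟩
  · by_cases hx : x ∈ U
    · exact hφ.contDiffAt.smul (hu.contDiffAt (hU.mem_nhds hx))
    · have : (fun x => φ x • u x) =ᶠ[𝓝 x] fun _ => 0 := by
        filter_upwards [hK'.isClosed.isOpen_compl.mem_nhds fun h => hx (h2 h)] with y hy
        rw [hφ0 fun h => hy (interior_subset h)]
        simp
      exact contDiffAt_const.congr_of_eventuallyEq this
  · have hev : (fun x => φ x • u x) =ᶠ[𝓝 x] u := by
      filter_upwards [hopen.mem_nhds hx] with y hy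
      rw [hφ1 (subset_closure hy)]
      simp
    exact ⟨hev.eq_of_nhds, hev.fderiv_eq⟩

/-- A function on the plane in polar coordinates, with its radial and angular derivatives. -/
def pol (u : Plane → ℂ) (r θ : ℝ) : ℂ := u (r * Real.cos θ, r * Real.sin θ)

def polR (u : Plane → ℂ) (r θ : ℝ) : ℂ :=
  fderiv ℝ u (r * Real.cos θ, r * Real.sin θ) (Real.cos θ, Real.sin θ)

def polT (u : Plane → ℂ) (r θ : ℝ) : ℂ :=
  fderiv ℝ u (r * Real.cos θ, r * Real.sin θ) (-(r * Real.sin θ), r * Real.cos θ)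

theorem magSq_polar (B : ℝ) (u : Plane → ℂ) (r θ : ℝ) :
    r ^ 2 * magSq B F0 u (r * Real.cos θ, r * Real.sin θ) = r ^ 2 * ‖polR u r θ‖ ^ 2 +
      ‖-I * polT u r θ + (-(B * r ^ 2 / 2) : ℝ) * pol u r θ‖ ^ 2 := by
  set x : Plane := (r * Real.cos θ, r * Real.sin θ) with hx
  have e1 : polR u r θ = Real.cos θ * fderiv ℝ u x (1, 0) + Real.sin θ * fderiv ℝ u x (0, 1) := by
    have : ((Real.cos θ, Real.sin θ) : Plane) =
        Real.cos θ • ((1 : ℝ), (0 : ℝ)) + Real.sin θ • ((0 : ℝ), (1 : ℝ)) := by simp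
    rw [polR, this, map_add, map_smul, map_smul, Complex.real_smul, Complex.real_smul]
  have e2 : polT u r θ =
      -(r * Real.sin θ : ℝ) * fderiv ℝ u x (1, 0) + (r * Real.cos θ : ℝ) * fderiv ℝ u x (0, 1) := by
    have : ((-(r * Real.sin θ), r * Real.cos θ) : Plane) =
        (-(r * Real.sin θ)) • ((1 : ℝ), (0 : ℝ)) + (r * Real.cos θ) • ((0 : ℝ), (1 : ℝ)) := by simp
    rw [polT, this, map_add, map_smul, map_smul, Complex.real_smul, Complex.real_smul,
      Complex.ofReal_neg]
  rw [e1, e2, magSq, pol, ← hx]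
  simp only [F0]
  have hc := Real.sin_sq_add_cos_sq θ
  generalize fderiv ℝ u x (1, 0) = p
  generalize fderiv ℝ u x (0, 1) = q
  rw [show x.1 = r * Real.cos θ from rfl, show x.2 = r * Real.sin θ from rfl]
  generalize u x = w
  generalize Real.cos θ = c at *
  generalize Real.sin θ = s at *
  simp only [← Complex.normSq_eq_norm_sq, Complex.normSq_apply]
  simp [-Complex.ofReal_pow]
  have hs : s ^ 2 = 1 - c ^ 2 := by linarith
  ring_nf
  simp only [hs]
  ring

variable {u : Plane → ℂ}

theorem continuous_pol (hu : ContDiff ℝ 1 u) : Continuous fun z : ℝ × ℝ => pol u z.1 z.2 := by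
  have := hu.continuous
  unfold pol
  fun_prop

theorem continuous_polR (hu : ContDiff ℝ 1 u) : Continuous fun z : ℝ × ℝ => polR u z.1 z.2 := by
  have := hu.continuous_fderiv one_ne_zero
  unfold polR
  fun_prop

theorem continuous_polT (hu : ContDiff ℝ 1 u) : Continuous fun z : ℝ × ℝ => polT u z.1 z.2 := by
  have := hu.continuous_fderiv one_ne_zero
  unfold polT
  fun_prop

theorem continuous_magSq (B : ℝ) (hu : ContDiff ℝ 1 u) : Continuous (magSq B F0 u) := by
  have := hu.continuous_fderiv one_ne_zero
  have := hu.continuous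
  unfold magSq F0
  fun_prop

theorem hasDerivAt_pol_r (hu : ContDiff ℝ 1 u) (r θ : ℝ) :
    HasDerivAt (fun r => pol u r θ) (polR u r θ) r := by
  have h1 : HasDerivAt (fun r : ℝ => (r * Real.cos θ, r * Real.sin θ)) (Real.cos θ, Real.sin θ) r := by
    have a := (hasDerivAt_id r).mul_const (Real.cos θ)
    have b := (hasDerivAt_id r).mul_const (Real.sin θ)
    rw [one_mul] at a b
    exact a.prodMk b
  exact ((hu.differentiable one_ne_zero _).hasFDerivAt).comp_hasDerivAt r h1

theorem hasDerivAt_pol_t (hu : ContDiff ℝ 1 u) (r θ : ℝ) :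
    HasDerivAt (fun θ => pol u r θ) (polT u r θ) θ := by
  have h1 : HasDerivAt (fun θ : ℝ => (r * Real.cos θ, r * Real.sin θ))
      (-(r * Real.sin θ), r * Real.cos θ) θ := by
    have a := (Real.hasDerivAt_cos θ).const_mul r
    have b := (Real.hasDerivAt_sin θ).const_mul r
    rw [mul_neg] at a
    exact a.prodMk b
  exact ((hu.differentiable one_ne_zero _).hasFDerivAt).comp_hasDerivAt θ h1

/-- Bessel's inequality for the magnetic energy on a circle. -/
theorem sum_le_integral_magSq (B : ℝ) (hu : ContDiff ℝ 1 u) {r : ℝ} (hr : 0 < r) (s : Finset ℤ) :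
    ∑ m ∈ s, (‖fc m (polR u r)‖ ^ 2 + (m / r - B * r / 2) ^ 2 * ‖fc m (pol u r)‖ ^ 2) * r ≤
      (2 * π)⁻¹ * (r * ∫ θ in -π..π, magSq B F0 u (r * Real.cos θ, r * Real.sin θ)) := by
  have hin : Continuous fun θ : ℝ => (r, θ) := by fun_prop
  have c1 : Continuous (pol u r) := (continuous_pol hu).comp hin
  have c2 : Continuous (polR u r) := (continuous_polR hu).comp hin
  have c3 : Continuous (polT u r) := (continuous_polT hu).comp hin
  have h1 := sum_le_hasSum s (fun _ _ => sq_nonneg _) (hasSum_fc c2)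
  have h2 := sum_le_hasSum s (fun _ _ => sq_nonneg _)
    (hasSum_fc (g := fun θ => -I * polT u r θ + (-(B * r ^ 2 / 2) : ℝ) * pol u r θ) (by fun_prop))
  have hper : pol u r π = pol u r (-π) := by simp [pol]
  have h3 : ∀ m : ℤ, ‖fc m (fun θ => -I * polT u r θ + (-(B * r ^ 2 / 2) : ℝ) * pol u r θ)‖ ^ 2 =
      (m - B * r ^ 2 / 2) ^ 2 * ‖fc m (pol u r)‖ ^ 2 := fun m => by
    rw [fc_lin m c3 c1, fc_deriv m (hasDerivAt_pol_t hu r) c3 hper]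
    have : -I * (m * I * fc m (pol u r)) + (-(B * r ^ 2 / 2) : ℝ) * fc m (pol u r) =
        ((m - B * r ^ 2 / 2 : ℝ) : ℂ) * fc m (pol u r) := by
      push_cast
      linear_combination (-(m : ℂ) * fc m (pol u r)) * Complex.I_mul_I
    rw [this, norm_mul, mul_pow, Complex.norm_real, Real.norm_eq_abs, sq_abs]
  simp only [h3] at h2
  have h4 : r ^ 2 * ∫ θ in -π..π, magSq B F0 u (r * Real.cos θ, r * Real.sin θ) =
      r ^ 2 * (∫ θ in -π..π, ‖polR u r θ‖ ^ 2) +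
      ∫ θ in -π..π, ‖-I * polT u r θ + (-(B * r ^ 2 / 2) : ℝ) * pol u r θ‖ ^ 2 := by
    rw [← intervalIntegral.integral_const_mul, ← intervalIntegral.integral_const_mul,
      ← intervalIntegral.integral_add (by apply Continuous.intervalIntegrable; fun_prop)
        (by apply Continuous.intervalIntegrable; fun_prop)]
    exact intervalIntegral.integral_congr fun θ _ => magSq_polar B u r θ
  refine le_of_mul_le_mul_left ?_ hr
  calc r * ∑ m ∈ s, (‖fc m (polR u r)‖ ^ 2 + (m / r - B * r / 2) ^ 2 * ‖fc m (pol u r)‖ ^ 2) * r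
      = r ^ 2 * ∑ m ∈ s, ‖fc m (polR u r)‖ ^ 2 +
        ∑ m ∈ s, (m - B * r ^ 2 / 2) ^ 2 * ‖fc m (pol u r)‖ ^ 2 := by
        rw [Finset.mul_sum, Finset.mul_sum, ← Finset.sum_add_distrib]
        refine Finset.sum_congr rfl fun m _ => ?_
        field_simp
    _ ≤ r ^ 2 * ((2 * π)⁻¹ * ∫ θ in -π..π, ‖polR u r θ‖ ^ 2) + _ :=
        add_le_add (mul_le_mul_of_nonneg_left h1 (sq_nonneg r)) h2
    _ = (2 * π)⁻¹ * (r ^ 2 * ∫ θ in -π..π, magSq B F0 u (r * Real.cos θ, r * Real.sin θ)) := by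
        rw [h4]; ring
    _ = _ := by ring

end SC

namespace SC

open Complex (I)
open scoped Real

theorem RadialBound.rescale {m R lam : ℝ} (hR : 0 < R) (h : RadialBound m R lam) :
    ∃ C η₀ : ℝ, 0 ≤ C ∧ 0 < η₀ ∧ η₀ ≤ 1 ∧ (m = 0 → C = 0) ∧ ∀ g g' : ℝ → ℝ,
      (∀ r, HasDerivAt g (g' r) r) → Continuous g' → ∀ η, 0 < η → η < η₀ →
      R ^ 2 * lam * (∫ r in η..1, g r ^ 2 * r) ≤
        (∫ r in η..1, (g' r ^ 2 + (m / r - R ^ 2 * r / 2) ^ 2 * g r ^ 2) * r) + C * g η ^ 2 := by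
  obtain ⟨C, η₀, hC, h0, h1, hC0, H⟩ := h
  refine ⟨C, η₀ / R, hC, by positivity, (div_le_one hR).2 h1, hC0, fun g g' hg hg' η hη hη' => ?_⟩
  have key := H (fun x => g (R⁻¹ * x)) (fun x => R⁻¹ * g' (R⁻¹ * x)) (fun x => by
      have := (hg (R⁻¹ * x)).comp x ((hasDerivAt_id x).const_mul R⁻¹)
      exact this.congr_deriv (by ring)) (by fun_prop) (R * η) (by positivity)
      (by rw [mul_comm]; exact (lt_div_iff₀ hR).1 hη')
  have hsub : ∀ F : ℝ → ℝ, ∫ x in R * η..R, F x = ∫ r in η..1, R * F (R * r) := fun F => by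
    rw [intervalIntegral.integral_const_mul, intervalIntegral.integral_comp_mul_left F hR.ne',
      mul_one, smul_eq_mul, mul_inv_cancel_left₀ hR.ne']
  have hc : ∀ r, R⁻¹ * (R * r) = r := fun r => inv_mul_cancel_left₀ hR.ne' r
  rw [hsub, hsub] at key
  simp only [hc] at key
  have e1 : ∫ r in η..1, R * (g r ^ 2 * (R * r)) = R ^ 2 * ∫ r in η..1, g r ^ 2 * r := by
    rw [← intervalIntegral.integral_const_mul]
    exact intervalIntegral.integral_congr fun r _ => by ring
  have hη1 : η ≤ 1 := hη'.le.trans ((div_le_one hR).2 h1)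
  have e2 : ∫ r in η..1, R * (((R⁻¹ * g' r) ^ 2 + radial m (R * r) ^ 2 * g r ^ 2) * (R * r)) =
      ∫ r in η..1, (g' r ^ 2 + (m / r - R ^ 2 * r / 2) ^ 2 * g r ^ 2) * r := by
    refine intervalIntegral.integral_congr fun r hr => ?_
    rw [uIcc_of_le hη1] at hr
    have : 0 < r := hη.trans_le hr.1
    simp only [radial]
    field_simp
  rw [e1, e2] at key
  linarith

theorem RadialBound.complex {m R lam : ℝ} (hR : 0 < R) (h : RadialBound m R lam) :
    ∃ C η₀ : ℝ, 0 ≤ C ∧ 0 < η₀ ∧ η₀ ≤ 1 ∧ (m = 0 → C = 0) ∧ ∀ c c' : ℝ → ℂ,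
      (∀ r, HasDerivAt c (c' r) r) → Continuous c' → ∀ η, 0 < η → η < η₀ →
      R ^ 2 * lam * (∫ r in η..1, ‖c r‖ ^ 2 * r) ≤
        (∫ r in η..1, (‖c' r‖ ^ 2 + (m / r - R ^ 2 * r / 2) ^ 2 * ‖c r‖ ^ 2) * r) +
          C * ‖c η‖ ^ 2 := by
  obtain ⟨C, η₀, hC, h0, h1, hC0, H⟩ := h.rescale hR
  refine ⟨C, η₀, hC, h0, h1, hC0, fun c c' hc hc' η hη hη' => ?_⟩
  have hcc : Continuous c := continuous_iff_continuousAt.2 fun x => (hc x).continuousAt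
  have a := H (fun r => (c r).re) (fun r => (c' r).re)
    (fun r => Complex.reCLM.hasFDerivAt.comp_hasDerivAt r (hc r)) (by fun_prop) η hη hη'
  have b := H (fun r => (c r).im) (fun r => (c' r).im)
    (fun r => Complex.imCLM.hasFDerivAt.comp_hasDerivAt r (hc r)) (by fun_prop) η hη hη'
  have hn : ∀ z : ℂ, ‖z‖ ^ 2 = z.re ^ 2 + z.im ^ 2 := fun z => by
    rw [← Complex.normSq_eq_norm_sq, Complex.normSq_apply]; ring
  have hη1 : η ≤ 1 := hη'.le.trans h1
  have hcont : ∀ f f' : ℝ → ℝ, Continuous f → Continuous f' → IntervalIntegrable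
      (fun r => (f' r ^ 2 + (m / r - R ^ 2 * r / 2) ^ 2 * f r ^ 2) * r) volume η 1 :=
    fun f f' hf hf' => ContinuousOn.intervalIntegrable (by
      rw [uIcc_of_le hη1]
      have : ContinuousOn (fun r : ℝ => m / r) (Icc η 1) :=
        continuousOn_const.div continuousOn_id fun r hr => (hη.trans_le hr.1).ne'
      fun_prop)
  have s1 : ∫ r in η..1, ‖c r‖ ^ 2 * r =
      (∫ r in η..1, (c r).re ^ 2 * r) + ∫ r in η..1, (c r).im ^ 2 * r := by
    rw [← intervalIntegral.integral_add (by apply Continuous.intervalIntegrable; fun_prop)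
      (by apply Continuous.intervalIntegrable; fun_prop)]
    exact intervalIntegral.integral_congr fun r _ => by simp only [hn]; ring
  have s2 : ∫ r in η..1, (‖c' r‖ ^ 2 + (m / r - R ^ 2 * r / 2) ^ 2 * ‖c r‖ ^ 2) * r =
      (∫ r in η..1, ((c' r).re ^ 2 + (m / r - R ^ 2 * r / 2) ^ 2 * (c r).re ^ 2) * r) +
      ∫ r in η..1, ((c' r).im ^ 2 + (m / r - R ^ 2 * r / 2) ^ 2 * (c r).im ^ 2) * r := by
    rw [← intervalIntegral.integral_add (hcont _ _ (by fun_prop) (by fun_prop))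
      (hcont _ _ (by fun_prop) (by fun_prop))]
    exact intervalIntegral.integral_congr fun r _ => by simp only [hn]; ring
  rw [s1, s2, hn]
  linarith

/-- Bounds on all radial forms give a bound on the magnetic form of the disc. -/
theorem le_integral_magSq {R lam : ℝ} (hR : 0 < R) (h : ∀ m : ℤ, RadialBound m R lam)
    {u : Plane → ℂ} (hu : CNearCl 1 unitDisc u) :
    R ^ 2 * lam * ∫ x in unitDisc, ‖u x‖ ^ 2 ≤ ∫ x in unitDisc, magSq (R ^ 2) F0 u x := by
  obtain ⟨w, hw, hwu⟩ := exists_global hu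
  have hm : MeasurableSet unitDisc :=
    (isOpen_lt (f := fun x : Plane => x.1 ^ 2 + x.2 ^ 2) (by fun_prop) continuous_const).measurableSet
  have e1 : ∫ x in unitDisc, ‖u x‖ ^ 2 = ∫ x in unitDisc, ‖w x‖ ^ 2 :=
    setIntegral_congr_fun hm fun x hx => by simp only [(hwu x hx).1]
  have e2 : ∫ x in unitDisc, magSq (R ^ 2) F0 u x = ∫ x in unitDisc, magSq (R ^ 2) F0 w x :=
    setIntegral_congr_fun hm fun x hx => by simp only [magSq, (hwu x hx).1, (hwu x hx).2]
  rw [e1, e2, integral_unitDisc (F := fun x => ‖w x‖ ^ 2) (by have := hw.continuous; fun_prop),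
    integral_unitDisc (continuous_magSq _ hw)]
  have hin : ∀ r : ℝ, Continuous fun θ : ℝ => (r, θ) := fun r => by fun_prop
  have cp := continuous_pol hw
  have cR := continuous_polR hw
  have cp' : ∀ r, Continuous (pol w r) := fun r => cp.comp (hin r)
  have cE : Continuous fun r => r * ∫ θ in -π..π, magSq (R ^ 2) F0 w (r * Real.cos θ, r * Real.sin θ) :=
    continuous_id.mul (intervalIntegral.continuous_parametric_intervalIntegral_of_continuous'
      (by have := continuous_magSq (R ^ 2) hw; fun_prop) _ _)
  have cN : Continuous fun r => r * ∫ θ in -π..π, ‖pol w r θ‖ ^ 2 :=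
    continuous_id.mul (intervalIntegral.continuous_parametric_intervalIntegral_of_continuous'
      (by fun_prop) _ _)
  have hd : ∀ m r, HasDerivAt (fun r => fc m (pol w r)) (fc m (polR w r)) r := fun m r =>
    hasDerivAt_fc m (fun x t => hasDerivAt_pol_r hw x t) cp' cR r
  have cf : ∀ m, Continuous fun r => fc m (pol w r) := fun m => continuous_fc m cp
  have cf' : ∀ m, Continuous fun r => fc m (polR w r) := fun m => continuous_fc m cR
  have fin : ∀ s : Finset ℤ, ∑ m ∈ s, R ^ 2 * lam * ∫ r in (0 : ℝ)..1, ‖fc m (pol w r)‖ ^ 2 * r ≤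
      ∫ r in (0 : ℝ)..1, (2 * π)⁻¹ *
        (r * ∫ θ in -π..π, magSq (R ^ 2) F0 w (r * Real.cos θ, r * Real.sin θ)) := by
    intro s
    choose C η₀ hC h0 h1 hC0 H using fun m : ℤ => (h m).complex hR
    have hprim : ∀ f : ℝ → ℝ, Continuous f → Tendsto (fun η => ∫ r in η..1, f r) (𝓝[>] 0)
        (𝓝 (∫ r in (0 : ℝ)..1, f r)) := fun f hf => by
      have : Continuous fun η => ∫ r in η..1, f r := by
        simp_rw [fun η => intervalIntegral.integral_symm (μ := volume) (f := f) 1 η]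
        exact (intervalIntegral.continuous_primitive (fun a b => hf.intervalIntegrable a b) 1).neg
      exact (this.tendsto 0).mono_left nhdsWithin_le_nhds
    have hz : ∀ m : ℤ, C m * ‖fc m (pol w 0)‖ ^ 2 = 0 := fun m => by
      by_cases hm0 : m = 0
      · rw [hC0 m (by exact_mod_cast hm0), zero_mul]
      · have : pol w 0 = fun _ => w (0, 0) := by ext θ; simp [pol]
        rw [this, fc_const_eq_zero hm0]; simp
    have L := tendsto_finsetSum s fun m _ =>
      (hprim (fun r => ‖fc m (pol w r)‖ ^ 2 * r) (by have := cf m; fun_prop)).const_mul (R ^ 2 * lam)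
    have Rr := (hprim _ (cE.const_mul (2 * π)⁻¹)).add (tendsto_finsetSum s fun m _ =>
      ((((cf m).norm.pow 2).const_mul (C m)).tendsto 0).mono_left
        (nhdsWithin_le_nhds (s := Ioi 0)))
    simp only [Pi.pow_apply, hz, Finset.sum_const_zero, add_zero] at Rr
    refine le_of_tendsto_of_tendsto L Rr ?_
    have ev : ∀ᶠ η in 𝓝[>] (0 : ℝ), ∀ m ∈ s, η < η₀ m :=
      (eventually_all_finset s).2 fun m _ =>
        nhdsWithin_le_nhds (eventually_lt_nhds (h0 m))
    have ev1 : ∀ᶠ η in 𝓝[>] (0 : ℝ), η < 1 := nhdsWithin_le_nhds (eventually_lt_nhds one_pos)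
    filter_upwards [ev, ev1, self_mem_nhdsWithin] with η hη hη1 hη0
    have hη0 : 0 < η := hη0
    have st := Finset.sum_le_sum fun m hm =>
      H m (fun r => fc m (pol w r)) (fun r => fc m (polR w r)) (hd m) (cf' m) η hη0 (hη m hm)
    rw [Finset.sum_add_distrib] at st
    refine st.trans (add_le_add_left ?_ _)
    have hII : ∀ m : ℤ, IntervalIntegrable (fun r => (‖fc m (polR w r)‖ ^ 2 +
        (m / r - R ^ 2 * r / 2) ^ 2 * ‖fc m (pol w r)‖ ^ 2) * r) volume η 1 := fun m =>
      ContinuousOn.intervalIntegrable (by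
        rw [uIcc_of_le hη1.le]
        have : ContinuousOn (fun r : ℝ => m / r) (Icc η 1) :=
          continuousOn_const.div continuousOn_id fun r hr => (hη0.trans_le hr.1).ne'
        have a := (cf m).continuousOn (s := Icc η 1)
        have b := (cf' m).continuousOn (s := Icc η 1)
        exact ((b.norm.pow 2).add (((this.sub (by fun_prop)).pow 2).mul (a.norm.pow 2))).mul
          continuousOn_id)
    rw [← intervalIntegral.integral_finsetSum fun m _ => hII m]
    refine intervalIntegral.integral_mono_on hη1.le
      (by simpa only [Finset.sum_fn] using IntervalIntegrable.sum s fun m _ => hII m)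
      ((cE.const_mul _).intervalIntegrable _ _) fun r hr => ?_
    exact sum_le_integral_magSq (R ^ 2) hw (hη0.trans_le hr.1) s
  have hsum : ∀ r, HasSum (fun m : ℤ => ‖fc m (pol w r)‖ ^ 2 * r)
      ((2 * π)⁻¹ * (r * ∫ θ in -π..π, ‖pol w r θ‖ ^ 2)) := fun r => by
    have := (hasSum_fc (cp' r)).mul_right r
    rwa [show ∀ a b c : ℝ, a * b * c = a * (c * b) from fun _ _ _ => by ring] at this
  have lim := intervalIntegral.hasSum_integral_of_dominated_convergence (μ := volume)
    (a := (0 : ℝ)) (b := 1)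
    (F := fun (m : ℤ) r => ‖fc m (pol w r)‖ ^ 2 * r) (fun m r => ‖fc m (pol w r)‖ ^ 2 * r)
    (fun m => Continuous.aestronglyMeasurable (by have := cf m; fun_prop))
    (fun m => .of_forall fun r hr => by
      rw [uIoc_of_le zero_le_one] at hr
      rw [Real.norm_of_nonneg (mul_nonneg (sq_nonneg _) hr.1.le)])
    (.of_forall fun r _ => (hsum r).summable)
    (by simp_rw [fun r => (hsum r).tsum_eq]; exact (cN.const_mul _).intervalIntegrable _ _)
    (.of_forall fun r _ => hsum r)
  have fin' := hasSum_le_of_sum_le (lim.mul_left (R ^ 2 * lam)) fin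
  rw [intervalIntegral.integral_const_mul, intervalIntegral.integral_const_mul] at fin'
  have hpi : 0 < (2 * π)⁻¹ := by positivity
  refine le_of_mul_le_mul_left ?_ hpi
  exact (mul_left_comm _ _ _).trans_le fin'

end SC

namespace SC

open Complex (I)
open scoped Real

/-- The function `F(r) e^{imθ}` on the plane. -/
def angular (m : ℕ) (F : ℝ → ℝ) (x : Plane) : ℂ :=
  (F ‖(x.1 + x.2 * I : ℂ)‖ / ‖(x.1 + x.2 * I : ℂ)‖ ^ m : ℝ) * (x.1 + x.2 * I) ^ m

section

variable {m : ℕ} {F F' : ℝ → ℝ}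

theorem contDiff_angular (hF : ContDiff ℝ 1 F) (h0 : ∀ r ≤ 1 / 4, F r = 0) :
    ContDiff ℝ 1 (angular m F) := by
  have hz : ContDiff ℝ 1 fun x : Plane => (x.1 + x.2 * I : ℂ) := by
    have h1 : ContDiff ℝ 1 fun x : Plane => (x.1 : ℂ) := Complex.ofRealCLM.contDiff.comp contDiff_fst
    have h2 : ContDiff ℝ 1 fun x : Plane => (x.2 : ℂ) := Complex.ofRealCLM.contDiff.comp contDiff_snd
    exact h1.add (h2.mul contDiff_const)
  refine contDiff_iff_contDiffAt.2 fun x => ?_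
  by_cases hx : (x.1 + x.2 * I : ℂ) = 0
  · have hev : ∀ᶠ y : Plane in 𝓝 x, ‖(y.1 + y.2 * I : ℂ)‖ < 1 / 4 :=
      (hz.continuous.norm.tendsto x).eventually_lt_const (by rw [hx]; norm_num)
    refine (contDiffAt_const (c := 0)).congr_of_eventuallyEq (hev.mono fun y hy => ?_)
    simp only [angular, h0 _ hy.le, zero_div, Complex.ofReal_zero, zero_mul]
  · have hn : ContDiffAt ℝ 1 (fun x : Plane => ‖(x.1 + x.2 * I : ℂ)‖) x :=
      (contDiffAt_norm ℝ hx).comp x hz.contDiffAt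
    have hq : ContDiffAt ℝ 1
        (fun x : Plane => F ‖(x.1 + x.2 * I : ℂ)‖ / ‖(x.1 + x.2 * I : ℂ)‖ ^ m) x :=
      (hF.contDiffAt.comp x hn).div (hn.pow m) (pow_ne_zero _ (norm_ne_zero_iff.2 hx))
    exact (Complex.ofRealCLM.contDiff.contDiffAt.comp x hq).mul (hz.contDiffAt.pow m)

theorem pol_angular {r : ℝ} (hr : 0 < r) (θ : ℝ) :
    pol (angular m F) r θ = F r * Complex.exp (θ * I) ^ m := by
  have e : ((r * Real.cos θ : ℝ) + (r * Real.sin θ : ℝ) * I : ℂ) = r * Complex.exp (θ * I) := by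
    rw [Complex.exp_mul_I]; push_cast; ring
  have hr' : (r : ℂ) ≠ 0 := by exact_mod_cast hr.ne'
  rw [pol, angular]
  simp only
  rw [e, norm_mul, Complex.norm_exp_ofReal_mul_I, mul_one, Complex.norm_real,
    Real.norm_of_nonneg hr.le, mul_pow, ← mul_assoc]
  push_cast
  rw [div_mul_cancel₀ _ (pow_ne_zero _ hr')]

theorem magSq_angular (hF : ContDiff ℝ 1 F) (hF' : ∀ r, HasDerivAt F (F' r) r)
    (h0 : ∀ r ≤ 1 / 4, F r = 0) (B : ℝ) {r : ℝ} (hr : 0 < r) (θ : ℝ) :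
    magSq B F0 (angular m F) (r * Real.cos θ, r * Real.sin θ) =
      F' r ^ 2 + (m / r - B * r / 2) ^ 2 * F r ^ 2 := by
  have hu := contDiff_angular (m := m) hF h0
  have e1 : polR (angular m F) r θ = F' r * Complex.exp (θ * I) ^ m := by
    refine (hasDerivAt_pol_r hu r θ).unique
      (((hF' r).ofReal_comp.mul_const (Complex.exp (θ * I) ^ m)).congr_of_eventuallyEq ?_)
    filter_upwards [lt_mem_nhds hr] with s hs using pol_angular hs θ
  have e2 : polT (angular m F) r θ = F r * (m * I * Complex.exp (θ * I) ^ m) := by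
    refine (hasDerivAt_pol_t hu r θ).unique ?_
    simp_rw [pol_angular hr, ← Complex.exp_nat_mul]
    have h1 : HasDerivAt (fun θ : ℝ => (m : ℂ) * (θ * I)) (m * I) θ := by
      simpa using (((hasDerivAt_id θ).ofReal_comp).mul_const I).const_mul (m : ℂ)
    exact (h1.cexp.const_mul (F r : ℂ)).congr_deriv (by ring)
  have key := magSq_polar B (angular m F) r θ
  have hn : ‖Complex.exp (θ * I) ^ m‖ = 1 := by
    rw [norm_pow, Complex.norm_exp_ofReal_mul_I, one_pow]
  rw [e1, e2, pol_angular hr, norm_mul, hn,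
    show -I * (F r * (m * I * Complex.exp (θ * I) ^ m)) +
      (-(B * r ^ 2 / 2) : ℝ) * (F r * Complex.exp (θ * I) ^ m) =
      (((m - B * r ^ 2 / 2) * F r : ℝ) : ℂ) * Complex.exp (θ * I) ^ m by
        push_cast
        linear_combination (-(m : ℂ) * F r * Complex.exp (θ * I) ^ m) * Complex.I_mul_I,
    norm_mul, hn, Complex.norm_real, Complex.norm_real, mul_one, mul_one, Real.norm_eq_abs,
    Real.norm_eq_abs, sq_abs, sq_abs] at key
  have hr2 : r ^ 2 ≠ 0 := by positivity
  refine mul_left_cancel₀ hr2 (key.trans ?_)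
  field_simp

theorem integral_angular (hF : ContDiff ℝ 1 F) (h0 : ∀ r ≤ 1 / 4, F r = 0) :
    ∫ x in unitDisc, ‖angular m F x‖ ^ 2 = 2 * π * ∫ r in (0 : ℝ)..1, F r ^ 2 * r := by
  have hu := (contDiff_angular (m := m) hF h0).continuous
  rw [integral_unitDisc (F := fun x => ‖angular m F x‖ ^ 2) (by fun_prop),
    ← intervalIntegral.integral_const_mul]
  refine intervalIntegral.integral_congr_ae (.of_forall fun r hr => ?_)
  rw [uIoc_of_le zero_le_one] at hr
  have : ∀ θ, ‖angular m F (r * Real.cos θ, r * Real.sin θ)‖ ^ 2 = F r ^ 2 := fun θ => by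
    rw [show angular m F (r * Real.cos θ, r * Real.sin θ) = pol (angular m F) r θ from rfl,
      pol_angular hr.1, norm_mul, norm_pow, Complex.norm_exp_ofReal_mul_I, one_pow, mul_one,
      Complex.norm_real, Real.norm_eq_abs, sq_abs]
  simp only [this, intervalIntegral.integral_const, smul_eq_mul]
  ring

theorem integral_magSq_angular (hF : ContDiff ℝ 1 F) (hF' : ∀ r, HasDerivAt F (F' r) r)
    (h0 : ∀ r ≤ 1 / 4, F r = 0) (B : ℝ) :
    ∫ x in unitDisc, magSq B F0 (angular m F) x =
      2 * π * ∫ r in (0 : ℝ)..1, (F' r ^ 2 + (m / r - B * r / 2) ^ 2 * F r ^ 2) * r := by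
  rw [integral_unitDisc (continuous_magSq B (contDiff_angular hF h0)),
    ← intervalIntegral.integral_const_mul]
  refine intervalIntegral.integral_congr_ae (.of_forall fun r hr => ?_)
  rw [uIoc_of_le zero_le_one] at hr
  simp only [magSq_angular hF hF' h0 B hr.1, intervalIntegral.integral_const, smul_eq_mul]
  ring

end

end SC

namespace SC

theorem exists_bump : ∃ η η' : ℝ → ℝ, ContDiff ℝ 1 η ∧ (∀ r, HasDerivAt η (η' r) r) ∧
    Continuous η' ∧ (∀ r, 0 ≤ η r ∧ η r ≤ 1) ∧ (∀ r ≤ 1 / 4, η r = 0) ∧ (∀ r ≤ 1 / 4, η' r = 0) ∧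
    (∀ r, 1 / 2 ≤ r → η r = 1) ∧ ∀ r, 1 / 2 < r → η' r = 0 := by
  have hη : ContDiff ℝ 1 fun r : ℝ => Real.smoothTransition (6 * r - 2) :=
    Real.smoothTransition.contDiff.comp (by fun_prop)
  have h0 : ∀ r : ℝ, r ≤ 1 / 3 → Real.smoothTransition (6 * r - 2) = 0 := fun r hr =>
    Real.smoothTransition.zero_of_nonpos (by linarith)
  have h1 : ∀ r : ℝ, 1 / 2 ≤ r → Real.smoothTransition (6 * r - 2) = 1 := fun r hr =>
    Real.smoothTransition.one_of_one_le (by linarith)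
  refine ⟨_, _, hη, fun r => (hη.differentiable one_ne_zero r).hasDerivAt,
    hη.continuous_deriv le_rfl, fun r => ⟨Real.smoothTransition.nonneg _,
      Real.smoothTransition.le_one _⟩, fun r hr => h0 r (by linarith), fun r hr => ?_, h1,
    fun r hr => ?_⟩
  · have : (fun r : ℝ => Real.smoothTransition (6 * r - 2)) =ᶠ[𝓝 r] fun _ => 0 := by
      filter_upwards [gt_mem_nhds (show r < 1 / 3 by linarith)] with s hs using h0 s hs.le
    rw [this.deriv_eq, deriv_const]
  · have : (fun r : ℝ => Real.smoothTransition (6 * r - 2)) =ᶠ[𝓝 r] fun _ => 1 := by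
      filter_upwards [lt_mem_nhds hr] with s hs using h1 s hs.le
    rw [this.deriv_eq, deriv_const]

theorem integral_cauchy_le {R : ℝ} (hR : 0 < R) {a : ℝ} :
    ∫ r in a..1, (1 + (R * (1 - r)) ^ 2)⁻¹ ≤ 2 * R⁻¹ := by
  have h := intervalIntegral.integral_comp_sub_mul (fun t : ℝ => (1 + t ^ 2)⁻¹) hR.ne' R
    (a := a) (b := 1)
  simp only [integral_inv_one_add_sq, smul_eq_mul, mul_one, sub_self, Real.arctan_zero,
    sub_zero] at h
  simp only [mul_sub, mul_one]
  rw [h, mul_comm]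
  have := Real.arctan_lt_pi_div_two (R - R * a)
  have := Real.pi_lt_d2
  exact mul_le_mul_of_nonneg_right (by linarith) (inv_nonneg.2 hR.le)

theorem integral_zero_one_eq {g : ℝ → ℝ} (h0 : ∀ r ≤ 1 / 4, g r = 0)
    (hg : ContinuousOn g (Icc (1 / 4) 1)) :
    ∫ r in (0 : ℝ)..1, g r = ∫ r in (1 / 4 : ℝ)..1, g r := by
  have hu : uIcc (1 / 4 : ℝ) 1 = Icc (1 / 4) 1 := uIcc_of_le (by norm_num)
  have hz : ∀ r ∈ uIcc (0 : ℝ) (1 / 4), g r = 0 := fun r hr => by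
    rw [uIcc_of_le (by norm_num)] at hr
    exact h0 r hr.2
  have hc : ContinuousOn g (uIcc 0 (1 / 4)) := continuousOn_const.congr hz
  rw [← intervalIntegral.integral_add_adjacent_intervals hc.intervalIntegrable
    (hu ▸ hg).intervalIntegrable, intervalIntegral.integral_congr hz]
  simp

namespace Profile

variable (P : Profile)

/-- The energy density of a cut-off quasimode, up to a total derivative. -/
theorem density_identity {r R η η' p p' φ V res h w : ℝ} (hr : r ≠ 0) (hR : R ≠ 0)
    (hh : h = R⁻¹) (hw : w = r) (hres : res = V - p' - p ^ 2 + h / w * p) :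
    R * ((η ^ 2 * p + r * (2 * η * η') * p + r * η ^ 2 * (p' * -R)) * φ ^ 2 +
      r * η ^ 2 * p * (2 * φ * (p * φ * -R))) =
    η' ^ 2 * φ ^ 2 * r + R ^ 2 * res * (η * φ) ^ 2 * r -
      ((η' * φ + η * (p * φ * -R)) ^ 2 + R ^ 2 * V * (η * φ) ^ 2) * r := by
  subst hh hw hres
  field_simp
  ring

set_option maxHeartbeats 1600000 in
theorem exists_trial : ∃ C, 0 ≤ C ∧ ∀ (R ε : ℝ) (m : ℕ), 2 ≤ R → R⁻¹ + |ε| ≤ 1 →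
    m = R ^ 2 / 2 + (P.ξ + ε) * R → ∃ F F' : ℝ → ℝ, ContDiff ℝ 1 F ∧
      (∀ r, HasDerivAt F (F' r) r) ∧ (∀ r ≤ 1 / 4, F r = 0) ∧
      0 < ∫ r in (0 : ℝ)..1, F r ^ 2 * r ∧
      ∫ r in (0 : ℝ)..1, (F' r ^ 2 + (m / r - R ^ 2 * r / 2) ^ 2 * F r ^ 2) * r ≤
        R ^ 2 * (P.lev R⁻¹ ε + C * (R⁻¹ + |ε|) ^ 3) * ∫ r in (0 : ℝ)..1, F r ^ 2 * r := by
  obtain ⟨η, η', hη, hηd, hηc, hη01, hη0, hη0', hη1, hη1'⟩ := exists_bump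
  obtain ⟨M, K₀, hK₀, hcut⟩ := P.exists_cutoff
  obtain ⟨C, N, hC, hres⟩ := P.res_sub_lev M
  obtain ⟨A, hA, hvA⟩ := P.v_mul_pow_bounded (N + 1)
  obtain ⟨A₀, hA₀, hvA₀⟩ := P.v_mul_pow_bounded 0
  obtain ⟨L, hL⟩ := isCompact_Icc.exists_bound_of_continuousOn (s := Icc (0 : ℝ) 1) hηc.continuousOn
  set K := A * A₀ * Real.exp (2 * K₀) ^ 2 with hKdef
  have hK : 0 ≤ K := by positivity
  set c := (P.v 1 * Real.exp (-(2 * K₀))) ^ 2 / 2 with hcdef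
  have hc : 0 < c := by have := P.v_pos 1; positivity
  refine ⟨(4 * L ^ 2 * K + 2 * C * K) / c, by positivity, fun R ε m hR hs hm => ?_⟩
  have hR0 : 0 < R := by linarith
  set h := R⁻¹ with hh
  have hh0 : 0 < h := inv_pos.2 hR0
  have hRh : R * h = 1 := mul_inv_cancel₀ hR0.ne'
  have hh1 : h ≤ 1 / 2 := by rw [hh]; exact (inv_le_inv₀ hR0 two_pos).2 hR |>.trans (by norm_num)
  set s := h + |ε| with hsdef
  have hsh : h ≤ s := by have := abs_nonneg ε; linarith
  set φ : ℝ → ℝ := fun r => P.mode M h ε (R * (1 - r)) with hφ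
  set q : ℝ → ℝ := fun r => P.p M h ε (R * (1 - r)) with hq
  have hlin : ∀ r : ℝ, HasDerivAt (fun r : ℝ => R * (1 - r)) (-R) r := fun r => by
    simpa using ((hasDerivAt_id r).const_sub 1).const_mul R
  have hφd : ∀ r, HasDerivAt φ (q r * φ r * -R) r := fun r =>
    HasDerivAt.comp (h₂ := P.mode M h ε) (h := fun r => R * (1 - r)) r
      (P.hasDerivAt_mode M h ε (R * (1 - r))) (hlin r)
  have hqd : ∀ r, HasDerivAt q (P.p' M h ε (R * (1 - r)) * -R) r := fun r =>
    HasDerivAt.comp (h₂ := P.p M h ε) (h := fun r => R * (1 - r)) r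
      (P.hasDerivAt_p M h ε (R * (1 - r))) (hlin r)
  have hφc : Continuous φ := continuous_iff_continuousAt.2 fun r => (hφd r).continuousAt
  have hqc : Continuous q := continuous_iff_continuousAt.2 fun r => (hqd r).continuousAt
  have hηcc : Continuous η := hη.continuous
  have hFd : ∀ r, HasDerivAt (fun r => η r * φ r) (η' r * φ r + η r * (q r * φ r * -R)) r :=
    fun r => (hηd r).mul (hφd r)
  have hF : ContDiff ℝ 1 fun r => η r * φ r := by
    refine contDiff_one_iff_deriv.2 ⟨fun r => (hFd r).differentiableAt, ?_⟩
    rw [funext fun r => (hFd r).deriv]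
    fun_prop
  have hV : ContinuousOn (fun r : ℝ => (m : ℝ) / r - R ^ 2 * r / 2) (Icc (1 / 4) 1) :=
    (continuousOn_const.div continuousOn_id fun r hr => by have := hr.1; intro h; simp at h; linarith).sub
      (by fun_prop)
  have hcut' := fun t ht => hcut h ε t hh0 hs ht
  have hφK : ∀ r, r ≤ 1 → (1 + (R * (1 - r)) ^ 2) ^ N * φ r ^ 2 ≤ K * (1 + (R * (1 - r)) ^ 2)⁻¹ :=
    fun r hr => by
      have ht : 0 ≤ R * (1 - r) := mul_nonneg hR0.le (by linarith)
      have hJ : 0 < 1 + (R * (1 - r)) ^ 2 := by positivity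
      have b := (P.mode_bounds hK₀ hcut' ht).2
      have h1 := hvA _ ht
      have h2 := hvA₀ _ ht
      rw [pow_zero, mul_one] at h2
      have hv := P.v_pos (R * (1 - r))
      rw [← div_eq_mul_inv, le_div_iff₀ hJ]
      calc (1 + (R * (1 - r)) ^ 2) ^ N * φ r ^ 2 * (1 + (R * (1 - r)) ^ 2)
          ≤ (1 + (R * (1 - r)) ^ 2) ^ N * (P.v (R * (1 - r)) * Real.exp (2 * K₀)) ^ 2 *
              (1 + (R * (1 - r)) ^ 2) := by
            have := (P.mode_pos M h ε (R * (1 - r))).le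
            gcongr
        _ = (P.v (R * (1 - r)) * (1 + (R * (1 - r)) ^ 2) ^ (N + 1)) * P.v (R * (1 - r)) *
              Real.exp (2 * K₀) ^ 2 := by ring
        _ ≤ A * A₀ * Real.exp (2 * K₀) ^ 2 := by gcongr
  have hφK0 : ∀ r, r ≤ 1 → φ r ^ 2 ≤ K * (1 + (R * (1 - r)) ^ 2)⁻¹ := fun r hr =>
    le_trans (le_mul_of_one_le_left (sq_nonneg _)
      (one_le_pow₀ (by linarith [sq_nonneg (R * (1 - r))]))) (hφK r hr)
  have hint : ∀ f : ℝ → ℝ, ContinuousOn f (Icc (1 / 4) 1) → IntervalIntegrable f volume (1 / 4) 1 :=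
    fun f hf => ContinuousOn.intervalIntegrable (by rwa [uIcc_of_le (by norm_num)])
  have hle : (1 / 4 : ℝ) ≤ 1 := by norm_num
  set mass := ∫ r in (1 / 4 : ℝ)..1, (η r * φ r) ^ 2 * r with hmass
  have hmass_ge : c * h ≤ mass := by
    have h1 : ∫ r in (1 - h)..1, c ≤ ∫ r in (1 - h)..1, (η r * φ r) ^ 2 * r := by
      refine intervalIntegral.integral_mono_on (by linarith) intervalIntegrable_const
        (by apply Continuous.intervalIntegrable; fun_prop) fun r hr => ?_
      have hr1 : 1 / 2 ≤ r := by linarith [hr.1]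
      have ht : 0 ≤ R * (1 - r) := mul_nonneg hR0.le (by linarith [hr.2])
      have ht1 : R * (1 - r) ≤ 1 := by
        rw [← hRh]; exact mul_le_mul_of_nonneg_left (by linarith [hr.1]) hR0.le
      have hv : P.v 1 ≤ P.v (R * (1 - r)) :=
        P.v_antitone (show 0 ≤ R * (1 - r) from ht) (show (0 : ℝ) ≤ 1 by norm_num) ht1
      have hb := (P.mode_bounds hK₀ hcut' ht).1
      have h3 : P.v 1 * Real.exp (-(2 * K₀)) ≤ φ r :=
        (mul_le_mul_of_nonneg_right hv (Real.exp_pos _).le).trans hb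
      have h4 : 0 < P.v 1 := P.v_pos 1
      rw [hη1 r hr1, one_mul, hcdef, div_eq_mul_inv]
      gcongr
      linarith
    have h2 : ∫ r in (1 - h)..1, (η r * φ r) ^ 2 * r ≤ mass :=
      intervalIntegral.integral_mono_interval (by linarith) (by linarith) le_rfl
        (by
          filter_upwards [ae_restrict_mem measurableSet_Ioc] with r hr
          have : 0 < r := by linarith [hr.1]
          exact mul_nonneg (sq_nonneg _) this.le) (hint _ (by fun_prop))
    rw [intervalIntegral.integral_const, smul_eq_mul] at h1
    calc c * h = (1 - (1 - h)) * c := by ring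
      _ ≤ _ := h1.trans h2
  have hmass0 : 0 < mass := (mul_pos hc hh0).trans_le hmass_ge
  have key := intervalIntegral.sub_le_integral_of_hasDeriv_right_of_le hle
    (g := fun r => R * (r * η r ^ 2 * q r * φ r ^ 2)) (by fun_prop)
    (fun r _ => HasDerivAt.hasDerivWithinAt (((((hasDerivAt_id r).mul ((hηd r).pow 2)).mul
      (hqd r)).mul ((hφd r).pow 2)).const_mul R))
    (φ := fun r => (η' r ^ 2 * φ r ^ 2 * r +
      R ^ 2 * (P.lev h ε * ((η r * φ r) ^ 2 * r) +
        C * s ^ 3 * ((1 + (R * (1 - r)) ^ 2) ^ N * (η r * φ r) ^ 2 * r))) -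
      ((η' r * φ r + η r * (q r * φ r * -R)) ^ 2 +
        (m / r - R ^ 2 * r / 2) ^ 2 * (η r * φ r) ^ 2) * r)
    (ContinuousOn.integrableOn_Icc (by fun_prop)) (fun r hr => by
      have hr0 : 0 < r := by linarith [hr.1]
      have ht : 0 ≤ R * (1 - r) := mul_nonneg hR0.le (by linarith [hr.2])
      have e1 : h * (R * (1 - r)) = 1 - r := by rw [← mul_assoc, mul_comm h, hRh, one_mul]
      have hV' : (m / r - R ^ 2 * r / 2) ^ 2 = R ^ 2 * P.pot h ε (R * (1 - r)) := by
        have hden : 1 - h * (R * (1 - r)) = r := by rw [e1]; ring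
        rw [pot, hden, hm, hh]
        field_simp
        ring
      have hid := density_identity (r := r) (R := R) (η := η r) (η' := η' r) (p := q r)
        (p' := P.p' M h ε (R * (1 - r))) (φ := φ r) (V := P.pot h ε (R * (1 - r)))
        (res := P.res M h ε (R * (1 - r))) (h := h) (w := 1 - h * (R * (1 - r)))
        hr0.ne' hR0.ne' hh (by rw [e1]; ring) rfl
      have hb := (abs_le.1 (hres h ε (R * (1 - r)) hh0 hs ht (by rw [e1]; linarith [hr.1]))).2
      have hb' := mul_le_mul_of_nonneg_left hb
        (show 0 ≤ R ^ 2 * ((η r * φ r) ^ 2 * r) by positivity)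
      rw [hV']
      refine le_of_eq_of_le (Eq.trans ?_ hid) ?_
      · simp only [id, Pi.pow_apply, Pi.mul_apply]
        ring
      · linarith)
  have hq1 : q 1 = 0 := by
    change P.p M h ε (R * (1 - 1)) = 0
    rw [sub_self, mul_zero, P.p_zero]
  have he : ContinuousOn (fun r => ((η' r * φ r + η r * (q r * φ r * -R)) ^ 2 +
      (m / r - R ^ 2 * r / 2) ^ 2 * (η r * φ r) ^ 2) * r) (Icc (1 / 4) 1) := by fun_prop
  rw [hq1, hη0 (1 / 4) le_rfl, intervalIntegral.integral_sub (hint _ (by fun_prop)) (hint _ he),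
    intervalIntegral.integral_add (hint _ (by fun_prop)) (hint _ (by fun_prop)),
    intervalIntegral.integral_const_mul, intervalIntegral.integral_add (hint _ (by fun_prop))
      (hint _ (by fun_prop)), intervalIntegral.integral_const_mul,
    intervalIntegral.integral_const_mul, ← hmass] at key
  have t1 : ∫ r in (1 / 4 : ℝ)..1, η' r ^ 2 * φ r ^ 2 * r ≤ 4 * L ^ 2 * K * h ^ 2 := by
    have : ∫ r in (1 / 4 : ℝ)..1, η' r ^ 2 * φ r ^ 2 * r ≤
        ∫ r in (1 / 4 : ℝ)..1, 4 * L ^ 2 * K * h ^ 2 := by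
      refine intervalIntegral.integral_mono_on hle (hint _ (by fun_prop)) intervalIntegrable_const
        fun r hr => ?_
      have hr0 : 0 ≤ r := by linarith [hr.1]
      rcases le_or_gt r (1 / 2) with h2 | h2
      · have a1 : η' r ^ 2 ≤ L ^ 2 := sq_le_sq' (abs_le.1 (hL r ⟨hr0, hr.2⟩)).1
          (abs_le.1 (hL r ⟨hr0, hr.2⟩)).2
        have a2 : (1 + (R * (1 - r)) ^ 2)⁻¹ ≤ 4 * h ^ 2 := by
          have a3 : (R / 2) ^ 2 ≤ (R * (1 - r)) ^ 2 :=
            pow_le_pow_left₀ (by positivity) (by nlinarith) 2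
          calc (1 + (R * (1 - r)) ^ 2)⁻¹ ≤ ((R / 2) ^ 2)⁻¹ :=
                inv_anti₀ (by positivity) (by linarith)
            _ = 4 * h ^ 2 := by rw [hh]; field_simp; norm_num
        calc η' r ^ 2 * φ r ^ 2 * r ≤ L ^ 2 * (K * (4 * h ^ 2)) * 1 := by
              gcongr
              · exact (hφK0 r hr.2).trans (by gcongr)
              · exact hr.2
          _ = _ := by ring
      · rw [hη1' r h2]
        have : 0 ≤ 4 * L ^ 2 * K * h ^ 2 := by positivity
        simpa using this
    rw [intervalIntegral.integral_const, smul_eq_mul] at this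
    have h0 : 0 ≤ 4 * L ^ 2 * K * h ^ 2 := by positivity
    linarith
  have t2 : ∫ r in (1 / 4 : ℝ)..1, (1 + (R * (1 - r)) ^ 2) ^ N * (η r * φ r) ^ 2 * r ≤
      2 * K * h := by
    have hcc : Continuous fun r : ℝ => K * (1 + (R * (1 - r)) ^ 2)⁻¹ :=
      continuous_const.mul (Continuous.inv₀ (by fun_prop) fun r => by positivity)
    have : ∫ r in (1 / 4 : ℝ)..1, (1 + (R * (1 - r)) ^ 2) ^ N * (η r * φ r) ^ 2 * r ≤
        ∫ r in (1 / 4 : ℝ)..1, K * (1 + (R * (1 - r)) ^ 2)⁻¹ := by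
      refine intervalIntegral.integral_mono_on hle (hint _ (by fun_prop))
        (hcc.intervalIntegrable _ _) fun r hr => ?_
      have hr0 : 0 ≤ r := by linarith [hr.1]
      have a1 : η r ^ 2 ≤ 1 := pow_le_one₀ (hη01 r).1 (hη01 r).2
      calc (1 + (R * (1 - r)) ^ 2) ^ N * (η r * φ r) ^ 2 * r
          = ((1 + (R * (1 - r)) ^ 2) ^ N * φ r ^ 2) * (η r ^ 2 * r) := by ring
        _ ≤ ((1 + (R * (1 - r)) ^ 2) ^ N * φ r ^ 2) * 1 := by
            refine mul_le_mul_of_nonneg_left (mul_le_one₀ a1 hr0 hr.2) (by positivity)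
        _ ≤ _ := by rw [mul_one]; exact hφK r hr.2
    rw [intervalIntegral.integral_const_mul] at this
    have h2 := mul_le_mul_of_nonneg_left (integral_cauchy_le hR0 (a := 1 / 4)) hK
    linarith
  have z1 : ∫ r in (0 : ℝ)..1, (η r * φ r) ^ 2 * r = mass :=
    integral_zero_one_eq (fun r hr => by rw [hη0 r hr]; ring) (by fun_prop)
  have z2 := integral_zero_one_eq (g := fun r => ((η' r * φ r + η r * (q r * φ r * -R)) ^ 2 +
    (m / r - R ^ 2 * r / 2) ^ 2 * (η r * φ r) ^ 2) * r)
    (fun r hr => by rw [hη0 r hr, hη0' r hr]; ring) he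
  refine ⟨_, _, hF, hFd, fun r hr => by rw [hη0 r hr, zero_mul], z1 ▸ hmass0, ?_⟩
  rw [z1, z2]
  refine (sub_nonneg.1 (le_trans (by simp) key)).trans ?_
  have hC3 : 0 ≤ R ^ 2 * (C * s ^ 3) := by positivity
  have f1 : h ^ 2 ≤ R ^ 2 * s ^ 3 * (mass / c) := by
    have b1 : h ≤ mass / c := (le_div_iff₀ hc).2 (by linarith)
    calc h ^ 2 = R ^ 2 * h ^ 3 * h := by
          rw [show R ^ 2 * h ^ 3 * h = (R * h) ^ 2 * h ^ 2 by ring, hRh]; ring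
      _ ≤ _ := by gcongr
  have f2 : h ≤ mass / c := (le_div_iff₀ hc).2 (by linarith)
  calc _ ≤ 4 * L ^ 2 * K * h ^ 2 + R ^ 2 * (P.lev h ε * mass + C * s ^ 3 * (2 * K * h)) := by
        gcongr
    _ ≤ 4 * L ^ 2 * K * (R ^ 2 * s ^ 3 * (mass / c)) +
        R ^ 2 * (P.lev h ε * mass + C * s ^ 3 * (2 * K * (mass / c))) := by gcongr
    _ = _ := by field_simp; ring

end Profile

end SC

namespace SC

namespace Profile

variable (P : Profile)

/-- The optimal shift of the angular momentum. -/
def shift₀ : ℝ := -P.avg P.src₂ / (2 * P.avg P.src₁)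

/-- The constant in the second-order term. -/
def const₀ : ℝ := P.avg P.src₃ / P.avg P.src₁ - P.shift₀ ^ 2

/-- The level as a function of `h` and of the rescaled angular momentum. -/
def level (h y : ℝ) : ℝ :=
  P.ξ ^ 2 + h * P.avg P.srcβ + h ^ 2 * (P.avg P.src₁ * (y ^ 2 + P.const₀))

theorem lev_eq_level (h y : ℝ) : P.lev h (h * (y + P.shift₀)) = P.level h y := by
  have := P.avg_src₁_pos.ne'
  unfold lev level const₀ shift₀
  field_simp
  ring

theorem exists_level_le (C : ℝ) (hC : 0 ≤ C) : ∃ ε₁ h₁ C', 0 < ε₁ ∧ 0 < h₁ ∧ 0 ≤ C' ∧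
    ∀ h y Δ : ℝ, 0 < h → h ≤ h₁ → 0 ≤ Δ → Δ ≤ 1 / 2 → Δ ≤ |y| → |h * (y + P.shift₀)| ≤ ε₁ →
      P.level h Δ - C' * h ^ 3 ≤ P.level h y - C * (h + |h * (y + P.shift₀)|) ^ 3 := by
  set A := P.avg P.src₁ with hA
  have hA0 : 0 < A := P.avg_src₁_pos
  set k := 1 + |P.shift₀| with hk
  have hk1 : 1 ≤ k := by have := abs_nonneg P.shift₀; linarith
  set D := C * (k + 1) ^ 3 with hD
  have hD0 : 0 ≤ D := by positivity
  refine ⟨A / (4 * (D + 1)), A / (4 * (D + 1) * k), D, by positivity, by positivity, hD0,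
    fun h y Δ h0 h1 hΔ0 hΔ1 hΔy hε => ?_⟩
  have hy0 := abs_nonneg y
  have e1 : h + |h * (y + P.shift₀)| ≤ h * (k + |y|) := by
    rw [abs_mul, abs_of_pos h0]
    nlinarith [abs_add_le y P.shift₀]
  have e2 : h * |y| ≤ |h * (y + P.shift₀)| + h * k := by
    have : |y| ≤ |y + P.shift₀| + |P.shift₀| := by simpa using abs_sub (y + P.shift₀) P.shift₀
    rw [abs_mul, abs_of_pos h0]
    nlinarith
  have e3 : C * (h + |h * (y + P.shift₀)|) ^ 3 ≤ C * (h * (k + |y|)) ^ 3 := by gcongr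
  have e4 : P.level h y = P.level h Δ + h ^ 2 * (A * (y ^ 2 - Δ ^ 2)) := by
    unfold level; ring
  have hyΔ : Δ ^ 2 ≤ y ^ 2 := by rw [← sq_abs y]; gcongr
  rcases le_or_gt |y| 1 with hy | hy
  · have e5 : C * (h * (k + |y|)) ^ 3 ≤ D * h ^ 3 := by
      calc C * (h * (k + |y|)) ^ 3 ≤ C * (h * (k + 1)) ^ 3 := by gcongr
        _ = D * h ^ 3 := by rw [hD]; ring
    have e6 : 0 ≤ h ^ 2 * (A * (y ^ 2 - Δ ^ 2)) :=
      mul_nonneg (sq_nonneg h) (mul_nonneg hA0.le (by linarith))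
    linarith
  · have e5 : C * (h * (k + |y|)) ^ 3 ≤ h ^ 2 * (D * (h * |y|) * y ^ 2) := by
      calc C * (h * (k + |y|)) ^ 3 ≤ C * (h * ((k + 1) * |y|)) ^ 3 := by
            gcongr; nlinarith
        _ = h ^ 2 * (D * (h * |y|) * y ^ 2) := by rw [hD, ← sq_abs y]; ring
    have e6 : D * (h * |y|) ≤ A / 2 := by
      have a1 : (D + 1) * |h * (y + P.shift₀)| ≤ A / 4 := by
        rw [le_div_iff₀ (by positivity)] at hε; linarith
      have a2 : (D + 1) * (h * k) ≤ A / 4 := by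
        rw [le_div_iff₀ (by positivity)] at h1; linarith
      calc D * (h * |y|) ≤ (D + 1) * (|h * (y + P.shift₀)| + h * k) := by
            gcongr; linarith
        _ ≤ A / 2 := by linarith
    have hy2 : 1 ≤ y ^ 2 := by rw [← sq_abs]; nlinarith
    have e7 : D * (h * |y|) * y ^ 2 ≤ A / 2 * y ^ 2 := by gcongr
    have e8 : Δ ^ 2 ≤ 1 / 4 := by nlinarith
    have e9 : A / 2 * y ^ 2 ≤ A * (y ^ 2 - Δ ^ 2) := by nlinarith
    have e10 := mul_le_mul_of_nonneg_left (e7.trans e9) (sq_nonneg h)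
    have : 0 ≤ D * h ^ 3 := by positivity
    linarith

theorem exists_level_le_add {c : ℝ} (hc : 0 < c) : ∃ h₁, 0 < h₁ ∧ ∀ h Δ : ℝ, 0 < h → h ≤ h₁ →
    0 ≤ Δ → Δ ≤ 1 / 2 → P.level h Δ ≤ P.ξ ^ 2 + c := by
  have hA0 := P.avg_src₁_pos
  set a := P.avg P.src₁ * (1 + |P.const₀|) with ha
  have ha0 : 0 < a := by have := abs_nonneg P.const₀; positivity
  refine ⟨min 1 (c / a), lt_min one_pos (by positivity), fun h Δ h0 h1 h2 h3 => ?_⟩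
  have hh1 := h1.trans (min_le_left _ _)
  have hh2 := (le_div_iff₀ ha0).1 (h1.trans (min_le_right _ _))
  have e1 : P.avg P.src₁ * (Δ ^ 2 + P.const₀) ≤ a := by
    have := le_abs_self P.const₀
    exact mul_le_mul_of_nonneg_left (by nlinarith) hA0.le
  have e2 : h * P.avg P.srcβ ≤ 0 := by
    rw [avg_srcβ]
    have := sq_nonneg (P.v 0)
    exact mul_nonpos_of_nonneg_of_nonpos h0.le (by linarith)
  have e3 : h ^ 2 * (P.avg P.src₁ * (Δ ^ 2 + P.const₀)) ≤ h ^ 2 * a := by gcongr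
  have e4 : h ^ 2 * a ≤ h * a := by gcongr; nlinarith
  unfold level
  linarith

end Profile

theorem exists_deltaB (ξ δ B : ℝ) : ∃ m : ℤ, |m - B / 2 - ξ * √B - δ| = DeltaB ξ δ B ∧
    0 ≤ DeltaB ξ δ B ∧ DeltaB ξ δ B ≤ 1 / 2 ∧
    ∀ n : ℤ, DeltaB ξ δ B ≤ |n - B / 2 - ξ * √B - δ| := by
  set x := B / 2 + ξ * √B + δ with hx
  have e : ∀ n : ℤ, |(n : ℝ) - B / 2 - ξ * √B - δ| = |x - n| := fun n => by
    rw [abs_sub_comm x, hx]; congr 1; ring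
  have hb : BddBelow (range fun m : ℤ => |(m : ℝ) - B / 2 - ξ * √B - δ|) :=
    ⟨0, by rintro _ ⟨m, rfl⟩; exact abs_nonneg _⟩
  have hle : ∀ n : ℤ, DeltaB ξ δ B ≤ |n - B / 2 - ξ * √B - δ| := fun n => csInf_le hb ⟨n, rfl⟩
  have heq : |(round x : ℝ) - B / 2 - ξ * √B - δ| = DeltaB ξ δ B := by
    refine le_antisymm (le_csInf (range_nonempty _) ?_) (hle _)
    rintro _ ⟨m, rfl⟩
    simp only [e]
    exact round_le x m
  refine ⟨round x, heq, ?_, ?_, hle⟩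
  · rw [← heq]; exact abs_nonneg _
  · rw [← heq, e]; exact abs_sub_round x

end SC

namespace SC

theorem magSq_nonneg (B : ℝ) (A : Plane → Plane) (u : Plane → ℂ) (x : Plane) :
    0 ≤ magSq B A u x := by
  unfold magSq; positivity

theorem lam1_le {B : ℝ} {u : Plane → ℂ} (hu : CNearCl 1 unitDisc u)
    (h0 : ∫ x in unitDisc, ‖u x‖ ^ 2 ≠ 0) :
    lam1 unitDisc B ≤ (∫ x in unitDisc, magSq B F0 u x) / ∫ x in unitDisc, ‖u x‖ ^ 2 := by
  refine csInf_le ⟨0, ?_⟩ ⟨u, hu, h0, rfl⟩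
  rintro _ ⟨w, -, -, rfl⟩
  exact div_nonneg (integral_nonneg fun x => magSq_nonneg _ _ _ _)
    (integral_nonneg fun x => by positivity)

theorem le_lam1 {B c : ℝ} {w : Plane → ℂ} (hw : CNearCl 1 unitDisc w)
    (hw0 : ∫ x in unitDisc, ‖w x‖ ^ 2 ≠ 0)
    (h : ∀ u : Plane → ℂ, CNearCl 1 unitDisc u →
      c * ∫ x in unitDisc, ‖u x‖ ^ 2 ≤ ∫ x in unitDisc, magSq B F0 u x) :
    c ≤ lam1 unitDisc B := by
  refine le_csInf ⟨_, w, hw, hw0, rfl⟩ ?_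
  rintro _ ⟨u, hu, hu0, rfl⟩
  have : 0 ≤ ∫ x in unitDisc, ‖u x‖ ^ 2 := integral_nonneg fun x => by positivity
  exact (le_div_iff₀ (this.lt_of_ne' hu0)).2 (h u hu)

namespace Profile

variable (P : Profile)

theorem exists_trial_plane : ∃ C R₀, 0 ≤ C ∧ 1 ≤ R₀ ∧ ∀ R : ℝ, R₀ ≤ R →
    ∃ u : Plane → ℂ, CNearCl 1 unitDisc u ∧ 0 < ∫ x in unitDisc, ‖u x‖ ^ 2 ∧
      ∫ x in unitDisc, magSq (R ^ 2) F0 u x ≤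
        R ^ 2 * (P.level R⁻¹ (DeltaB P.ξ P.shift₀ (R ^ 2)) + C * R⁻¹ ^ 3) *
          ∫ x in unitDisc, ‖u x‖ ^ 2 := by
  obtain ⟨C, hC, H⟩ := P.exists_trial
  set k := |P.shift₀| + 2 with hk
  have hk2 : 2 ≤ k := by have := abs_nonneg P.shift₀; linarith
  refine ⟨C * k ^ 3, 4 + k, by positivity, by linarith, fun R hR => ?_⟩
  have hR0 : 0 < R := by linarith
  have hh0 : 0 < R⁻¹ := inv_pos.2 hR0
  have hRk : R⁻¹ * k ≤ 1 := by rw [inv_mul_le_iff₀ hR0]; linarith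
  obtain ⟨m, hm, hΔ0, hΔ1, -⟩ := exists_deltaB P.ξ P.shift₀ (R ^ 2)
  rw [Real.sqrt_sq hR0.le] at hm
  set Δ := DeltaB P.ξ P.shift₀ (R ^ 2)
  set y := (m : ℝ) - R ^ 2 / 2 - P.ξ * R - P.shift₀ with hy
  set ε := R⁻¹ * (y + P.shift₀) with hε
  have hmε : (m : ℝ) = R ^ 2 / 2 + (P.ξ + ε) * R := by
    rw [hε, hy]; field_simp; ring
  have hεk : R⁻¹ + |ε| ≤ k * R⁻¹ := by
    rw [hε, abs_mul, abs_of_pos hh0]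
    nlinarith [abs_add_le y P.shift₀]
  have hε1 : |ε| ≤ 1 := by linarith
  have hm0 : 0 ≤ m := by
    have e1 : (0 : ℝ) ≤ m := by
      have := P.ξ_gt
      have := (abs_le.1 hε1).1
      rw [hmε]; nlinarith
    exact_mod_cast e1
  lift m to ℕ using hm0
  obtain ⟨F, F', hF, hF', hF0, hpos, hle⟩ := H R ε m (by linarith) (by linarith) (by simpa using hmε)
  have hlev : P.lev R⁻¹ ε = P.level R⁻¹ Δ := by
    rw [hε, lev_eq_level, ← hm]; unfold level; rw [sq_abs]
  refine ⟨angular m F, ⟨univ, isOpen_univ, subset_univ _,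
    (contDiff_angular hF hF0).contDiffOn⟩, ?_, ?_⟩
  · rw [integral_angular hF hF0]; positivity
  · rw [integral_angular hF hF0, integral_magSq_angular hF hF' hF0]
    have e1 : C * (R⁻¹ + |ε|) ^ 3 ≤ C * k ^ 3 * R⁻¹ ^ 3 := by
      rw [mul_assoc, ← mul_pow]; gcongr
    rw [hlev] at hle
    have e2 := hle.trans (mul_le_mul_of_nonneg_right
      (mul_le_mul_of_nonneg_left (add_le_add_right e1 _) (sq_nonneg R)) hpos.le)
    have := mul_le_mul_of_nonneg_left e2 (show 0 ≤ 2 * Real.pi by positivity)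
    linarith

theorem exists_le_magSq : ∃ C R₀, 0 ≤ C ∧ 1 ≤ R₀ ∧ ∀ R : ℝ, R₀ ≤ R →
    ∀ u : Plane → ℂ, CNearCl 1 unitDisc u →
      R ^ 2 * (P.level R⁻¹ (DeltaB P.ξ P.shift₀ (R ^ 2)) - C * R⁻¹ ^ 3) *
        ∫ x in unitDisc, ‖u x‖ ^ 2 ≤ ∫ x in unitDisc, magSq (R ^ 2) F0 u x := by
  obtain ⟨C, hC, H⟩ := P.exists_radialBound
  obtain ⟨ε₁, h₁, C', hε₁, hh₁, hC', hnear⟩ := P.exists_level_le C hC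
  obtain ⟨ε₀, c, R₀, -, hε₀, hc, hR₀, hbound⟩ := H ε₁ hε₁
  obtain ⟨h₂, hh₂, hfar⟩ := P.exists_level_le_add hc
  refine ⟨C', max R₀ (max h₁⁻¹ h₂⁻¹), hC', hR₀.trans (le_max_left _ _), fun R hR u hu => ?_⟩
  have hRR₀ := (le_max_left _ _).trans hR
  have hR0 : 0 < R := by linarith
  have hh0 : 0 < R⁻¹ := inv_pos.2 hR0
  have hRh₁ : R⁻¹ ≤ h₁ :=
    inv_le_of_inv_le₀ hh₁ (((le_max_left _ _).trans (le_max_right _ _)).trans hR)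
  have hRh₂ : R⁻¹ ≤ h₂ :=
    inv_le_of_inv_le₀ hh₂ (((le_max_right _ _).trans (le_max_right _ _)).trans hR)
  obtain ⟨-, -, hΔ0, hΔ1, hΔle⟩ := exists_deltaB P.ξ P.shift₀ (R ^ 2)
  refine le_integral_magSq hR0 (fun m => ?_) hu
  have hΔy := hΔle m
  rw [Real.sqrt_sq hR0.le] at hΔy
  set y := (m : ℝ) - R ^ 2 / 2 - P.ξ * R - P.shift₀ with hy
  have hm : (m : ℝ) = R ^ 2 / 2 + (P.ξ + R⁻¹ * (y + P.shift₀)) * R := by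
    rw [hy]; field_simp; ring
  obtain ⟨hb₁, hb₂⟩ := hbound R _ m hRR₀ hm
  rcases le_or_gt |R⁻¹ * (y + P.shift₀)| ε₀ with hε | hε
  · refine (hb₁ hε).mono ?_
    rw [lev_eq_level]
    exact hnear _ _ _ hh0 hRh₁ hΔ0 hΔ1 hΔy (hε.trans hε₀)
  · refine (hb₂ hε).mono ?_
    have : 0 ≤ C' * R⁻¹ ^ 3 := by positivity
    linarith [hfar _ _ hh0 hRh₂ hΔ0 hΔ1]

theorem exists_lam1_sub_level_le : ∃ C, 0 < C ∧ ∃ R₀, 1 ≤ R₀ ∧ ∀ R : ℝ, R₀ ≤ R →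
    |lam1 unitDisc (R ^ 2) - R ^ 2 * P.level R⁻¹ (DeltaB P.ξ P.shift₀ (R ^ 2))| ≤ C * R⁻¹ := by
  obtain ⟨C₁, R₁, hC₁, hR₁, htrial⟩ := P.exists_trial_plane
  obtain ⟨C₂, R₂, hC₂, -, hlow⟩ := P.exists_le_magSq
  refine ⟨C₁ + C₂ + 1, by positivity, max R₁ R₂, hR₁.trans (le_max_left _ _), fun R hR => ?_⟩
  have hRR₁ := (le_max_left _ _).trans hR
  have hR0 : 0 < R := by linarith
  have hh0 : 0 < R⁻¹ := inv_pos.2 hR0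
  obtain ⟨u, hu, hu0, hle⟩ := htrial R hRR₁
  have hup := (lam1_le hu hu0.ne').trans ((div_le_iff₀ hu0).2 hle)
  have hlo := le_lam1 hu hu0.ne' (hlow R ((le_max_right _ _).trans hR))
  have e : ∀ C : ℝ, R ^ 2 * (C * R⁻¹ ^ 3) = C * R⁻¹ := fun C => by field_simp
  rw [mul_add, e] at hup
  rw [mul_sub, e] at hlo
  have := mul_nonneg hC₁ hh0.le
  have := mul_nonneg hC₂ hh0.le
  rw [abs_le]
  constructor <;> linarith

end Profile

theorem DeGennes.sq_mul_level (D : DeGennes) {B : ℝ} (hB : 0 < B) (Δ : ℝ) :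
    B * D.profile.level (√B)⁻¹ Δ = Theta0 * B - D.C1 * √B +
      3 * D.C1 * √Theta0 * (Δ ^ 2 + D.profile.const₀) := by
  have hθ : √Theta0 = -D.ξ₀ := by
    rw [← D.ξ₀_sq, ← neg_sq, Real.sqrt_sq (by linarith [D.ξ₀_mem.2])]
  have hv : D.profile.v 0 = D.u₀ 0 := congrArg D.u₀ abs_zero
  have hξ : D.profile.ξ = D.ξ₀ := rfl
  have hs : 0 < √B := Real.sqrt_pos.2 hB
  have hB' : B = √B ^ 2 := (Real.sq_sqrt hB.le).symm
  rw [Profile.level, Profile.avg_srcβ, Profile.avg_src₁, hv, hξ, hθ, DeGennes.C1, ← D.ξ₀_sq]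
  generalize √B = s at *
  subst hB'
  field_simp
  ring

end SC

/-- Two-term (plus oscillatory correction) eigenvalue asymptotics for the disc:
`λ₁(B) = Θ₀ B - C₁ √B + 3 C₁ √Θ₀ (Δ_B² + C₀) + O(B^{-1/2})`. -/
theorem lam1_disc_asymptotics (D : SC.DeGennes) :
    ∃ C₀ δ₀ : ℝ, ∃ C > 0, ∃ B₀ > 0, ∀ B ≥ B₀,
      |SC.lam1 SC.unitDisc B - (SC.Theta0 * B - D.C1 * Real.sqrt B +
          3 * D.C1 * Real.sqrt SC.Theta0 * ((SC.DeltaB D.ξ₀ δ₀ B) ^ 2 + C₀))|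
        ≤ C * B ^ (-(1 : ℝ) / 2) := by
  obtain ⟨C, hC, R₀, hR₀, H⟩ := D.profile.exists_lam1_sub_level_le
  refine ⟨D.profile.const₀, D.profile.shift₀, C, hC, R₀ ^ 2, by positivity, fun B hB => ?_⟩
  have hB0 : 0 < B := lt_of_lt_of_le (by positivity) hB
  have h := H (√B) (Real.le_sqrt_of_sq_le hB)
  rw [Real.sq_sqrt hB0.le, D.sq_mul_level hB0] at h
  rwa [neg_div, Real.rpow_neg hB0.le, ← Real.sqrt_eq_rpow]
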